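/- Let 1/2 < s ≤ 1 and 0 < t ≤ 1, and let F ⊆ ℝ² be a circular (s,t)-Furstenberg set. Then the Hausdorff dimension of F satisfies dim_H F ≥ (2s−1)t + s. -/

import Mathlib

lemma quad_I1 (c x e c' y e' C x2 f C' y2 f' : ℝ) (h1 : c' - c = C' - C)
    (h2 : c' * y - c * x = C' * y2 - C * x2) :
    (c' - c) * (x2 - x) = c' * (y - x) - C' * (y2 - x2) := by
  linear_combination x2 * h1 - h2

lemma quad_I2 (c x e c' y e' C x2 f C' y2 f' : ℝ) (h1 : c' - c = C' - C)
    (h2 : c' * y - c * x = C' * y2 - C * x2)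
    (h3 : c' * y ^ 2 + e' - c * x ^ 2 - e = C' * y2 ^ 2 + f' - C * x2 ^ 2 - f) :
    (x2 - x) * (c' * (y - x) + C' * (y2 - x2)) =
      c' * (y - x) ^ 2 - C' * (y2 - x2) ^ 2 + ((e' - e) - (f' - f)) := by
  linear_combination (-x*x2) * h1 + (x+x2) * h2 -  h3

lemma quad_I3 (c x e c' y e' C x2 f C' y2 f' : ℝ) (h1 : c' - c = C' - C)
    (h2 : c' * y - c * x = C' * y2 - C * x2)
    (h3 : c' * y ^ 2 + e' - c * x ^ 2 - e = C' * y2 ^ 2 + f' - C * x2 ^ 2 - f) :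
    (y2 - y) * (c * (y - x) + C * (y2 - x2)) =
      -(c * (y - x) ^ 2 - C * (y2 - x2) ^ 2) + ((e' - e) - (f' - f)) := by
  linear_combination (-y*y2) * h1 + (y+y2) * h2 -  h3

lemma quad_I5 (c x e c' y e' C x2 f C' y2 f' : ℝ) (h1 : c' - c = C' - C)
    (h2 : c' * y - c * x = C' * y2 - C * x2)
    (h3 : c' * y ^ 2 + e' - c * x ^ 2 - e = C' * y2 ^ 2 + f' - C * x2 ^ 2 - f) :
    c' * (y - x) * (y2 - y) + C * (x2 - x) * (y2 - x2) = ((e' - e) - (f' - f)) := by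
  linear_combination (-x*y2) * h1 + (y2 + x) * h2 -  h3

lemma quad_H (c x e c' y e' κ l ν : ℝ) (h1 : c' - c = κ)
    (h2 : c' * y - c * x = l)
    (h3 : c' * y ^ 2 + e' - c * x ^ 2 - e = ν) :
    c * c' * (y - x) ^ 2 = l ^ 2 - κ * ν + κ * (e' - e) := by
  subst h1 h2 h3; ring

noncomputable section

/-- signed truncated indicator -/
def psiF (ρ : ℝ) (j : ℕ) (X : ℝ) : ℝ :=
  if ρ ≤ |X| ∧ |X| ≤ 2 ^ j * ρ then (if X < 0 then -1 else 1) else 0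

def sigF (ρ : ℝ) (E : ℝ) : ℝ :=
  if 10 * ρ ≤ |E| then (if E < 0 then -1 else 1) else 0

open Classical in
def cntJ (ρ : ℝ) (M : ℕ) (Z : ℝ) : ℝ :=
  ((Finset.range M).filter (fun j : ℕ => Z ≤ 2 ^ j * ρ)).card

open Classical in
lemma cntJ_sum (ρ : ℝ) (M : ℕ) (Z : ℝ) :
    cntJ ρ M Z = ∑ j ∈ Finset.range M, if Z ≤ 2 ^ j * ρ then (1:ℝ) else 0 := by
  unfold cntJ
  rw [Finset.sum_boole]

lemma psi_le_one (ρ : ℝ) (j : ℕ) (X Y : ℝ) : psiF ρ j X * psiF ρ j Y ≤ 1 := by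
  unfold psiF; split_ifs <;> norm_num

lemma sum_psi_le (ρ : ℝ) (M : ℕ) (X Y : ℝ) :
    ∑ j ∈ Finset.range M, psiF ρ j X * psiF ρ j Y ≤ M := by
  calc _ ≤ ∑ j ∈ Finset.range M, (1:ℝ) := Finset.sum_le_sum (fun j _ => psi_le_one ρ j X Y)
    _ = M := by simp

lemma psi_near (ρ : ℝ) (j : ℕ) (X : ℝ) (h : |X| < ρ) : psiF ρ j X = 0 := by
  unfold psiF; rw [if_neg]; rintro ⟨h1, _⟩; linarith

/-- J + 1 ≤ M -/
lemma cntJ_lt (ρ : ℝ) (M : ℕ) (hM : 1 ≤ M) (Z : ℝ) (hZ : ρ < Z) : cntJ ρ M Z + 1 ≤ M := by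
  classical
  unfold cntJ
  have : ((Finset.range M).filter (fun j : ℕ => Z ≤ 2 ^ j * ρ)).card < M := by
    conv_rhs => rw [← Finset.card_range M]
    apply Finset.card_lt_card
    rw [Finset.filter_ssubset]
    refine ⟨0, by simp; omega, ?_⟩
    simpa using hZ
  exact_mod_cast this

lemma cntJ_step (ρ : ℝ) (hρ : 0 < ρ) (M : ℕ) (hM : 1 ≤ M) (S : ℝ) (hS : ρ < 50 * S) (hS0 : 0 < S)
    (hSM : S ≤ 2 ^ (M - 1) * ρ) : cntJ ρ M (50 * S) + 1 ≤ cntJ ρ M S := by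
  classical
  unfold cntJ
  have hex : ∃ j : ℕ, S ≤ 2 ^ j * ρ := ⟨_, hSM⟩
  set j := Nat.find hex with hj
  have h1 : S ≤ 2 ^ j * ρ := Nat.find_spec hex
  have h2 : j ≤ M - 1 := Nat.find_min' hex hSM
  have h3 : 2 ^ j * ρ < 50 * S := by
    rcases Nat.eq_zero_or_pos j with h | h
    · rw [h]; simpa using hS
    · have := Nat.find_min hex (m := j - 1) (by omega)
      obtain ⟨i, hi⟩ : ∃ i, j = i + 1 := ⟨j - 1, by omega⟩
      rw [hi] at this ⊢
      simp only [Nat.add_sub_cancel, not_le] at this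
      rw [pow_succ]; nlinarith
  have : ((Finset.range M).filter (fun j : ℕ => 50 * S ≤ 2 ^ j * ρ)).card <
      ((Finset.range M).filter (fun j : ℕ => S ≤ 2 ^ j * ρ)).card := by
    apply Finset.card_lt_card
    rw [Finset.ssubset_iff_of_subset]
    · refine ⟨j, ?_, ?_⟩
      · simp only [Finset.mem_filter, Finset.mem_range]; exact ⟨by omega, h1⟩
      · simp only [Finset.mem_filter, Finset.mem_range, not_and, not_le]; intro _; exact h3
    · intro i; simp only [Finset.mem_filter, Finset.mem_range]
      rintro ⟨h, h'⟩; exact ⟨h, by linarith⟩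
  exact_mod_cast this

/-- size of `E` versus `S = sqrt H` -/
lemma good_size (ρ c x e c' y e' κ l ν S : ℝ) (hρ : 0 < ρ) (hc : 1 ≤ c ∧ c ≤ 1.01)
    (hc' : 1 ≤ c' ∧ c' ≤ 1.01) (he : |e| ≤ ρ ^ 2) (he' : |e'| ≤ ρ ^ 2) (h1 : c' - c = κ)
    (h2 : c' * y - c * x = l) (h3 : c' * y ^ 2 + e' - c * x ^ 2 - e = ν)
    (hE : 10 * ρ ≤ |y - x|) (hS : S = Real.sqrt (l ^ 2 - κ * ν)) :
    |y - x| ≤ 1.01 * S ∧ S ≤ 1.02 * |y - x| ∧ 9 * ρ ≤ S := by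
  have hH := quad_H c x e c' y e' κ l ν h1 h2 h3
  have hk : |κ| ≤ 0.01 := by rw [← h1, abs_le]; constructor <;> linarith [hc.1, hc.2, hc'.1, hc'.2]
  have hee : |e' - e| ≤ 2 * ρ ^ 2 := by
    rw [abs_le] at *; constructor <;> linarith [he.1, he.2, he'.1, he'.2]
  have hke : |κ * (e' - e)| ≤ 0.02 * ρ ^ 2 := by
    rw [abs_mul]
    calc |κ| * |e' - e| ≤ 0.01 * (2 * ρ ^ 2) := by gcongr
      _ = _ := by ring
  have hEE : |y - x| ^ 2 = (y - x) ^ 2 := sq_abs _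
  have hE2 : 100 * ρ ^ 2 ≤ (y - x) ^ 2 := by rw [← hEE]; nlinarith
  have hcc1 : 1 ≤ c * c' := by nlinarith [hc.1, hc'.1]
  have hcc2 : c * c' ≤ 1.0201 := by nlinarith [hc.1, hc'.1, hc.2, hc'.2]
  rw [abs_le] at hke
  have hsq := sq_nonneg (y - x)
  have hl : 0.9998 * (y - x) ^ 2 ≤ l ^ 2 - κ * ν := by
    have : 1 * (y - x) ^ 2 ≤ c * c' * (y - x) ^ 2 := by gcongr
    linarith [hke.1, hke.2]
  have hu : l ^ 2 - κ * ν ≤ 1.0203 * (y - x) ^ 2 := by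
    have : c * c' * (y - x) ^ 2 ≤ 1.0201 * (y - x) ^ 2 := by gcongr
    linarith [hke.1, hke.2]
  have hS0 : 0 ≤ S := by rw [hS]; exact Real.sqrt_nonneg _
  have hSS : S ^ 2 = l ^ 2 - κ * ν := by rw [hS]; exact Real.sq_sqrt (by linarith)
  have ha := abs_nonneg (y - x)
  have A1 : |y - x| ≤ 1.01 * S := by
    rw [← pow_le_pow_iff_left₀ ha (by linarith) (two_ne_zero)]
    rw [hEE, mul_pow, hSS]; linarith
  refine ⟨A1, ?_, by linarith⟩
  rw [← pow_le_pow_iff_left₀ hS0 (by linarith) (two_ne_zero)]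
  rw [mul_pow, hEE, hSS]; linarith

lemma same_bound_pos (X a b E E2 S ρ g : ℝ) (hρ : 0 < ρ) (ha : 1 ≤ a ∧ a ≤ 1.01)
    (hb : 1 ≤ b ∧ b ≤ 1.01) (hE : 0 < E) (hE2 : 0 < E2) (h1 : E ≤ 1.01 * S)
    (h2 : S ≤ 1.02 * E) (h1' : E2 ≤ 1.01 * S)
    (h2' : S ≤ 1.02 * E2) (h3 : 9 * ρ ≤ S) (hg : |g| ≤ 4 * ρ ^ 2)
    (h : X * (a * E + b * E2) = (a * E ^ 2 - b * E2 ^ 2) + g) : |X| ≤ S := by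
  have hS : 0 < S := by linarith
  have q1 : S ≤ 1.02 * (a * E) := by nlinarith
  have q2 : S ≤ 1.02 * (b * E2) := by nlinarith
  have r1 : a * E ^ 2 ≤ 1.04 * S ^ 2 := by
    calc a * E ^ 2 ≤ 1.01 * (1.01 * S) ^ 2 := by gcongr; exact ha.2
      _ ≤ _ := by nlinarith
  have r2 : b * E2 ^ 2 ≤ 1.04 * S ^ 2 := by
    calc b * E2 ^ 2 ≤ 1.01 * (1.01 * S) ^ 2 := by gcongr; exact hb.2
      _ ≤ _ := by nlinarith
  have r3 : 0 ≤ a * E ^ 2 := mul_nonneg (by linarith [ha.1]) (sq_nonneg _)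
  have r4 : 0 ≤ b * E2 ^ 2 := mul_nonneg (by linarith [hb.1]) (sq_nonneg _)
  have r5 : 81 * ρ ^ 2 ≤ S ^ 2 := by nlinarith
  have hD : S * 1.9 ≤ a * E + b * E2 := by linarith
  have hD0 : 0 < a * E + b * E2 := by linarith
  have hbd : |X * (a * E + b * E2)| ≤ S * (a * E + b * E2) := by
    rw [h]
    have : S * (S * 1.9) ≤ S * (a * E + b * E2) := by gcongr
    rw [abs_le] at hg ⊢
    constructor <;> nlinarith [hg.1, hg.2]
  rw [abs_mul, abs_of_pos hD0] at hbd
  exact le_of_mul_le_mul_right hbd hD0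

lemma same_bound (X a b E E2 S ρ g : ℝ) (hρ : 0 < ρ) (ha : 1 ≤ a ∧ a ≤ 1.01)
    (hb : 1 ≤ b ∧ b ≤ 1.01) (hE : (0 < E ∧ 0 < E2) ∨ (E < 0 ∧ E2 < 0)) (h1 : |E| ≤ 1.01 * S)
    (h2 : S ≤ 1.02 * |E|) (h1' : |E2| ≤ 1.01 * S)
    (h2' : S ≤ 1.02 * |E2|) (h3 : 9 * ρ ≤ S) (hg : |g| ≤ 4 * ρ ^ 2)
    (h : X * (a * E + b * E2) = (a * E ^ 2 - b * E2 ^ 2) + g) : |X| ≤ S := by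
  rcases hE with ⟨p, q⟩ | ⟨p, q⟩
  · rw [abs_of_pos p] at h1 h2; rw [abs_of_pos q] at h1' h2'
    exact same_bound_pos X a b E E2 S ρ g hρ ha hb p q h1 h2 h1' h2' h3 hg h
  · rw [abs_of_neg p] at h1 h2; rw [abs_of_neg q] at h1' h2'
    rw [← abs_neg]
    exact same_bound_pos (-X) a b (-E) (-E2) S ρ g hρ ha hb (by linarith) (by linarith)
      h1 h2 h1' h2' h3 hg (by linarith)

lemma opp_sign (X Y a b E E2 ρ g : ℝ) (hρ : 0 < ρ) (ha : 1 ≤ a)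
    (hb : 1 ≤ b) (hE : (0 < E ∧ 0 < E2) ∨ (E < 0 ∧ E2 < 0)) (h1 : 10 * ρ ≤ |E|)
    (h2 : 10 * ρ ≤ |E2|) (hX : ρ ≤ |X|) (hY : ρ ≤ |Y|) (hg : |g| ≤ 4 * ρ ^ 2)
    (h : a * E * Y + b * X * E2 = g) : (0 < X ∧ Y < 0) ∨ (X < 0 ∧ 0 < Y) := by
  have key : ∀ X Y E E2 g : ℝ, 10 * ρ ≤ E → 10 * ρ ≤ E2 → ρ ≤ X → ρ ≤ Y → |g| ≤ 4 * ρ ^ 2 →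
      a * E * Y + b * X * E2 ≠ g := by
    intro X Y E E2 g k1 k2 k3 k4 k5 k6
    have e1 : 1 * (10 * ρ) * ρ ≤ a * E * Y := by
      have : 0 ≤ a * E := by apply mul_nonneg <;> linarith
      gcongr
    have e2 : 1 * ρ * (10 * ρ) ≤ b * X * E2 := by
      have : 0 ≤ b * X := by apply mul_nonneg <;> linarith
      gcongr
    rw [abs_le] at k5
    nlinarith [k5.2]
  have hX0 : X ≠ 0 := by rintro rfl; simp at hX; linarith
  have hY0 : Y ≠ 0 := by rintro rfl; simp at hY; linarith
  have hg' : |-g| ≤ 4 * ρ ^ 2 := by rwa [abs_neg]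
  rcases hE with ⟨p, q⟩ | ⟨p, q⟩
  · rw [abs_of_pos p] at h1; rw [abs_of_pos q] at h2
    rcases lt_or_gt_of_ne hX0 with x | x <;> rcases lt_or_gt_of_ne hY0 with y | y
    · rw [abs_of_neg x] at hX; rw [abs_of_neg y] at hY
      exact absurd (by linarith) (key (-X) (-Y) E E2 (-g) h1 h2 hX hY hg')
    · exact Or.inr ⟨x, y⟩
    · exact Or.inl ⟨x, y⟩
    · rw [abs_of_pos x] at hX; rw [abs_of_pos y] at hY
      exact absurd (by linarith) (key X Y E E2 g h1 h2 hX hY hg)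
  · rw [abs_of_neg p] at h1; rw [abs_of_neg q] at h2
    rcases lt_or_gt_of_ne hX0 with x | x <;> rcases lt_or_gt_of_ne hY0 with y | y
    · rw [abs_of_neg x] at hX; rw [abs_of_neg y] at hY
      exact absurd (by linarith) (key (-X) (-Y) (-E) (-E2) g h1 h2 hX hY hg)
    · exact Or.inr ⟨x, y⟩
    · exact Or.inl ⟨x, y⟩
    · rw [abs_of_pos x] at hX; rw [abs_of_pos y] at hY
      exact absurd (by linarith) (key X Y (-E) (-E2) (-g) h1 h2 hX hY hg')

lemma diff_bound (X a b E E2 S κ : ℝ) (hκ : |κ| ≤ 0.01) (ha : 1 ≤ a) (hb : 1 ≤ b) (hS : 0 < S)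
    (hE : (0 < E ∧ E2 < 0) ∨ (E < 0 ∧ 0 < E2))
    (h2 : S ≤ 1.02 * |E|) (h : κ * X = a * E - b * E2) : 50 * S ≤ |X| := by
  have h3 : |κ| * |X| ≤ 0.01 * |X| := by gcongr
  rw [← abs_mul, h] at h3
  rcases hE with ⟨p, q⟩ | ⟨p, q⟩
  · rw [abs_of_pos p] at h2
    have := le_abs_self (a * E - b * E2)
    nlinarith
  · rw [abs_of_neg p] at h2
    have := neg_abs_le (a * E - b * E2)
    nlinarith

lemma pointwise_theta (ρ : ℝ) (M : ℕ) (c x e c' y e' C x2 f C' y2 f' κ l ν : ℝ) (hρ : 0 < ρ)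
    (hM : 1 ≤ M) (hMρ : 3 ≤ 2 ^ (M - 1) * ρ)
    (hc : 1 ≤ c ∧ c ≤ 1.01) (hc' : 1 ≤ c' ∧ c' ≤ 1.01) (hC : 1 ≤ C ∧ C ≤ 1.01)
    (hC' : 1 ≤ C' ∧ C' ≤ 1.01)
    (he : |e| ≤ ρ ^ 2) (he' : |e'| ≤ ρ ^ 2) (hf : |f| ≤ ρ ^ 2) (hf' : |f'| ≤ ρ ^ 2)
    (hx : |x| ≤ 1) (hy : |y| ≤ 1)
    (h1 : c' - c = κ)
    (h2 : c' * y - c * x = l) (h3 : c' * y ^ 2 + e' - c * x ^ 2 - e = ν)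
    (k1 : C' - C = κ)
    (k2 : C' * y2 - C * x2 = l) (k3 : C' * y2 ^ 2 + f' - C * x2 ^ 2 - f = ν) :
    ∑ j ∈ Finset.range M, psiF ρ j (x2 - x) * psiF ρ j (y2 - y) ≤
      - (1 / 2) * (sigF ρ (y - x) ^ 2 * sigF ρ (y2 - x2) ^ 2)
      - (cntJ ρ M (50 * Real.sqrt (l ^ 2 - κ * ν)) + 1 / 2) * (sigF ρ (y - x) * sigF ρ (y2 - x2))
      + M * (if |x2 - x| < ρ ∨ |y2 - y| < ρ then 1 else 0)
      + M * (1 - sigF ρ (y - x) ^ 2 * sigF ρ (y2 - x2) ^ 2) := by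
  classical
  have hn0 : (0:ℝ) ≤ (if |x2 - x| < ρ ∨ |y2 - y| < ρ then (1:ℝ) else 0) := by split_ifs <;> norm_num
  have hM0 : (0:ℝ) ≤ M := by positivity
  by_cases hE : 10 * ρ ≤ |y - x|
  swap
  · have : sigF ρ (y - x) = 0 := by unfold sigF; rw [if_neg hE]
    rw [this]
    have := sum_psi_le ρ M (x2 - x) (y2 - y)
    have h' : 0 ≤ (M:ℝ) * (if |x2 - x| < ρ ∨ |y2 - y| < ρ then (1:ℝ) else 0) := mul_nonneg hM0 hn0
    linarith
  by_cases hE2 : 10 * ρ ≤ |y2 - x2|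
  swap
  · have : sigF ρ (y2 - x2) = 0 := by unfold sigF; rw [if_neg hE2]
    rw [this]
    have := sum_psi_le ρ M (x2 - x) (y2 - y)
    have h' : 0 ≤ (M:ℝ) * (if |x2 - x| < ρ ∨ |y2 - y| < ρ then (1:ℝ) else 0) := mul_nonneg hM0 hn0
    linarith
  set S := Real.sqrt (l ^ 2 - κ * ν) with hS
  obtain ⟨g1, g2, g3⟩ := good_size ρ c x e c' y e' κ l ν S hρ hc hc' he he' h1 h2 h3 hE hS
  obtain ⟨g1', g2', g3'⟩ := good_size ρ C x2 f C' y2 f' κ l ν S hρ hC hC' hf hf' k1 k2 k3 hE2 hS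
  have hS0 : 0 < S := by linarith
  have hJM := cntJ_lt ρ M hM (50 * S) (by linarith)
  have hJ0 : 0 ≤ cntJ ρ M (50 * S) := by unfold cntJ; positivity
  have hs1 : sigF ρ (y - x) ^ 2 = 1 := by unfold sigF; rw [if_pos hE]; split_ifs <;> norm_num
  have hs2 : sigF ρ (y2 - x2) ^ 2 = 1 := by unfold sigF; rw [if_pos hE2]; split_ifs <;> norm_num
  have hsp : sigF ρ (y - x) * sigF ρ (y2 - x2) = 1 ∨ sigF ρ (y - x) * sigF ρ (y2 - x2) = -1 := by
    unfold sigF; rw [if_pos hE, if_pos hE2]; split_ifs <;> norm_num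
  rw [hs1, hs2]
  by_cases hn : |x2 - x| < ρ ∨ |y2 - y| < ρ
  · have hz : ∑ j ∈ Finset.range M, psiF ρ j (x2 - x) * psiF ρ j (y2 - y) = 0 := by
      apply Finset.sum_eq_zero
      intro j _
      rcases hn with h | h <;> rw [psi_near ρ j _ h] <;> simp
    rw [hz, if_pos hn]
    rcases hsp with h | h <;> rw [h] <;> linarith
  rw [if_neg hn]
  push Not at hn
  obtain ⟨nX, nY⟩ := hn
  have hk : |κ| ≤ 0.01 := by rw [← h1, abs_le]; constructor <;> linarith [hc.1, hc.2, hc'.1, hc'.2]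
  have i1 := quad_I1 c x e c' y e' C x2 f C' y2 f' (by linarith) (by linarith)
  have i2 := quad_I2 c x e c' y e' C x2 f C' y2 f' (by linarith) (by linarith) (by linarith)
  have i3 := quad_I3 c x e c' y e' C x2 f C' y2 f' (by linarith) (by linarith) (by linarith)
  have i5 := quad_I5 c x e c' y e' C x2 f C' y2 f' (by linarith) (by linarith) (by linarith)
  have herr : |(e' - e) - (f' - f)| ≤ 4 * ρ ^ 2 := by
    rw [abs_le] at *; constructor <;> linarith [he.1, he.2, he'.1, he'.2, hf.1, hf.2, hf'.1, hf'.2]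
  rcases hsp with h | h
  · -- same type
    rw [h]
    have hsame : (0 < y - x ∧ 0 < y2 - x2) ∨ (y - x < 0 ∧ y2 - x2 < 0) := by
      unfold sigF at h; rw [if_pos hE, if_pos hE2] at h
      split_ifs at h with q1 q2 q2
      · right; exact ⟨q1, q2⟩
      · norm_num at h
      · norm_num at h
      · left
        push Not at q1 q2
        rw [abs_of_nonneg q1] at hE; rw [abs_of_nonneg q2] at hE2
        constructor <;> linarith
    have hXY : (0 < x2 - x ∧ y2 - y < 0) ∨ (x2 - x < 0 ∧ 0 < y2 - y) := 
      opp_sign _ _ c' C (y - x) (y2 - x2) ρ _ hρ hc'.1 hC.1 hsame hE hE2 nX nY herr i5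
    have bX : |x2 - x| ≤ S :=
      same_bound _ c' C' (y - x) (y2 - x2) S ρ _ hρ hc' hC' hsame g1 g2 g1' g2' g3 herr i2
    have bY : |y2 - y| ≤ S := by
      rw [← abs_neg]
      refine same_bound _ c C (y - x) (y2 - x2) S ρ (-((e' - e) - (f' - f))) hρ hc hC hsame
        g1 g2 g1' g2' g3 (by rwa [abs_neg]) (by linarith)
    have hst := cntJ_step ρ hρ M hM S (by linarith) hS0 (by
      rw [abs_le] at hx hy
      have : |y - x| ≤ 2 := by rw [abs_le]; constructor <;> linarith [hx.1, hx.2, hy.1, hy.2]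
      linarith)
    have : ∑ j ∈ Finset.range M, psiF ρ j (x2 - x) * psiF ρ j (y2 - y) ≤ - cntJ ρ M S := by
      rw [cntJ_sum, ← Finset.sum_neg_distrib]
      apply Finset.sum_le_sum
      intro j _
      by_cases hj : S ≤ 2 ^ j * ρ
      · rw [if_pos hj]
        unfold psiF
        have z1 : ρ ≤ |x2 - x| ∧ |x2 - x| ≤ 2 ^ j * ρ := ⟨nX, by linarith⟩
        have z2 : ρ ≤ |y2 - y| ∧ |y2 - y| ≤ 2 ^ j * ρ := ⟨nY, by linarith⟩
        simp only [z1, z2, and_self, if_true]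
        rcases hXY with ⟨p, q⟩ | ⟨p, q⟩
        · rw [if_neg (not_lt.2 p.le), if_pos q]; norm_num
        · rw [if_pos p, if_neg (not_lt.2 q.le)]; norm_num
      · rw [if_neg hj]
        unfold psiF
        rcases hXY with ⟨p, q⟩ | ⟨p, q⟩
        · rw [if_neg (not_lt.2 p.le), if_pos q]; split_ifs <;> norm_num
        · rw [if_pos p, if_neg (not_lt.2 q.le)]; split_ifs <;> norm_num
    linarith
  · rw [h]
    have bX : 50 * S ≤ |x2 - x| := by
      refine diff_bound _ c' C' (y - x) (y2 - x2) S κ hk hc'.1 hC'.1 hS0 ?_ g2 (h1 ▸ i1)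
      unfold sigF at h; rw [if_pos hE, if_pos hE2] at h
      split_ifs at h with q1 q2 q2
      · norm_num at h
      · right; refine ⟨q1, lt_of_le_of_ne (not_lt.1 q2) ?_⟩
        intro q; rw [← q, abs_zero] at hE2; linarith
      · left; refine ⟨lt_of_le_of_ne (not_lt.1 q1) ?_, q2⟩
        intro q; rw [← q, abs_zero] at hE; linarith
      · norm_num at h
    have : ∑ j ∈ Finset.range M, psiF ρ j (x2 - x) * psiF ρ j (y2 - y) ≤ cntJ ρ M (50 * S) := by
      rw [cntJ_sum]
      apply Finset.sum_le_sum
      intro j _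
      by_cases hj : 50 * S ≤ 2 ^ j * ρ
      · rw [if_pos hj]; exact psi_le_one _ _ _ _
      · rw [if_neg hj]
        have : psiF ρ j (x2 - x) = 0 := by
          unfold psiF; rw [if_neg]; rintro ⟨_, q⟩; linarith
        rw [this]; simp
    linarith
end

noncomputable section
open Finset

lemma sum_comm4 {ι κ : Type*} (A A' : Finset ι) (B B' : Finset κ) (f : ι → ι → κ → κ → ℝ) :
    ∑ a ∈ A, ∑ a' ∈ A', ∑ b ∈ B, ∑ b' ∈ B', f a a' b b' =
    ∑ b ∈ B, ∑ b' ∈ B', ∑ a ∈ A, ∑ a' ∈ A', f a a' b b' := by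
  calc _ = ∑ a ∈ A, ∑ b ∈ B, ∑ a' ∈ A', ∑ b' ∈ B', f a a' b b' :=
        sum_congr rfl fun a _ => sum_comm
    _ = ∑ b ∈ B, ∑ a ∈ A, ∑ a' ∈ A', ∑ b' ∈ B', f a a' b b' := sum_comm
    _ = ∑ b ∈ B, ∑ a ∈ A, ∑ b' ∈ B', ∑ a' ∈ A', f a a' b b' :=
        sum_congr rfl fun b _ => sum_congr rfl fun a _ => sum_comm
    _ = _ := sum_congr rfl fun b _ => sum_comm

lemma theta_sum_nonneg {ι κ : Type*} (A : Finset ι) (B : Finset κ) (u x : ι → κ → ℝ) (ρ : ℝ)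
    (M : ℕ) :
    0 ≤ ∑ a ∈ A, ∑ a' ∈ A, ∑ b ∈ B, ∑ b' ∈ B, (u a b * u a' b) * (u a b' * u a' b') *
      ∑ j ∈ range M, psiF ρ j (x a b' - x a b) * psiF ρ j (x a' b' - x a' b) := by
  rw [sum_comm4]
  refine sum_nonneg fun b _ => sum_nonneg fun b' _ => ?_
  have : ∑ a ∈ A, ∑ a' ∈ A, (u a b * u a' b) * (u a b' * u a' b') *
      ∑ j ∈ range M, psiF ρ j (x a b' - x a b) * psiF ρ j (x a' b' - x a' b) =
      ∑ j ∈ range M, (∑ a ∈ A, u a b * u a b' * psiF ρ j (x a b' - x a b)) ^ 2 := by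
    simp_rw [sq, sum_mul_sum, mul_sum]
    calc _ = ∑ a ∈ A, ∑ j ∈ range M, ∑ a' ∈ A, (u a b * u a' b) * (u a b' * u a' b') *
          (psiF ρ j (x a b' - x a b) * psiF ρ j (x a' b' - x a' b)) :=
          sum_congr rfl fun a _ => sum_comm
      _ = ∑ j ∈ range M, ∑ a ∈ A, ∑ a' ∈ A, (u a b * u a' b) * (u a b' * u a' b') *
          (psiF ρ j (x a b' - x a b) * psiF ρ j (x a' b' - x a' b)) := sum_comm
      _ = _ := sum_congr rfl fun j _ => sum_congr rfl fun a _ => sum_congr rfl fun a' _ => by ring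
  rw [this]
  exact sum_nonneg fun j _ => sq_nonneg _

def SuppOK {ι κ : Type*} (A : Finset ι) (B : Finset κ) (u x c e : ι → κ → ℝ) (ρ : ℝ)
    (p1 p2 p3 : ι → ℝ) (q1 q2 q3 : κ → ℝ) : Prop :=
  ∀ a ∈ A, ∀ b ∈ B, u a b ≠ 0 → (1 ≤ c a b ∧ c a b ≤ 1.01) ∧ |e a b| ≤ ρ ^ 2 ∧ |x a b| ≤ 1 ∧
    p1 a - q1 b = c a b ∧ p2 a - q2 b = c a b * x a b ∧ p3 a - q3 b = c a b * x a b ^ 2 + e a b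

/-- inequality for a fixed pair of rows -/
lemma pair_ineq {ι κ : Type*} (A : Finset ι) (B : Finset κ) (u x c e : ι → κ → ℝ) (ρ : ℝ)
    (p1 p2 p3 : ι → ℝ) (q1 q2 q3 : κ → ℝ) (h : SuppOK A B u x c e ρ p1 p2 p3 q1 q2 q3)
    (hu : ∀ a b, 0 ≤ u a b) (hρ : 0 < ρ) (M : ℕ) (hM : 1 ≤ M) (hMρ : 3 ≤ 2 ^ (M - 1) * ρ)
    (a a' : ι) (ha : a ∈ A) (ha' : a' ∈ A) :
    ∑ b ∈ B, ∑ b' ∈ B, (u a b * u a' b) * (u a b' * u a' b') *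
      ∑ j ∈ range M, psiF ρ j (x a b' - x a b) * psiF ρ j (x a' b' - x a' b) ≤
    - (1 / 2) * (∑ b ∈ B, u a b * u a' b) ^ 2 +
    M * (∑ b ∈ B, ∑ b' ∈ B, (u a b * u a' b) * (u a b' * u a' b') *
      (if |x a b' - x a b| < ρ ∨ |x a' b' - x a' b| < ρ then 1 else 0)) +
    (2 * M + 1) * (∑ b ∈ B, ∑ b' ∈ B, (u a b * u a' b) * (u a b' * u a' b') *
      (if |x a' b - x a b| < 10 * ρ then 1 else 0)) := by
  classical
  set w : κ → ℝ := fun b => u a b * u a' b with hw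
  have hw0 : ∀ b, 0 ≤ w b := fun b => mul_nonneg (hu _ _) (hu _ _)
  set S : κ → ℝ := fun b => sigF ρ (x a' b - x a b) with hS
  set n : κ → κ → ℝ := fun b b' => if |x a b' - x a b| < ρ ∨ |x a' b' - x a' b| < ρ then 1 else 0
    with hn
  set J := cntJ ρ M (50 * Real.sqrt ((p2 a' - p2 a) ^ 2 - (p1 a' - p1 a) * (p3 a' - p3 a))) with hJ
  have hJ0 : 0 ≤ J := by rw [hJ]; unfold cntJ; positivity
  have hpt : ∀ b ∈ B, ∀ b' ∈ B, w b * w b' *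
      ∑ j ∈ range M, psiF ρ j (x a b' - x a b) * psiF ρ j (x a' b' - x a' b) ≤
      w b * w b' * (- (1 / 2) * (S b ^ 2 * S b' ^ 2) - (J + 1 / 2) * (S b * S b') + M * n b b' +
        M * (1 - S b ^ 2 * S b' ^ 2)) := by
    intro b hb b' hb'
    by_cases hz : w b * w b' = 0
    · rw [hz]; simp
    have hz1 : u a b ≠ 0 := by rintro hh; apply hz; simp [hw, hh]
    have hz2 : u a' b ≠ 0 := by rintro hh; apply hz; simp [hw, hh]
    have hz3 : u a b' ≠ 0 := by rintro hh; apply hz; simp [hw, hh]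
    have hz4 : u a' b' ≠ 0 := by rintro hh; apply hz; simp [hw, hh]
    obtain ⟨c1, e1, x1, d1, f1, g1⟩ := h a ha b hb hz1
    obtain ⟨c2, e2, x2, d2, f2, g2⟩ := h a' ha' b hb hz2
    obtain ⟨c3, e3, x3, d3, f3, g3⟩ := h a ha b' hb' hz3
    obtain ⟨c4, e4, x4, d4, f4, g4⟩ := h a' ha' b' hb' hz4
    apply mul_le_mul_of_nonneg_left _ (mul_nonneg (hw0 _) (hw0 _))
    exact pointwise_theta ρ M (c a b) (x a b) (e a b) (c a' b) (x a' b) (e a' b)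
      (c a b') (x a b') (e a b') (c a' b') (x a' b') (e a' b')
      (p1 a' - p1 a) (p2 a' - p2 a) (p3 a' - p3 a) hρ hM hMρ c1 c2 c3 c4 e1 e2 e3 e4 x1 x2
      (by linarith) (by linarith) (by linarith) (by linarith) (by linarith) (by linarith)
  have hsum := sum_le_sum fun b hb => sum_le_sum fun b' hb' => hpt b hb b' hb'
  refine hsum.trans ?_
  set k := ∑ b ∈ B, w b with hk
  set k2 := ∑ b ∈ B, w b * S b ^ 2 with hk2
  have E1 : ∑ b ∈ B, ∑ b' ∈ B, w b * w b' * (- (1 / 2) * (S b ^ 2 * S b' ^ 2) -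
      (J + 1 / 2) * (S b * S b') + M * n b b' + M * (1 - S b ^ 2 * S b' ^ 2)) =
      - (1 / 2 + M) * k2 ^ 2 - (J + 1 / 2) * (∑ b ∈ B, w b * S b) ^ 2 + 
      M * (∑ b ∈ B, ∑ b' ∈ B, w b * w b' * n b b') + M * k ^ 2 := by
    rw [hk, hk2]
    simp_rw [sq (∑ b ∈ B, _), sum_mul_sum, mul_sum, ← sum_sub_distrib, ← sum_add_distrib]
    exact sum_congr rfl fun b _ => sum_congr rfl fun b' _ => by ring
  rw [E1]
  set g := ∑ b ∈ B, w b * (if |x a' b - x a b| < 10 * ρ then 1 else 0) with hg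
  have E2 : ∑ b ∈ B, ∑ b' ∈ B, w b * w b' * (if |x a' b - x a b| < 10 * ρ then 1 else 0) =
      g * k := by
    rw [hg, hk, sum_mul_sum]
    exact sum_congr rfl fun b _ => sum_congr rfl fun b' _ => by ring
  change _ ≤ -(1 / 2) * k ^ 2 + M * (∑ b ∈ B, ∑ b' ∈ B, w b * w b' * n b b') + (2 * M + 1) * 
    (∑ b ∈ B, ∑ b' ∈ B, w b * w b' * (if |x a' b - x a b| < 10 * ρ then 1 else 0))
  rw [E2]
  have hgk : k2 = k - g := by
    rw [hk2, hk, hg, ← sum_sub_distrib]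
    refine sum_congr rfl fun b _ => ?_
    have : S b ^ 2 = 1 - (if |x a' b - x a b| < 10 * ρ then 1 else 0) := by
      simp only [hS, sigF]
      by_cases hh : |x a' b - x a b| < 10 * ρ
      · rw [if_pos hh, if_neg (not_le.2 hh)]; norm_num
      · rw [if_neg hh, if_pos (not_lt.1 hh)]; split_ifs <;> norm_num
    rw [this]; ring
  rw [hgk]
  have h1 : 0 ≤ (J + 1 / 2) * (∑ b ∈ B, w b * S b) ^ 2 := by positivity
  have hM0 : (0:ℝ) ≤ M := by positivity
  nlinarith [mul_nonneg hM0 (sq_nonneg g), sq_nonneg g]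

/-- the global inequality -/
lemma C4_ineq {ι κ : Type*} (A : Finset ι) (B : Finset κ) (u x c e : ι → κ → ℝ) (ρ : ℝ)
    (p1 p2 p3 : ι → ℝ) (q1 q2 q3 : κ → ℝ) (h : SuppOK A B u x c e ρ p1 p2 p3 q1 q2 q3)
    (hu : ∀ a b, 0 ≤ u a b) (hρ : 0 < ρ) (M : ℕ) (hM : 1 ≤ M) (hMρ : 3 ≤ 2 ^ (M - 1) * ρ) :
    ∑ a ∈ A, ∑ a' ∈ A, (∑ b ∈ B, u a b * u a' b) ^ 2 ≤
    4 * M * (∑ a ∈ A, ∑ a' ∈ A, ∑ b ∈ B, ∑ b' ∈ B, (u a b * u a' b) * (u a b' * u a' b') *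
      (if |x a b' - x a b| < ρ then 1 else 0)) + 
    (4 * M + 2) * (∑ a ∈ A, ∑ a' ∈ A, ∑ b ∈ B, ∑ b' ∈ B, (u a b * u a' b) * (u a b' * u a' b') *
      (if |x a' b - x a b| < 10 * ρ then 1 else 0)) := by
  classical
  have h0 := theta_sum_nonneg A B u x ρ M
  have h1 := sum_le_sum fun a ha => sum_le_sum fun a' ha' =>
    pair_ineq A B u x c e ρ p1 p2 p3 q1 q2 q3 h hu hρ M hM hMρ a a' ha ha'
  have h2 := h0.trans h1
  simp_rw [sum_add_distrib, ← mul_sum] at h2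
  set S1 := ∑ a ∈ A, ∑ a' ∈ A, ∑ b ∈ B, ∑ b' ∈ B, (u a b * u a' b) * (u a b' * u a' b') *
      (if |x a b' - x a b| < ρ then 1 else 0) with hS1
  have h3 : ∑ a ∈ A, ∑ a' ∈ A, ∑ b ∈ B, ∑ b' ∈ B, (u a b * u a' b) * (u a b' * u a' b') *
      (if |x a b' - x a b| < ρ ∨ |x a' b' - x a' b| < ρ then 1 else 0) ≤ 2 * S1 := by
    have hsw : S1 = ∑ a ∈ A, ∑ a' ∈ A, ∑ b ∈ B, ∑ b' ∈ B, (u a b * u a' b) * (u a b' * u a' b') *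
      (if |x a' b' - x a' b| < ρ then 1 else 0) := by
      rw [hS1, sum_comm]
      exact sum_congr rfl fun a _ => sum_congr rfl fun a' _ => sum_congr rfl fun b _ =>
        sum_congr rfl fun b' _ => by ring
    have h2S : 2 * S1 = S1 + ∑ a ∈ A, ∑ a' ∈ A, ∑ b ∈ B, ∑ b' ∈ B,
        (u a b * u a' b) * (u a b' * u a' b') * (if |x a' b' - x a' b| < ρ then 1 else 0) := by
      rw [← hsw]; ring
    rw [h2S, hS1]
    simp_rw [← sum_add_distrib]
    refine sum_le_sum fun a _ => sum_le_sum fun a' _ => sum_le_sum fun b _ =>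
        sum_le_sum fun b' _ => ?_
    rw [← mul_add]
    apply mul_le_mul_of_nonneg_left _
      (mul_nonneg (mul_nonneg (hu _ _) (hu _ _)) (mul_nonneg (hu _ _) (hu _ _)))
    by_cases z1 : |x a b' - x a b| < ρ <;> by_cases z2 : |x a' b' - x a' b| < ρ <;> simp [z1, z2]
  have hM0 : (0:ℝ) ≤ M := by positivity
  nlinarith [mul_le_mul_of_nonneg_left h3 hM0]

set_option maxHeartbeats 1600000 in
lemma kst_bound {ι κ : Type*} (A : Finset ι) (B : Finset κ) (u x c e : ι → κ → ℝ) (ρ : ℝ)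
    (p1 p2 p3 : ι → ℝ) (q1 q2 q3 : κ → ℝ) (h : SuppOK A B u x c e ρ p1 p2 p3 q1 q2 q3)
    (hu : ∀ a b, 0 ≤ u a b) (hρ : 0 < ρ) (M : ℕ) (hM : 1 ≤ M) (hMρ : 3 ≤ 2 ^ (M - 1) * ρ)
    (Lb W n : ℝ) (hL : ∀ a b, u a b ≤ Lb) (hLb : 0 ≤ Lb) (hW0 : 0 ≤ W)
    (hW1 : ∀ a ∈ A, ∀ b ∈ B, u a b ≠ 0 →
      ∑ b' ∈ B, u a b' * (if |x a b' - x a b| < ρ then 1 else 0) ≤ W)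
    (hW2 : ∀ a ∈ A, ∀ b ∈ B, u a b ≠ 0 →
      ∑ a' ∈ A, u a' b * (if |x a' b - x a b| < 10 * ρ then 1 else 0) ≤ W)
    (hA : (A.card : ℝ) ≤ n) (hB : (B.card : ℝ) ≤ n) :
    (∑ a ∈ A, ∑ b ∈ B, u a b) ^ 2 ≤ (8 * M + 4) * (Lb * W) * n ^ 3 := by
  classical
  have hn0 : 0 ≤ n := le_trans (by positivity) hA
  have hC := C4_ineq A B u x c e ρ p1 p2 p3 q1 q2 q3 h hu hρ M hM hMρ
  set C4 := ∑ a ∈ A, ∑ a' ∈ A, (∑ b ∈ B, u a b * u a' b) ^ 2 with hC4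
  set P := ∑ b ∈ B, (∑ a ∈ A, u a b) ^ 2 with hP
  set P' := ∑ a ∈ A, (∑ b ∈ B, u a b) ^ 2 with hP'
  have hP0 : 0 ≤ P := sum_nonneg fun _ _ => sq_nonneg _
  have hP0' : 0 ≤ P' := sum_nonneg fun _ _ => sq_nonneg _
  have hC40 : 0 ≤ C4 := sum_nonneg fun _ _ => sum_nonneg fun _ _ => sq_nonneg _
  have hS1 : (∑ a ∈ A, ∑ a' ∈ A, ∑ b ∈ B, ∑ b' ∈ B, (u a b * u a' b) * (u a b' * u a' b') *
      (if |x a b' - x a b| < ρ then 1 else 0)) ≤ Lb * W * P := by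
    have : Lb * W * P = ∑ a ∈ A, ∑ a' ∈ A, ∑ b ∈ B, (u a b * u a' b) * (Lb * W) := by
      rw [hP]
      simp_rw [sq, sum_mul_sum, mul_sum]
      rw [sum_comm]
      refine sum_congr rfl fun a _ => ?_
      rw [sum_comm]
      exact sum_congr rfl fun a' _ => sum_congr rfl fun b _ => by ring
    rw [this]
    refine sum_le_sum fun a ha => sum_le_sum fun a' ha' => sum_le_sum fun b hb => ?_
    by_cases hz : u a b = 0
    · simp [hz]
    calc _ ≤ ∑ b' ∈ B, (u a b * u a' b) *
          (Lb * (u a b' * (if |x a b' - x a b| < ρ then 1 else 0))) := by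
          refine sum_le_sum fun b' hb' => ?_
          rw [mul_assoc]
          apply mul_le_mul_of_nonneg_left _ (mul_nonneg (hu _ _) (hu _ _))
          have : (0:ℝ) ≤ (if |x a b' - x a b| < ρ then 1 else 0) := by split_ifs <;> norm_num
          nlinarith [mul_le_mul_of_nonneg_right (hL a' b') (mul_nonneg (hu a b') this)]
      _ = (u a b * u a' b) * (Lb * ∑ b' ∈ B, u a b' * (if |x a b' - x a b| < ρ then 1 else 0)) := by
          rw [← mul_sum, ← mul_sum]
      _ ≤ _ := by
          apply mul_le_mul_of_nonneg_left _ (mul_nonneg (hu _ _) (hu _ _))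
          exact mul_le_mul_of_nonneg_left (hW1 a ha b hb hz) hLb
  have hS2 : (∑ a ∈ A, ∑ a' ∈ A, ∑ b ∈ B, ∑ b' ∈ B, (u a b * u a' b) * (u a b' * u a' b') *
      (if |x a' b - x a b| < 10 * ρ then 1 else 0)) ≤ Lb * W * P' := by
    have : Lb * W * P' = ∑ a ∈ A, ∑ b ∈ B, ∑ b' ∈ B, (u a b * u a b') * (Lb * W) := by
      rw [hP']
      simp_rw [sq, sum_mul_sum, mul_sum]
      exact sum_congr rfl fun a' _ => sum_congr rfl fun b _ => sum_congr rfl fun _ _ => by ring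
    rw [this]
    refine sum_le_sum fun a ha => ?_
    rw [sum_comm]
    refine sum_le_sum fun b hb => ?_
    rw [sum_comm]
    refine sum_le_sum fun b' hb' => ?_
    by_cases hz : u a b = 0
    · simp [hz]
    calc _ ≤ ∑ a' ∈ A, (u a b * u a b') *
          (Lb * (u a' b * (if |x a' b - x a b| < 10 * ρ then 1 else 0))) := by
          refine sum_le_sum fun a' hb' => ?_
          have : (0:ℝ) ≤ (if |x a' b - x a b| < 10 * ρ then 1 else 0) := by split_ifs <;> norm_num
          have := mul_le_mul_of_nonneg_left (hL a' b') 
            (mul_nonneg (mul_nonneg (hu a b) (hu a b')) (mul_nonneg (hu a' b) this))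
          linarith
      _ = (u a b * u a b') *
            (Lb * ∑ a' ∈ A, u a' b * (if |x a' b - x a b| < 10 * ρ then 1 else 0)) := by
          rw [← mul_sum, ← mul_sum]
      _ ≤ _ := by
          apply mul_le_mul_of_nonneg_left _ (mul_nonneg (hu _ _) (hu _ _))
          exact mul_le_mul_of_nonneg_left (hW2 a ha b hb hz) hLb
  -- P^2 ≤ n^2 C4
  have hPC : P ^ 2 ≤ n ^ 2 * C4 := by
    have e : P = ∑ p ∈ A ×ˢ A, ∑ b ∈ B, u p.1 b * u p.2 b := by
      rw [hP]
      simp_rw [sq, sum_mul_sum]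
      rw [sum_product, sum_comm]
      exact sum_congr rfl fun a _ => sum_comm
    have := sq_sum_le_card_mul_sum_sq (s := A ×ˢ A) (f := fun p => ∑ b ∈ B, u p.1 b * u p.2 b)
    rw [← e, sum_product, card_product] at this
    refine this.trans ?_
    push_cast
    have : (A.card : ℝ) * A.card ≤ n ^ 2 := by rw [sq]; gcongr
    exact mul_le_mul_of_nonneg_right this hC40
  have hPC' : P' ^ 2 ≤ n ^ 2 * C4 := by
    have e : P' = ∑ p ∈ B ×ˢ B, ∑ a ∈ A, u a p.1 * u a p.2 := by
      rw [hP']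
      simp_rw [sq, sum_mul_sum]
      rw [sum_product, sum_comm]
      exact sum_congr rfl fun a _ => sum_comm
    have := sq_sum_le_card_mul_sum_sq (s := B ×ˢ B) (f := fun p => ∑ a ∈ A, u a p.1 * u a p.2)
    rw [← e, sum_product, card_product] at this
    have e2 : ∑ x ∈ B, ∑ y ∈ B, (∑ a ∈ A, u a x * u a y) ^ 2 = C4 := by
      rw [hC4]
      simp_rw [sq, sum_mul_sum]
      rw [sum_comm4]
      exact sum_congr rfl fun a _ => sum_congr rfl fun a' _ => sum_congr rfl fun b _ =>
        sum_congr rfl fun b' _ => by ring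
    simp only [e2] at this
    refine this.trans ?_
    push_cast
    have : (B.card : ℝ) * B.card ≤ n ^ 2 := by rw [sq]; gcongr
    exact mul_le_mul_of_nonneg_right this hC40
  have hT : (∑ a ∈ A, ∑ b ∈ B, u a b) ^ 2 ≤ n * P' := by
    have := sq_sum_le_card_mul_sum_sq (s := A) (f := fun a => ∑ b ∈ B, u a b)
    exact this.trans (mul_le_mul_of_nonneg_right hA hP0')
  have hM0 : (0:ℝ) ≤ M := by positivity
  have hLW : 0 ≤ Lb * W := by positivity
  have hC' : C4 ≤ (4 * M + 2) * (Lb * W) * (P + P') := by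
    have i1 := mul_le_mul_of_nonneg_left hS1 hM0
    have i2 := mul_le_mul_of_nonneg_left hS2 hM0
    have : 0 ≤ Lb * W * P := by positivity
    nlinarith
  -- let Q = sqrt C4
  set q := Real.sqrt C4 with hq
  have hq0 : 0 ≤ q := Real.sqrt_nonneg _
  have hqq : q ^ 2 = C4 := Real.sq_sqrt hC40
  have hPq : P ≤ n * q := by
    rw [← pow_le_pow_iff_left₀ hP0 (by positivity) two_ne_zero, mul_pow, hqq]; exact hPC
  have hPq' : P' ≤ n * q := by
    rw [← pow_le_pow_iff_left₀ hP0' (by positivity) two_ne_zero, mul_pow, hqq]; exact hPC'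
  have hqb : q ≤ (8 * M + 4) * (Lb * W) * n := by
    by_contra hcon
    push Not at hcon
    have hqpos : 0 < q := lt_of_le_of_lt (by positivity) hcon
    have : q ^ 2 ≤ ((8 * M + 4) * (Lb * W) * n) * q := by
      rw [hqq]
      refine hC'.trans ?_
      have : (4 * M + 2) * (Lb * W) * (P + P') ≤ (4 * M + 2) * (Lb * W) * (n * q + n * q) := by
        gcongr
      linarith
    nlinarith
  calc _ ≤ n * P' := hT
    _ ≤ n * (n * q) := by gcongr
    _ ≤ n * (n * ((8 * M + 4) * (Lb * W) * n)) := by gcongr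
    _ = _ := by ring
end

lemma geo_dot (δ ζ1 ζ2 X1 X2 R r : ℝ) (h1 : |ζ1 ^ 2 + ζ2 ^ 2 - r ^ 2| ≤ 9 * δ)
    (h2 : |(ζ1 + X1) ^ 2 + (ζ2 + X2) ^ 2 - (r - R) ^ 2| ≤ 9 * δ) :
    ∃ ε1 ε : ℝ, |ε1| ≤ 9 * δ ∧ |ε| ≤ 9 * δ ∧ ζ1 ^ 2 + ζ2 ^ 2 = r ^ 2 + ε1 ∧
      ζ1 * X1 + ζ2 * X2 = - r * R - (X1 ^ 2 + X2 ^ 2 - R ^ 2) / 2 + ε := by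
  refine ⟨ζ1 ^ 2 + ζ2 ^ 2 - r ^ 2, (((ζ1 + X1) ^ 2 + (ζ2 + X2) ^ 2 - (r - R) ^ 2) -
    (ζ1 ^ 2 + ζ2 ^ 2 - r ^ 2)) / 2, h1, ?_, by ring, by ring⟩
  rw [abs_le] at *
  constructor <;> linarith [h1.1, h1.2, h2.1, h2.2]

/-- sizes of `R`, when nearly tangent -/
lemma geo_R (d τ X1 X2 R : ℝ) (hd : 0 < d) (hτd : τ ≤ d / 100)
    (hdist : d / 2 < max |X1| (max |X2| |R|)) (hR : 0 < R)
    (hQ : |X1 ^ 2 + X2 ^ 2 - R ^ 2| ≤ τ * d) : 0.48 * d ≤ R ∧ 0.47 ^ 2 * d ^ 2 ≤ X1 ^ 2 + X2 ^ 2 := by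
  rw [abs_le] at hQ
  have hτ : τ * d ≤ d ^ 2 / 100 := by nlinarith
  have h : 0.24 * d ^ 2 ≤ R ^ 2 := by
    rcases lt_max_iff.1 hdist with h | h
    · have : (d / 2) ^ 2 ≤ X1 ^ 2 := by rw [← sq_abs X1]; gcongr
      nlinarith [hQ.2, sq_nonneg X2]
    rcases lt_max_iff.1 h with h | h
    · have : (d / 2) ^ 2 ≤ X2 ^ 2 := by rw [← sq_abs X2]; gcongr
      nlinarith [hQ.2, sq_nonneg X1]
    · have : (d / 2) ^ 2 ≤ R ^ 2 := by rw [← sq_abs R]; gcongr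
      nlinarith
  constructor
  · rw [← pow_le_pow_iff_left₀ (by positivity) hR.le two_ne_zero]; nlinarith
  · nlinarith [hQ.1]

/-- G1 : near-tangent intersections are near the tangency point -/
lemma geo_G1 (δ d τ ζ1 ζ2 X1 X2 R r : ℝ) (hδ : 0 < δ) (hd : 0 < d) (hd2 : d ≤ 2)
    (hτ : 800 * δ ≤ τ) (hr : 1 ≤ r ∧ r ≤ 2) (hR : 0.48 * d ≤ R)
    (hQ : |X1 ^ 2 + X2 ^ 2 - R ^ 2| ≤ τ * d)
    (h1 : |ζ1 ^ 2 + ζ2 ^ 2 - r ^ 2| ≤ 9 * δ)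
    (h2 : |(ζ1 + X1) ^ 2 + (ζ2 + X2) ^ 2 - (r - R) ^ 2| ≤ 9 * δ) :
    (ζ1 + r * X1 / R) ^ 2 + (ζ2 + r * X2 / R) ^ 2 ≤ 30 * (τ / d) := by
  obtain ⟨ε1, ε, k1, k2, k3, k4⟩ := geo_dot δ ζ1 ζ2 X1 X2 R r h1 h2
  have hR0 : 0 < R := by nlinarith
  have hτ0 : 0 < τ := by linarith
  set Q := X1 ^ 2 + X2 ^ 2 - R ^ 2 with hQd
  have e : (ζ1 + r * X1 / R) ^ 2 + (ζ2 + r * X2 / R) ^ 2 =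
      ε1 - r * (Q / R) + 2 * r * (ε / R) + r ^ 2 * (Q / R ^ 2) := by
    have : (ζ1 + r * X1 / R) ^ 2 + (ζ2 + r * X2 / R) ^ 2 = (ζ1 ^ 2 + ζ2 ^ 2) +
      2 * r * (ζ1 * X1 + ζ2 * X2) / R + r ^ 2 * (Q + R ^ 2) / R ^ 2 := by
      rw [hQd]; field_simp; ring
    rw [this, k3, k4]; field_simp; ring
  rw [e]
  have b1 : |Q / R| ≤ 4.2 * (τ / d) := by
    rw [abs_div, abs_of_pos hR0, div_le_iff₀ hR0]
    calc |Q| ≤ τ * d := hQ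
      _ = (τ / d) * (d * d) := by field_simp
      _ ≤ (τ / d) * (2 * (R * (25 / 12))) := by
        gcongr; linarith
      _ = (25 / 6) * (τ / d * R) := by ring
      _ ≤ 4.2 * (τ / d * R) := by gcongr; norm_num
      _ = _ := by ring
  have b2 : |ε / R| ≤ 0.1 * (τ / d) := by
    rw [abs_div, abs_of_pos hR0, div_le_iff₀ hR0]
    calc |ε| ≤ 9 * δ := k2
      _ ≤ 0.012 * τ := by linarith
      _ = 0.012 * (τ / d) * d := by field_simp
      _ ≤ 0.012 * (τ / d) * (R * (25 / 12)) := by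
        gcongr; linarith
      _ = 0.025 * (τ / d * R) := by ring
      _ ≤ 0.1 * (τ / d * R) := by gcongr; norm_num
      _ = _ := by ring
  have b3 : |Q / R ^ 2| ≤ 4.4 * (τ / d) := by
    rw [abs_div, abs_of_pos (by positivity : 0 < R ^ 2), div_le_iff₀ (by positivity)]
    calc |Q| ≤ τ * d := hQ
      _ = (τ / d) * (d ^ 2) := by field_simp
      _ ≤ (τ / d) * (4.4 * R ^ 2) := by
        gcongr
        nlinarith
      _ = _ := by ring
  have b4 : |ε1| ≤ 0.03 * (τ / d) := by
    calc |ε1| ≤ 9 * δ := k1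
      _ ≤ 0.012 * τ := by linarith
      _ = 0.012 * (τ / d) * d := by field_simp
      _ ≤ 0.012 * (τ / d) * 2 := by gcongr
      _ ≤ _ := by
        have : 0 < τ / d := by positivity
        nlinarith
  have hT : 0 < τ / d := by positivity
  have c1 : |r * (Q / R)| ≤ 2 * (4.2 * (τ / d)) := by
    rw [abs_mul, abs_of_pos (by linarith [hr.1])]; gcongr; exact hr.2
  have c2 : |2 * r * (ε / R)| ≤ 2 * 2 * (0.1 * (τ / d)) := by
    rw [abs_mul, abs_of_pos (by linarith [hr.1])]; gcongr; exact hr.2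
  have c3 : |r ^ 2 * (Q / R ^ 2)| ≤ 2 ^ 2 * (4.4 * (τ / d)) := by
    rw [abs_mul, abs_of_pos (by have := hr.1; positivity)]; gcongr; linarith [hr.1]; exact hr.2
  rw [abs_le] at c1 c2 c3 b4
  linarith [c1.1, c2.2, c3.2, b4.2]

/-- the cross product squared -/
lemma geo_N (δ d ζ1 ζ2 X1 X2 R r : ℝ) (hδ : 0 < δ) (hδd : δ ≤ d) (hd2 : d ≤ 2)
    (hr : 1 ≤ r ∧ r ≤ 2)
    (hX1 : |X1| ≤ d) (hX2 : |X2| ≤ d) (hR : |R| ≤ d)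
    (h1 : |ζ1 ^ 2 + ζ2 ^ 2 - r ^ 2| ≤ 9 * δ)
    (h2 : |(ζ1 + X1) ^ 2 + (ζ2 + X2) ^ 2 - (r - R) ^ 2| ≤ 9 * δ) :
    |(ζ1 * X2 - ζ2 * X1) ^ 2 - (X1 ^ 2 + X2 ^ 2 - R ^ 2) *
      (r * (r - R) - (X1 ^ 2 + X2 ^ 2 - R ^ 2) / 4)| ≤ 200 * (δ * d) := by
  obtain ⟨ε1, ε, k1, k2, k3, k4⟩ := geo_dot δ ζ1 ζ2 X1 X2 R r h1 h2
  have hd : 0 < d := by linarith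
  set Q := X1 ^ 2 + X2 ^ 2 - R ^ 2 with hQd
  set K := - r * R - Q / 2 with hK
  have e : (ζ1 * X2 - ζ2 * X1) ^ 2 - Q * (r * (r - R) - Q / 4) =
      ε1 * (X1 ^ 2 + X2 ^ 2) - 2 * K * ε - ε ^ 2 := by
    have : (ζ1 * X2 - ζ2 * X1) ^ 2 = (ζ1 ^ 2 + ζ2 ^ 2) * (X1 ^ 2 + X2 ^ 2) -
      (ζ1 * X1 + ζ2 * X2) ^ 2 := by ring
    rw [this, k3, k4, hK, hQd]; ring
  rw [e]
  have x1 : X1 ^ 2 ≤ d ^ 2 := by rw [← sq_abs X1]; gcongr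
  have x2 : X2 ^ 2 ≤ d ^ 2 := by rw [← sq_abs X2]; gcongr
  have x3 : R ^ 2 ≤ d ^ 2 := by rw [← sq_abs R]; gcongr
  have x12 : |X1 ^ 2 + X2 ^ 2| ≤ 4 * d := by
    have hdd : d ^ 2 ≤ 2 * d := by rw [sq]; gcongr
    rw [abs_of_nonneg (by positivity)]; linarith
  have hQ : |Q| ≤ 2 * d ^ 2 := by
    rw [abs_le]; constructor <;> linarith [sq_nonneg X1, sq_nonneg X2, sq_nonneg R]
  have hKb : |K| ≤ 4 * d := by
    have : |r * R| ≤ 2 * d := by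
      rw [abs_mul, abs_of_pos (by linarith [hr.1])]
      have := hr.1
      gcongr; exact hr.2
    have hdd : d ^ 2 ≤ 2 * d := by rw [sq]; gcongr
    rw [abs_le] at this hQ ⊢
    constructor <;> linarith [this.1, this.2, hQ.1, hQ.2]
  have c1 : |ε1 * (X1 ^ 2 + X2 ^ 2)| ≤ 9 * δ * (4 * d) := by rw [abs_mul]; gcongr
  have c2 : |2 * K * ε| ≤ 2 * (4 * d) * (9 * δ) := by
    rw [abs_mul, abs_mul, abs_two]; gcongr
  have c3 : |ε ^ 2| ≤ 81 * (δ * d) := by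
    rw [abs_pow]
    calc |ε| ^ 2 ≤ (9 * δ) ^ 2 := by gcongr
      _ = 81 * (δ * δ) := by ring
      _ ≤ _ := by gcongr
  have := mul_pos hδ hd
  rw [abs_le] at c1 c2 c3 ⊢
  constructor <;> linarith [c1.1, c1.2, c2.1, c2.2, c3.1, c3.2]

set_option maxHeartbeats 1000000 in
lemma geo_G2 (δ d θ ζ1 ζ2 ξ1 ξ2 X1 X2 R r : ℝ) (hδ : 0 < δ) (hδd : δ ≤ d) (hd2 : d ≤ 2)
    (hr : 1 ≤ r ∧ r ≤ 2) (hr' : 1 ≤ r - R ∧ r - R ≤ 2)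
    (hX1 : |X1| ≤ d) (hX2 : |X2| ≤ d) (hR : |R| ≤ d)
    (hX1' : |X1| ≤ 0.02) (hX2' : |X2| ≤ 0.02)
    (hdist : d / 2 < max |X1| (max |X2| |R|))
    (hθ : 800 * (δ * d) ≤ θ) (hQ : θ ≤ |X1 ^ 2 + X2 ^ 2 - R ^ 2|)
    (h1 : |ζ1 ^ 2 + ζ2 ^ 2 - r ^ 2| ≤ 9 * δ)
    (h2 : |(ζ1 + X1) ^ 2 + (ζ2 + X2) ^ 2 - (r - R) ^ 2| ≤ 9 * δ)
    (h1' : |ξ1 ^ 2 + ξ2 ^ 2 - r ^ 2| ≤ 9 * δ)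
    (h2' : |(ξ1 + X1) ^ 2 + (ξ2 + X2) ^ 2 - (r - R) ^ 2| ≤ 9 * δ)
    (hN : 0 ≤ ζ1 * X2 - ζ2 * X1 ↔ 0 ≤ ξ1 * X2 - ξ2 * X1) :
    (ζ1 - ξ1) ^ 2 + (ζ2 - ξ2) ^ 2 ≤ 600 ^ 2 * (δ ^ 2 / θ) := by
  have hd : 0 < d := by linarith
  have hδd0 := mul_pos hδ hd
  have hθ0 : 0 < θ := by linarith
  have N1 := geo_N δ d ζ1 ζ2 X1 X2 R r hδ hδd hd2 hr hX1 hX2 hR h1 h2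
  have N2 := geo_N δ d ξ1 ξ2 X1 X2 R r hδ hδd hd2 hr hX1 hX2 hR h1' h2'
  obtain ⟨ε1, ε, -, k2, -, k4⟩ := geo_dot δ ζ1 ζ2 X1 X2 R r h1 h2
  obtain ⟨η1, η, -, l2, -, l4⟩ := geo_dot δ ξ1 ξ2 X1 X2 R r h1' h2'
  set Q := X1 ^ 2 + X2 ^ 2 - R ^ 2 with hQd
  set N := ζ1 * X2 - ζ2 * X1 with hNd
  set N' := ξ1 * X2 - ξ2 * X1 with hNd'
  have x1' : X1 ^ 2 ≤ 0.02 ^ 2 := by rw [← sq_abs X1]; gcongr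
  have x2' : X2 ^ 2 ≤ 0.02 ^ 2 := by rw [← sq_abs X2]; gcongr
  have hrr : 1 ≤ r * (r - R) := one_le_mul_of_one_le_of_one_le hr.1 hr'.1
  have hQ4 : 0.99 ≤ r * (r - R) - Q / 4 := by
    have := sq_nonneg R
    norm_num at x1' x2' ⊢
    linarith
  have hQ0 : 0 < Q := by
    by_contra hneg
    push Not at hneg
    rw [abs_of_nonpos hneg] at hQ
    rw [abs_le] at N1
    have z1 : Q * (r * (r - R) - Q / 4) ≤ Q * 0.99 := mul_le_mul_of_nonpos_left hQ4 hneg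
    linarith [N1.2, sq_nonneg N]
  rw [abs_of_pos hQ0] at hQ
  have hD : d ^ 2 / 4 ≤ X1 ^ 2 + X2 ^ 2 := by
    rcases lt_max_iff.1 hdist with h | h
    · have : (d / 2) ^ 2 ≤ X1 ^ 2 := by rw [← sq_abs X1]; gcongr
      have z : (d / 2) ^ 2 = d ^ 2 / 4 := by ring
      linarith [sq_nonneg X2]
    rcases lt_max_iff.1 h with h | h
    · have : (d / 2) ^ 2 ≤ X2 ^ 2 := by rw [← sq_abs X2]; gcongr
      have z : (d / 2) ^ 2 = d ^ 2 / 4 := by ring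
      linarith [sq_nonneg X1]
    · have : (d / 2) ^ 2 ≤ R ^ 2 := by rw [← sq_abs R]; gcongr
      have z : (d / 2) ^ 2 = d ^ 2 / 4 := by ring
      linarith
  have x1 : X1 ^ 2 ≤ d ^ 2 := by rw [← sq_abs X1]; gcongr
  have x2 : X2 ^ 2 ≤ d ^ 2 := by rw [← sq_abs X2]; gcongr
  have hθd : θ ≤ 2 * d ^ 2 := by linarith [sq_nonneg R]
  have hNl : θ / 2 ≤ N ^ 2 := by
    have z1 : Q * 0.99 ≤ Q * (r * (r - R) - Q / 4) := mul_le_mul_of_nonneg_left hQ4 hQ0.le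
    rw [abs_le] at N1; linarith [N1.1]
  have hNl' : θ / 2 ≤ N' ^ 2 := by
    have z1 : Q * 0.99 ≤ Q * (r * (r - R) - Q / 4) := mul_le_mul_of_nonneg_left hQ4 hQ0.le
    rw [abs_le] at N2; linarith [N2.1]
  have hNN : |N ^ 2 - N' ^ 2| ≤ 400 * (δ * d) := by
    rw [abs_le] at N1 N2 ⊢; constructor <;> linarith [N1.1, N1.2, N2.1, N2.2]
  have hs : 2 * θ ≤ (N + N') ^ 2 := by
    have hpr : 0 ≤ N * N' := by
      by_cases hn : 0 ≤ N
      · exact mul_nonneg hn (hN.1 hn)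
      · have hn' : ¬ 0 ≤ N' := fun h => hn (hN.2 h)
        push Not at hn hn'
        exact (mul_pos_of_neg_of_neg hn hn').le
    have : θ / 2 ≤ N * N' := by
      rw [← pow_le_pow_iff_left₀ (by positivity) hpr two_ne_zero]
      calc (θ / 2) ^ 2 = (θ / 2) * (θ / 2) := by ring
        _ ≤ N ^ 2 * N' ^ 2 := by gcongr
        _ = _ := by ring
    have z : (N + N') ^ 2 = N ^ 2 + 2 * (N * N') + N' ^ 2 := by ring
    linarith
  have hdN : (N - N') ^ 2 * θ ≤ 80000 * (δ * d) ^ 2 := by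
    have e : (N - N') ^ 2 * (N + N') ^ 2 = |N ^ 2 - N' ^ 2| ^ 2 := by rw [sq_abs]; ring
    have : |N ^ 2 - N' ^ 2| ^ 2 ≤ (400 * (δ * d)) ^ 2 := by gcongr
    have h3 : (N - N') ^ 2 * (2 * θ) ≤ (N - N') ^ 2 * (N + N') ^ 2 := by gcongr
    have z : (400 * (δ * d)) ^ 2 = 160000 * (δ * d) ^ 2 := by ring
    linarith
  have hdot : ((ζ1 - ξ1) * X1 + (ζ2 - ξ2) * X2) ^ 2 ≤ (18 * δ) ^ 2 := by
    have : (ζ1 - ξ1) * X1 + (ζ2 - ξ2) * X2 = ε - η := by linarith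
    rw [this]
    apply sq_le_sq'
    all_goals (rw [abs_le] at k2 l2; linarith [k2.1, k2.2, l2.1, l2.2])
  have hid : ((ζ1 - ξ1) ^ 2 + (ζ2 - ξ2) ^ 2) * (X1 ^ 2 + X2 ^ 2) =
      ((ζ1 - ξ1) * X1 + (ζ2 - ξ2) * X2) ^ 2 + (N - N') ^ 2 := by rw [hNd, hNd']; ring
  set G := (ζ1 - ξ1) ^ 2 + (ζ2 - ξ2) ^ 2 with hG
  have hG0 : 0 ≤ G := by positivity
  have m1 : G * (d ^ 2 / 4) ≤ (18 * δ) ^ 2 + (N - N') ^ 2 := by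
    have : G * (d ^ 2 / 4) ≤ G * (X1 ^ 2 + X2 ^ 2) := by gcongr
    linarith
  have m2 : G * θ * (d ^ 2 / 4) ≤ (18 * δ) ^ 2 * (2 * d ^ 2) + 80000 * (δ * d) ^ 2 := by
    calc G * θ * (d ^ 2 / 4) = (G * (d ^ 2 / 4)) * θ := by ring
      _ ≤ ((18 * δ) ^ 2 + (N - N') ^ 2) * θ := by gcongr
      _ = (18 * δ) ^ 2 * θ + (N - N') ^ 2 * θ := by ring
      _ ≤ _ := by gcongr
  have m3 : G * θ ≤ 600 ^ 2 * δ ^ 2 := by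
    have hd2' : 0 < d ^ 2 / 4 := by positivity
    apply le_of_mul_le_mul_right _ hd2'
    refine m2.trans ?_
    have z0 : 0 ≤ δ ^ 2 * d ^ 2 := by positivity
    have z1 : (18 * δ) ^ 2 * (2 * d ^ 2) + 80000 * (δ * d) ^ 2 = 80648 * (δ ^ 2 * d ^ 2) := by ring
    have z2 : 600 ^ 2 * δ ^ 2 * (d ^ 2 / 4) = 90000 * (δ ^ 2 * d ^ 2) := by ring
    rw [z1, z2]; linarith
  rw [← mul_div_assoc, le_div_iff₀ hθ0]
  exact m3

set_option maxHeartbeats 1000000 in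
lemma geo_near (d τ X1 X2 R Y1 Y2 S e1 e2 : ℝ) (hd : 0 < d) (hτ : 0 < τ) (he : e1 ^ 2 + e2 ^ 2 = 1)
    (hR : 0.48 * d ≤ R) (hS : 0.48 * d ≤ S)
    (hτd : τ ≤ d / 100)
    (hQ : |X1 ^ 2 + X2 ^ 2 - R ^ 2| ≤ τ * d) (hQ' : |Y1 ^ 2 + Y2 ^ 2 - S ^ 2| ≤ τ * d)
    (hu : 0.9 * d ≤ R + (X1 * e1 + X2 * e2)) (hu' : 0.9 * d ≤ S + (Y1 * e1 + Y2 * e2))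
    (ρ : ℝ) (hρ : ρ ^ 2 = 2 * (τ / d))
    (hx : |(X1 * e2 - X2 * e1) / (R + (X1 * e1 + X2 * e2)) -
      (Y1 * e2 - Y2 * e1) / (S + (Y1 * e1 + Y2 * e2))| ≤ 10 * ρ) :
    (X1 / R - Y1 / S) ^ 2 + (X2 / R - Y2 / S) ^ 2 ≤ 1000 * (τ / d) := by
  have hR0 : 0 < R := by nlinarith
  have hS0 : 0 < S := by nlinarith
  set u := R + (X1 * e1 + X2 * e2) with hud
  set u' := S + (Y1 * e1 + Y2 * e2) with hud'
  set x := (X1 * e2 - X2 * e1) / u with hxd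
  set x' := (Y1 * e2 - Y2 * e1) / u' with hxd'
  have hu0 : 0 < u := by nlinarith
  have hu0' : 0 < u' := by nlinarith
  set Q := X1 ^ 2 + X2 ^ 2 - R ^ 2 with hQd
  set Q' := Y1 ^ 2 + Y2 ^ 2 - S ^ 2 with hQd'
  have e : (X1 / R - Y1 / S) ^ 2 + (X2 / R - Y2 / S) ^ 2 = Q / R ^ 2 + Q' / S ^ 2 +
      (u / R) * (u' / S) * ((x - x') ^ 2 - Q / u ^ 2 - Q' / u' ^ 2) := by
    have key : (u / R) * (u' / S) * ((x - x') ^ 2 - Q / u ^ 2 - Q' / u' ^ 2) =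
      2 * (R * S - (X1 * Y1 + X2 * Y2)) / (R * S) := by
      have hv : (X1 * e2 - X2 * e1) ^ 2 - Q = u * (R - (X1 * e1 + X2 * e2)) := by
        rw [hQd, hud]; linear_combination (X1 ^ 2 + X2 ^ 2) * he
      have hv' : (Y1 * e2 - Y2 * e1) ^ 2 - Q' = u' * (S - (Y1 * e1 + Y2 * e2)) := by
        rw [hQd', hud']; linear_combination (Y1 ^ 2 + Y2 ^ 2) * he
      have z1 : (x - x') ^ 2 - Q / u ^ 2 - Q' / u' ^ 2 = (R - (X1 * e1 + X2 * e2)) / u +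
          (S - (Y1 * e1 + Y2 * e2)) / u' -
          2 * (X1 * e2 - X2 * e1) * (Y1 * e2 - Y2 * e1) / (u * u') := by
        have w1 : (R - (X1 * e1 + X2 * e2)) / u = ((X1 * e2 - X2 * e1) ^ 2 - Q) / u ^ 2 := by
          rw [hv]; field_simp
        have w2 : (S - (Y1 * e1 + Y2 * e2)) / u' = ((Y1 * e2 - Y2 * e1) ^ 2 - Q') / u' ^ 2 := by
          rw [hv']; field_simp
        rw [w1, w2, hxd, hxd']; field_simp; ring
      rw [z1]
      have z2 : (u / R) * (u' / S) * ((R - (X1 * e1 + X2 * e2)) / u +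
          (S - (Y1 * e1 + Y2 * e2)) / u' -
          2 * (X1 * e2 - X2 * e1) * (Y1 * e2 - Y2 * e1) / (u * u')) =
          (u' * (R - (X1 * e1 + X2 * e2)) + u * (S - (Y1 * e1 + Y2 * e2)) - 
           2 * (X1 * e2 - X2 * e1) * (Y1 * e2 - Y2 * e1)) / (R * S) := by
        field_simp
      rw [z2]
      congr 1
      rw [hud, hud']
      linear_combination (-2 * (X1 * Y1 + X2 * Y2)) * he
    rw [key, hQd, hQd']; field_simp; ring
  rw [e]
  have hT : 0 < τ / d := by positivity
  have hdT : τ * d = (τ / d) * d ^ 2 := by field_simp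
  have qb : ∀ (Z V c : ℝ), |Z| ≤ τ * d → 0 < V → 0 < c → c * d ^ 2 ≤ V ^ 2 →
      |Z / V ^ 2| ≤ (1 / c) * (τ / d) := by
    intro Z V c hZ hV hc hcV
    rw [abs_div, abs_of_pos (by positivity : 0 < V ^ 2), div_le_iff₀ (by positivity)]
    calc |Z| ≤ (τ / d) * d ^ 2 := by linarith
      _ ≤ (τ / d) * (V ^ 2 / c) := by
        gcongr; rw [le_div_iff₀ hc]; linarith
      _ = _ := by field_simp
  have b1 := qb Q R 0.2 hQ hR0 (by norm_num) (by nlinarith)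
  have b2 := qb Q' S 0.2 hQ' hS0 (by norm_num) (by nlinarith)
  have b3 := qb Q u 0.5 hQ hu0 (by norm_num) (by nlinarith)
  have b4 := qb Q' u' 0.5 hQ' hu0' (by norm_num) (by nlinarith)
  have ub : ∀ (Z1 Z2 V : ℝ), 0 < V → 0.48 * d ≤ V → |Z1 ^ 2 + Z2 ^ 2 - V ^ 2| ≤ τ * d →
      (V + (Z1 * e1 + Z2 * e2)) / V ≤ 2.1 := by
    intro Z1 Z2 V hV hVd hZ
    rw [div_le_iff₀ hV]
    have : (Z1 * e1 + Z2 * e2) ^ 2 ≤ (1.1 * V) ^ 2 := by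
      have cs : (Z1 * e1 + Z2 * e2) ^ 2 + (Z1 * e2 - Z2 * e1) ^ 2 = Z1 ^ 2 + Z2 ^ 2 := by
        linear_combination (Z1 ^ 2 + Z2 ^ 2) * he
      rw [abs_le] at hZ
      nlinarith [hZ.2, sq_nonneg (Z1 * e2 - Z2 * e1)]
    have := abs_le_of_sq_le_sq' this (by positivity)
    linarith [this.2]
  have u1 : u / R ≤ 2.1 := ub X1 X2 R hR0 hR hQ
  have u2 : u' / S ≤ 2.1 := ub Y1 Y2 S hS0 hS hQ'
  have u1' : 0 < u / R := by positivity
  have u2' : 0 < u' / S := by positivity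
  have hxx : (x - x') ^ 2 ≤ 200 * (τ / d) := by
    rw [← sq_abs]
    calc |x - x'| ^ 2 ≤ (10 * ρ) ^ 2 := by gcongr
      _ = _ := by rw [mul_pow, hρ]; ring
  rw [abs_le] at b1 b2 b3 b4
  have in2 : (x - x') ^ 2 - Q / u ^ 2 - Q' / u' ^ 2 ≤ 204 * (τ / d) := by
    linarith [b3.1, b4.1]
  have : (u / R) * (u' / S) * ((x - x') ^ 2 - Q / u ^ 2 - Q' / u' ^ 2) ≤
      2.1 * 2.1 * (204 * (τ / d)) := by
    calc _ ≤ (u / R) * (u' / S) * (204 * (τ / d)) := by gcongr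
      _ ≤ _ := by gcongr
  linarith [b1.2, b2.2]

noncomputable section
open Finset Classical

abbrev Pt := ℝ × ℝ × ℝ

structure Cfg (δ C0 s t μ : ℝ) (P : Finset Pt) (E : Pt → Finset (ℝ × ℝ)) : Prop where
  hδ : 0 < δ
  hδ1 : δ ≤ 1
  hC0 : 1 ≤ C0
  ht : 0 < t
  hts : t ≤ s
  hs1 : s ≤ 1
  hμ : 1 ≤ μ
  hr : ∀ p ∈ P, (1 ≤ p.2.2 ∧ p.2.2 ≤ 2) ∧ |p.1| ≤ 1 / 100 ∧ |p.2.1| ≤ 1 / 100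
  hE : ∀ p ∈ P, ∀ z ∈ E p, |(z.1 - p.1) ^ 2 + (z.2 - p.2.1) ^ 2 - p.2.2 ^ 2| ≤ 9 * δ
  hP : ∀ q : Pt, ∀ ρ : ℝ, δ ≤ ρ → ((P.filter (fun p => dist p q ≤ ρ)).card : ℝ) ≤ C0 * (ρ / δ) ^ t
  hEc : ∀ p ∈ P, ∀ y : ℝ × ℝ, ∀ ρ : ℝ, δ ≤ ρ →
    (((E p).filter (fun z => dist z y ≤ ρ)).card : ℝ) ≤ C0 * (ρ / δ) ^ s
  hm : ∀ z, ((P.filter (fun p => z ∈ E p)).card : ℝ) ≤ 2 * μ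

def Qf (a b : Pt) : ℝ := (a.1 - b.1) ^ 2 + (a.2.1 - b.2.1) ^ 2 - (a.2.2 - b.2.2) ^ 2

def Uf (E : Pt → Finset (ℝ × ℝ)) (a b : Pt) : ℝ := ((E a ∩ E b).card : ℝ)

lemma rpow_cmul (c y s : ℝ) (hc : 1 ≤ c) (hy : 0 ≤ y) (hs0 : 0 ≤ s) (hs : s ≤ 1) :
    (c * y) ^ s ≤ c * y ^ s := by
  rw [Real.mul_rpow (by linarith) hy]
  have : c ^ s ≤ c := by
    calc c ^ s ≤ c ^ (1:ℝ) := Real.rpow_le_rpow_of_exponent_le hc hs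
      _ = c := Real.rpow_one c
  have := Real.rpow_nonneg hy s
  gcongr

lemma dist_max (a b : Pt) : dist a b = max |a.1 - b.1| (max |a.2.1 - b.2.1| |a.2.2 - b.2.2|) := by
  simp [Prod.dist_eq, Real.dist_eq]

lemma dist_coord (a b : Pt) (d : ℝ) (h : dist a b ≤ d) :
    |a.1 - b.1| ≤ d ∧ |a.2.1 - b.2.1| ≤ d ∧ |a.2.2 - b.2.2| ≤ d := by
  rw [dist_max] at h
  simpa using h

section
variable {δ C0 s t μ : ℝ} {P : Finset Pt} {E : Pt → Finset (ℝ × ℝ)}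

/-- geometric hypotheses for a common point -/
lemma Cfg.zeta (h : Cfg δ C0 s t μ P E) {a b : Pt} (ha : a ∈ P) (hb : b ∈ P) {z : ℝ × ℝ}
    (hz : z ∈ E a ∩ E b) :
    |(z.1 - a.1) ^ 2 + (z.2 - a.2.1) ^ 2 - a.2.2 ^ 2| ≤ 9 * δ ∧
    |((z.1 - a.1) + (a.1 - b.1)) ^ 2 + ((z.2 - a.2.1) + (a.2.1 - b.2.1)) ^ 2 -
      (a.2.2 - (a.2.2 - b.2.2)) ^ 2| ≤ 9 * δ := by
  rw [mem_inter] at hz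
  refine ⟨h.hE a ha z hz.1, ?_⟩
  have := h.hE b hb z hz.2
  convert this using 2; ring

lemma Cfg.card_le_of_dist (h : Cfg δ C0 s t μ P E) {a : Pt} (ha : a ∈ P) (S : Finset (ℝ × ℝ))
    (hS : S ⊆ E a) (y : ℝ × ℝ) (ρ : ℝ) (hρ : δ ≤ ρ) (hd : ∀ z ∈ S, dist z y ≤ ρ) :
    (S.card : ℝ) ≤ C0 * (ρ / δ) ^ s := by
  refine le_trans ?_ (h.hEc a ha y ρ hρ)
  gcongr
  intro z hz
  rw [mem_filter]; exact ⟨hS hz, hd z hz⟩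

lemma dist2_le (z y : ℝ × ℝ) (ρ : ℝ) (hρ : 0 ≤ ρ)
    (h : (z.1 - y.1) ^ 2 + (z.2 - y.2) ^ 2 ≤ ρ ^ 2) : dist z y ≤ ρ := by
  rw [Prod.dist_eq, Real.dist_eq, Real.dist_eq]
  apply max_le
  · exact abs_le_of_sq_le_sq (by nlinarith [sq_nonneg (z.2 - y.2)]) hρ
  · exact abs_le_of_sq_le_sq (by nlinarith [sq_nonneg (z.1 - y.1)]) hρ

lemma Cfg.X_small (h : Cfg δ C0 s t μ P E) {a b : Pt} (ha : a ∈ P) (hb : b ∈ P) :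
    |a.1 - b.1| ≤ 0.02 ∧ |a.2.1 - b.2.1| ≤ 0.02 := by
  obtain ⟨-, h1, h2⟩ := h.hr a ha
  obtain ⟨-, h3, h4⟩ := h.hr b hb
  rw [abs_le] at *
  rw [abs_le]
  norm_num
  refine ⟨⟨?_, ?_⟩, ?_, ?_⟩ <;> linarith [h1.1, h1.2, h2.1, h2.2, h3.1, h3.2, h4.1, h4.2]

lemma Cfg.U_G2 (h : Cfg δ C0 s t μ P E) {a b : Pt} (ha : a ∈ P) (hb : b ∈ P) (d θ : ℝ)
    (hδd : δ ≤ d) (hd2 : d ≤ 2) (hab : dist a b ≤ d) (hab' : d / 2 < dist a b)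
    (hθ : 800 * (δ * d) ≤ θ) (hQ : θ ≤ |Qf a b|) :
    Uf E a b ≤ 2 * C0 * (600 / Real.sqrt θ) ^ s := by
  have hδ := h.hδ
  have hd : 0 < d := by linarith
  have hθ0 : 0 < θ := by have := mul_pos hδ hd; linarith
  have hsq : 0 < Real.sqrt θ := Real.sqrt_pos.2 hθ0
  obtain ⟨c1, c2, c3⟩ := dist_coord a b d hab
  have hra := (h.hr a ha).1
  have hrb := (h.hr b hb).1
  obtain ⟨x1, x2⟩ := h.X_small ha hb
  have hθ4 : θ ≤ 3 := by
    refine hQ.trans ?_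
    unfold Qf
    have q1 : (a.1 - b.1) ^ 2 ≤ 0.02 ^ 2 := by rw [← sq_abs]; gcongr
    have q2 : (a.2.1 - b.2.1) ^ 2 ≤ 0.02 ^ 2 := by rw [← sq_abs]; gcongr
    have q3 : (a.2.2 - b.2.2) ^ 2 ≤ 1 ^ 2 := by
      apply sq_le_sq'
      · linarith [hra.1, hrb.2]
      · linarith [hra.2, hrb.1]
    rw [abs_le]; constructor <;> nlinarith [sq_nonneg (a.1 - b.1), sq_nonneg (a.2.1 - b.2.1), sq_nonneg (a.2.2 - b.2.2)]
  have hsq2 : Real.sqrt θ ≤ 2 := by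
    rw [Real.sqrt_le_left (by norm_num)]; linarith
  set ρ := 600 * δ / Real.sqrt θ with hρ
  have hρδ : δ ≤ ρ := by
    rw [hρ, le_div_iff₀ hsq]; nlinarith
  have key : ∀ S : Finset (ℝ × ℝ), S ⊆ E a ∩ E b →
      (∀ z ∈ S, ∀ y ∈ S, (0 ≤ (z.1 - a.1) * (a.2.1 - b.2.1) - (z.2 - a.2.1) * (a.1 - b.1) ↔
        0 ≤ (y.1 - a.1) * (a.2.1 - b.2.1) - (y.2 - a.2.1) * (a.1 - b.1))) →
      (S.card : ℝ) ≤ C0 * (600 / Real.sqrt θ) ^ s := by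
    intro S hS hsg
    have e : ρ / δ = 600 / Real.sqrt θ := by rw [hρ]; field_simp
    rcases S.eq_empty_or_nonempty with rfl | ⟨y, hy⟩
    · simp; have := h.hC0; positivity
    rw [← e]
    apply h.card_le_of_dist ha S (fun z hz => (mem_inter.1 (hS hz)).1) y ρ hρδ
    intro z hz
    obtain ⟨z1, z2⟩ := h.zeta ha hb (hS hz)
    obtain ⟨y1, y2⟩ := h.zeta ha hb (hS hy)
    have := geo_G2 δ d θ _ _ _ _ _ _ _ _ hδ hδd hd2 hra (by simpa using hrb) c1 c2 c3 x1 x2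
      (by rw [← dist_max]; exact hab') hθ hQ z1 z2 y1 y2 (hsg z hz y hy)
    apply dist2_le _ _ _ (by linarith)
    have e2 : ρ ^ 2 = 600 ^ 2 * (δ ^ 2 / θ) := by
      rw [hρ, div_pow, Real.sq_sqrt hθ0.le]; ring
    rw [e2]
    convert this using 2 <;> ring
  unfold Uf
  rw [← card_filter_add_card_filter_not (s := E a ∩ E b)
    (fun z => 0 ≤ (z.1 - a.1) * (a.2.1 - b.2.1) - (z.2 - a.2.1) * (a.1 - b.1))]
  push_cast
  have k1 := key ((E a ∩ E b).filter
    (fun z => 0 ≤ (z.1 - a.1) * (a.2.1 - b.2.1) - (z.2 - a.2.1) * (a.1 - b.1)))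
    (filter_subset _ _) (by
      intro z hz y hy
      rw [mem_filter] at hz hy
      exact ⟨fun _ => hy.2, fun _ => hz.2⟩)
  have k2 := key ((E a ∩ E b).filter
    (fun z => ¬ 0 ≤ (z.1 - a.1) * (a.2.1 - b.2.1) - (z.2 - a.2.1) * (a.1 - b.1)))
    (filter_subset _ _) (by
      intro z hz y hy
      rw [mem_filter] at hz hy
      exact ⟨fun q => absurd q hz.2, fun q => absurd q hy.2⟩)
  linarith

def TT (δ d τ : ℝ) (a b : Pt) : Prop :=
  d / 2 < dist a b ∧ dist a b ≤ d ∧ b.2.2 < a.2.2 ∧ |Qf a b| ≤ τ * d ∧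
    (τ = 800 * δ ∨ τ * d / 2 ≤ |Qf a b|)

lemma TT.geo {d τ : ℝ} (hd : 0 < d) (hτd : τ ≤ d / 100) {a b : Pt} (h : TT δ d τ a b) :
    0.48 * d ≤ a.2.2 - b.2.2 ∧ 0.47 ^ 2 * d ^ 2 ≤ (a.1 - b.1) ^ 2 + (a.2.1 - b.2.1) ^ 2 := by
  apply geo_R d τ _ _ _ hd hτd (by rw [← dist_max]; exact h.1) (by linarith [h.2.2.1]) h.2.2.2.1

/-- tangency centre -/
def gc (a b : Pt) : ℝ × ℝ :=
  (a.1 - a.2.2 * (a.1 - b.1) / (a.2.2 - b.2.2), a.2.1 - a.2.2 * (a.2.1 - b.2.1) / (a.2.2 - b.2.2))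

lemma gc_eq {a b : Pt} (h : a.2.2 - b.2.2 ≠ 0) : gc a b =
  (b.1 - b.2.2 * (a.1 - b.1) / (a.2.2 - b.2.2), b.2.1 - b.2.2 * (a.2.1 - b.2.1) / (a.2.2 - b.2.2)) := by
  unfold gc
  ext <;> simp <;> field_simp <;> ring

lemma Cfg.near_gc (h : Cfg δ C0 s t μ P E) {a b : Pt} (ha : a ∈ P) (hb : b ∈ P) (d τ : ℝ)
    (hd : 0 < d) (hd2 : d ≤ 2) (hτ : 800 * δ ≤ τ) (hτd : τ ≤ d / 100)
    (hT : TT δ d τ a b) (z : ℝ × ℝ) (hz : z ∈ E a ∩ E b) :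
    dist z (gc a b) ≤ 6 * Real.sqrt (τ / d) := by
  obtain ⟨z1, z2⟩ := h.zeta ha hb hz
  have hτ0 : 0 < τ := by have := h.hδ; linarith
  have := geo_G1 δ d τ _ _ _ _ _ _ h.hδ hd hd2 hτ (h.hr a ha).1 (hT.geo hd hτd).1 hT.2.2.2.1 z1 z2
  apply dist2_le _ _ _ (by positivity)
  rw [mul_pow, Real.sq_sqrt (by positivity)]
  have hT : 0 < τ / d := by positivity
  calc _ = (z.1 - a.1 + a.2.2 * (a.1 - b.1) / (a.2.2 - b.2.2)) ^ 2 +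
      (z.2 - a.2.1 + a.2.2 * (a.2.1 - b.2.1) / (a.2.2 - b.2.2)) ^ 2 := by
        unfold gc; ring
    _ ≤ _ := this
    _ ≤ _ := by nlinarith

lemma Cfg.U_tang (h : Cfg δ C0 s t μ P E) {a b : Pt} (ha : a ∈ P) (hb : b ∈ P) (d τ : ℝ)
    (hδd : δ ≤ d) (hd2 : d ≤ 2) (hτ : 800 * δ ≤ τ) (hτd : τ ≤ d / 100)
    (hT : TT δ d τ a b) (hτ2 : τ = 800 * δ ∨ 1600 * δ ≤ τ) :
    Uf E a b ≤ 5000 * C0 * (1 / Real.sqrt (τ * d)) ^ s := by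
  have hδ := h.hδ
  have hC0 := h.hC0
  have hd : 0 < d := by linarith
  have hτ0 : 0 < τ := by linarith
  have hs0 : 0 ≤ s := by linarith [h.ht, h.hts]
  have hq : 0 < Real.sqrt (τ * d) := Real.sqrt_pos.2 (by positivity)
  have low : τ = 800 * δ → Uf E a b ≤ 5000 * C0 * (1 / Real.sqrt (τ * d)) ^ s := by
    intro hτe
    have e1 : Real.sqrt (τ / d) = τ / Real.sqrt (τ * d) := by
      rw [eq_div_iff hq.ne', ← Real.sqrt_mul (by positivity)]
      rw [show τ / d * (τ * d) = τ ^ 2 by field_simp]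
      exact Real.sqrt_sq hτ0.le
    have e2 : 6 * Real.sqrt (τ / d) / δ = 4800 * (1 / Real.sqrt (τ * d)) := by
      rw [e1, hτe]; field_simp; norm_num
    have hq2 : Real.sqrt (τ * d) ≤ 1 := by
      rw [Real.sqrt_le_left (by norm_num)]; nlinarith
    have hge : δ ≤ 6 * Real.sqrt (τ / d) := by
      rw [e1, hτe]
      rw [← mul_div_assoc, le_div_iff₀ (by rw [← hτe]; exact hq), ← hτe]; nlinarith
    have := h.card_le_of_dist ha (E a ∩ E b) inter_subset_left (gc a b) _ hge
      (fun z hz => h.near_gc ha hb d τ hd hd2 hτ hτd hT z hz)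
    rw [e2] at this
    refine this.trans ?_
    have h3 := rpow_cmul 4800 (1 / Real.sqrt (τ * d)) s (by norm_num) (by positivity) hs0 h.hs1
    have : 0 ≤ (1 / Real.sqrt (τ * d)) ^ s := by positivity
    calc _ ≤ C0 * (4800 * (1 / Real.sqrt (τ * d)) ^ s) := by gcongr
      _ ≤ _ := by nlinarith
  rcases hT.2.2.2.2 with hτe | hQ
  · exact low hτe
  rcases hτ2 with hτe | hτ2
  · exact low hτe
  have hδd0 := mul_pos hδ hd
  have := h.U_G2 ha hb d (τ * d / 2) hδd hd2 hT.2.1 hT.1 (by nlinarith) hQ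
  refine this.trans ?_
  have e3 : 600 / Real.sqrt (τ * d / 2) ≤ 1200 * (1 / Real.sqrt (τ * d)) := by
    have : Real.sqrt (τ * d) / 2 ≤ Real.sqrt (τ * d / 2) := by
      rw [div_le_iff₀ (by norm_num)]
      apply Real.sqrt_le_iff.2
      constructor
      · positivity
      · rw [mul_pow, Real.sq_sqrt (by positivity)]
        have := mul_pos hτ0 hd
        linarith
    have h2 : 0 < Real.sqrt (τ * d) / 2 := by positivity
    calc 600 / Real.sqrt (τ * d / 2) ≤ 600 / (Real.sqrt (τ * d) / 2) := by gcongr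
      _ = _ := by field_simp; norm_num
  have h3 := rpow_cmul 1200 (1 / Real.sqrt (τ * d)) s (by norm_num) (by positivity) hs0 h.hs1
  have : 0 ≤ (1 / Real.sqrt (τ * d)) ^ s := by positivity
  calc _ ≤ 2 * C0 * (1200 * (1 / Real.sqrt (τ * d))) ^ s := by gcongr
    _ ≤ 2 * C0 * (1200 * (1 / Real.sqrt (τ * d)) ^ s) := by gcongr
    _ ≤ _ := by nlinarith

/-- double counting -/
lemma Cfg.W_bound (h : Cfg δ C0 s t μ P E) {a : Pt} (ha : a ∈ P) (S : Finset Pt) (hS : S ⊆ P)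
    (y : ℝ × ℝ) (ρ : ℝ) (hρ : δ ≤ ρ) (hd : ∀ b ∈ S, ∀ z ∈ E a ∩ E b, dist z y ≤ ρ) :
    ∑ b ∈ S, Uf E a b ≤ 2 * μ * (C0 * (ρ / δ) ^ s) := by
  have hμ := h.hμ
  have e1 : ∀ b ∈ S, Uf E a b = ∑ z ∈ (E a).filter (fun z => dist z y ≤ ρ),
      if z ∈ E b then (1:ℝ) else 0 := by
    intro b hb
    unfold Uf
    rw [sum_boole]
    congr 2
    ext z
    simp only [mem_inter, mem_filter]
    constructor
    · rintro ⟨z1, z2⟩; exact ⟨⟨z1, hd b hb z (mem_inter.2 ⟨z1, z2⟩)⟩, z2⟩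
    · rintro ⟨⟨z1, _⟩, z2⟩; exact ⟨z1, z2⟩
  rw [sum_congr rfl e1, sum_comm]
  calc _ ≤ ∑ z ∈ (E a).filter (fun z => dist z y ≤ ρ), 2 * μ := by
        refine sum_le_sum fun z _ => ?_
        rw [sum_boole]
        refine le_trans ?_ (h.hm z)
        gcongr
    _ = 2 * μ * (((E a).filter (fun z => dist z y ≤ ρ)).card : ℝ) := by
        rw [sum_const, nsmul_eq_mul]; ring
    _ ≤ _ := by
        gcongr
        exact h.hEc a ha y ρ hρ
end
end

noncomputable section
open Finset Classical

def xw (e1 e2 : ℝ) (a b : Pt) : ℝ :=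
  ((a.1 - b.1) * e2 - (a.2.1 - b.2.1) * e1) /
    ((a.2.2 - b.2.2) + ((a.1 - b.1) * e1 + (a.2.1 - b.2.1) * e2))

def uw (e1 e2 : ℝ) (a b : Pt) : ℝ :=
  (a.2.2 - b.2.2) + ((a.1 - b.1) * e1 + (a.2.1 - b.2.1) * e2)

def wT (E : Pt → Finset (ℝ × ℝ)) (P : Finset Pt) (δ d τ : ℝ) (a b : Pt) : ℝ :=
  if a ∈ P ∧ b ∈ P ∧ TT δ d τ a b then Uf E a b else 0

lemma frame_exists (d A1 A2 R0 : ℝ) (hd : 0 < d) (hR0 : 0.48 * d ≤ R0)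
    (hA : 0.47 ^ 2 * d ^ 2 ≤ A1 ^ 2 + A2 ^ 2) :
    ∃ e1 e2 u0 : ℝ, e1 ^ 2 + e2 ^ 2 = 1 ∧ |e1| ≤ 1 ∧ |e2| ≤ 1 ∧ u0 = R0 + (A1 * e1 + A2 * e2) ∧
      A1 * e2 - A2 * e1 = 0 ∧ 0.95 * d ≤ u0 := by
  set D := Real.sqrt (A1 ^ 2 + A2 ^ 2) with hD
  have hD2 : D ^ 2 = A1 ^ 2 + A2 ^ 2 := Real.sq_sqrt (by positivity)
  have hDd : 0.47 * d ≤ D := by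
    apply Real.le_sqrt_of_sq_le; nlinarith
  have hD0 : 0 < D := by linarith
  have hu : (A1 / D) ^ 2 + (A2 / D) ^ 2 = 1 := by
    rw [div_pow, div_pow, ← add_div, ← hD2]; field_simp
  refine ⟨A1 / D, A2 / D, _, hu, ?_, ?_, rfl, by field_simp; ring, ?_⟩
  · exact abs_le_one_iff_mul_self_le_one.2 (by nlinarith [sq_nonneg (A2 / D)])
  · exact abs_le_one_iff_mul_self_le_one.2 (by nlinarith [sq_nonneg (A1 / D)])
  · have : A1 * (A1 / D) + A2 * (A2 / D) = D := by
      field_simp; linarith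
    rw [this]; linarith

lemma frame_est (d A1 A2 R0 X1 X2 R e1 e2 u0 : ℝ) (hd : 0 < d) (h1 : |e1| ≤ 1) (h2 : |e2| ≤ 1)
    (hu0 : u0 = R0 + (A1 * e1 + A2 * e2)) (hw : A1 * e2 - A2 * e1 = 0)
    (c1 : |X1 - A1| ≤ d / 1000) (c2 : |X2 - A2| ≤ d / 1000) (c3 : |R - R0| ≤ d / 1000) :
    |R + (X1 * e1 + X2 * e2) - u0| ≤ 3 * (d / 1000) ∧ |X1 * e2 - X2 * e1| ≤ 2 * (d / 1000) := by
  have m : ∀ x y : ℝ, |x| ≤ d / 1000 → |y| ≤ 1 → |x * y| ≤ d / 1000 := by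
    intro x y hx hy
    rw [abs_mul]
    calc |x| * |y| ≤ d / 1000 * 1 := by gcongr
      _ = _ := mul_one _
  constructor
  · have : R + (X1 * e1 + X2 * e2) - u0 = (R - R0) + (X1 - A1) * e1 + (X2 - A2) * e2 := by
      rw [hu0]; ring
    rw [this]
    have t1 := abs_add_le ((R - R0) + (X1 - A1) * e1) ((X2 - A2) * e2)
    have t2 := abs_add_le (R - R0) ((X1 - A1) * e1)
    have := m _ _ c1 h1
    have := m _ _ c2 h2
    linarith
  · have : X1 * e2 - X2 * e1 = (X1 - A1) * e2 - (X2 - A2) * e1 := by linarith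
    rw [this]
    have t1 := abs_sub ((X1 - A1) * e2) ((X2 - A2) * e1)
    have := m _ _ c1 h2
    have := m _ _ c2 h1
    linarith

lemma frame_supp (d τ X1 X2 R e1 e2 u0 ρ : ℝ) (hd : 0 < d) (hτ : 0 < τ) (he : e1 ^ 2 + e2 ^ 2 = 1)
    (hu0 : 0.95 * d ≤ u0)
    (hu : |R + (X1 * e1 + X2 * e2) - u0| ≤ 3 * (d / 1000)) (hw : |X1 * e2 - X2 * e1| ≤ 2 * (d / 1000))
    (hQ : |X1 ^ 2 + X2 ^ 2 - R ^ 2| ≤ τ * d) (hρ : ρ ^ 2 = 2 * (τ / d)) (cm : ℝ)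
    (hcm : cm = u0 - 3 * (d / 1000)) (u w : ℝ) (hud : u = R + (X1 * e1 + X2 * e2))
    (hwd : w = X1 * e2 - X2 * e1) :
    0.9 * d ≤ u ∧ 
    (1 ≤ u / cm ∧ u / cm ≤ 1.01) ∧ |-(X1 ^ 2 + X2 ^ 2 - R ^ 2) / (u * cm)| ≤ ρ ^ 2 ∧ |w / u| ≤ 1 ∧
    w / cm = u / cm * (w / u) ∧ (R - (X1 * e1 + X2 * e2)) / cm =
      u / cm * (w / u) ^ 2 + -(X1 ^ 2 + X2 ^ 2 - R ^ 2) / (u * cm) := by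
  rw [← hud] at hu
  rw [← hwd] at hw
  obtain ⟨hu1, hu2⟩ := abs_le.1 hu
  have hcm0 : 0.94 * d ≤ cm := by rw [hcm]; linarith
  have hcmp : 0 < cm := by linarith
  have hu94 : 0.94 * d ≤ u := by linarith
  have hup : 0 < u := by linarith
  refine ⟨by linarith, ⟨?_, ?_⟩, ?_, ?_, ?_, ?_⟩
  · rw [le_div_iff₀ hcmp]; linarith
  · rw [div_le_iff₀ hcmp]; linarith
  · rw [abs_div, abs_neg, abs_of_pos (mul_pos hup hcmp), hρ, div_le_iff₀ (mul_pos hup hcmp)]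
    refine hQ.trans ?_
    have : (0.94 * d) * (0.94 * d) ≤ u * cm := by gcongr
    calc τ * d = (τ / d) * d ^ 2 := by field_simp
      _ ≤ 2 * (τ / d) * ((0.94 * d) * (0.94 * d)) := by
        have : 0 < τ / d * d ^ 2 := by positivity
        nlinarith
      _ ≤ _ := by gcongr
  · rw [abs_div, abs_of_pos hup, div_le_one hup]; linarith
  · field_simp
  · have key : w ^ 2 + (X1 * e1 + X2 * e2) ^ 2 = X1 ^ 2 + X2 ^ 2 := by
      rw [hwd]; linear_combination (X1 ^ 2 + X2 ^ 2) * he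
    have hup' := hup.ne'
    field_simp
    have : u * (R - (X1 * e1 + X2 * e2)) = w ^ 2 - (X1 ^ 2 + X2 ^ 2 - R ^ 2) := by
      rw [← key, hud]; ring
    linarith

lemma dist_scale (q : ℝ) (r A1 A2 B1 B2 x1 x2 : ℝ) (hr : 0 ≤ r) (hr2 : r ≤ 2) (hq : 0 ≤ q)
    (h : (A1 - B1) ^ 2 + (A2 - B2) ^ 2 ≤ 1000 * q) :
    dist ((x1 - r * A1, x2 - r * A2) : ℝ × ℝ) (x1 - r * B1, x2 - r * B2) ≤ 64 * Real.sqrt q := by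
  apply dist2_le _ _ _ (by positivity)
  rw [mul_pow, Real.sq_sqrt hq]
  have : (x1 - r * A1 - (x1 - r * B1)) ^ 2 + (x2 - r * A2 - (x2 - r * B2)) ^ 2 =
    r ^ 2 * ((A1 - B1) ^ 2 + (A2 - B2) ^ 2) := by ring
  simp only
  rw [this]
  calc _ ≤ 2 ^ 2 * (1000 * q) := by gcongr
    _ ≤ _ := by linarith

section
variable {δ C0 s t μ : ℝ} {P : Finset Pt} {E : Pt → Finset (ℝ × ℝ)}

lemma gc_near_left {d τ e1 e2 ρ : ℝ} (hd : 0 < d) (hτ : 0 < τ) (he : e1 ^ 2 + e2 ^ 2 = 1)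
    (hτd : τ ≤ d / 100) (hρ : ρ ^ 2 = 2 * (τ / d)) {a b b' : Pt} (hT : TT δ d τ a b) (hT' : TT δ d τ a b')
    (hu : 0.9 * d ≤ uw e1 e2 a b) (hu' : 0.9 * d ≤ uw e1 e2 a b') (hr : 0 ≤ a.2.2 ∧ a.2.2 ≤ 2)
    (hx : |xw e1 e2 a b - xw e1 e2 a b'| ≤ 10 * ρ) :
    dist (gc a b) (gc a b') ≤ 64 * Real.sqrt (τ / d) := by
  have := geo_near d τ _ _ _ _ _ _ e1 e2 hd hτ he (hT.geo hd hτd).1 (hT'.geo hd hτd).1 hτd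
    hT.2.2.2.1 hT'.2.2.2.1 hu hu' ρ hρ hx
  have h2 := dist_scale (τ / d) a.2.2 _ _ _ _ a.1 a.2.1 hr.1 hr.2 (by positivity) this
  unfold gc
  simpa only [mul_div_assoc] using h2

lemma gc_near_right {d τ e1 e2 ρ : ℝ} (hd : 0 < d) (hτ : 0 < τ) (he : e1 ^ 2 + e2 ^ 2 = 1)
    (hτd : τ ≤ d / 100) (hρ : ρ ^ 2 = 2 * (τ / d)) {a a' b : Pt} (hT : TT δ d τ a b) (hT' : TT δ d τ a' b)
    (hu : 0.9 * d ≤ uw e1 e2 a b) (hu' : 0.9 * d ≤ uw e1 e2 a' b) (hr : 0 ≤ b.2.2 ∧ b.2.2 ≤ 2)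
    (hx : |xw e1 e2 a b - xw e1 e2 a' b| ≤ 10 * ρ) :
    dist (gc a b) (gc a' b) ≤ 64 * Real.sqrt (τ / d) := by
  have := geo_near d τ _ _ _ _ _ _ e1 e2 hd hτ he (hT.geo hd hτd).1 (hT'.geo hd hτd).1 hτd
    hT.2.2.2.1 hT'.2.2.2.1 hu hu' ρ hρ hx
  have h2 := dist_scale (τ / d) b.2.2 _ _ _ _ b.1 b.2.1 hr.1 hr.2 (by positivity) this
  rw [gc_eq (by linarith [hT.2.2.1]), gc_eq (by linarith [hT'.2.2.1])]
  simpa only [mul_div_assoc] using h2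

lemma Uf_comm (E : Pt → Finset (ℝ × ℝ)) (a b : Pt) : Uf E a b = Uf E b a := by
  unfold Uf; rw [inter_comm]

lemma Cfg.block_sq (h : Cfg δ C0 s t μ P E) (d τ : ℝ) 
    (hδd : δ ≤ d) (hd2 : d ≤ 2) (hτ : 800 * δ ≤ τ) (hτd : τ ≤ d / 100)
    (hτ2 : τ = 800 * δ ∨ 1600 * δ ≤ τ) (A B : Finset Pt) (hA : A ⊆ P) (hB : B ⊆ P)
    (hAd : ∀ a ∈ A, ∀ a' ∈ A, dist a a' ≤ d / 2000) (hBd : ∀ a ∈ B, ∀ a' ∈ B, dist a a' ≤ d / 2000)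
    (M : ℕ) (hM : 1 ≤ M) (hMρ : 3 ≤ 2 ^ (M - 1) * Real.sqrt (2 * (τ / d))) :
    (∑ a ∈ A, ∑ b ∈ B, wT E P δ d τ a b) ^ 2 ≤ (8 * M + 4) *
      ((5000 * C0 * (1 / Real.sqrt (τ * d)) ^ s) * (2 * μ * (C0 * (70 * Real.sqrt (τ / d) / δ) ^ s))) *
        ((A.card : ℝ) + B.card) ^ 3 := by
  have hδ := h.hδ
  have hC0 := h.hC0
  have hμ := h.hμ
  have hd : 0 < d := by linarith
  have hτ0 : 0 < τ := by linarith
  have hs0 : 0 ≤ s := by linarith [h.ht, h.hts]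
  by_cases hex : ∃ a ∈ A, ∃ b ∈ B, TT δ d τ a b
  swap
  · have : ∑ a ∈ A, ∑ b ∈ B, wT E P δ d τ a b = 0 := by
      refine sum_eq_zero fun a ha => sum_eq_zero fun b hb => ?_
      unfold wT
      rw [if_neg]
      rintro ⟨-, -, hT⟩
      exact hex ⟨a, ha, b, hb, hT⟩
    rw [this, zero_pow two_ne_zero]; positivity
  obtain ⟨a0, ha0, b0, hb0, hT0⟩ := hex
  obtain ⟨e1, e2, u0, he, he1, he2, hu0, hw0, hu0d⟩ :=
    frame_exists d _ _ _ hd (hT0.geo hd hτd).1 (hT0.geo hd hτd).2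
  set ρ := Real.sqrt (2 * (τ / d)) with hρd
  have hρ2 : ρ ^ 2 = 2 * (τ / d) := Real.sq_sqrt (by positivity)
  have hρ : 0 < ρ := Real.sqrt_pos.2 (by positivity)
  set cm := u0 - 3 * (d / 1000) with hcm
  have hest : ∀ a ∈ A, ∀ b ∈ B, |uw e1 e2 a b - u0| ≤ 3 * (d / 1000) ∧
      |(a.1 - b.1) * e2 - (a.2.1 - b.2.1) * e1| ≤ 2 * (d / 1000) := by
    intro a ha b hb
    obtain ⟨k1, k2, k3⟩ := dist_coord _ _ _ (hAd a ha a0 ha0)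
    obtain ⟨l1, l2, l3⟩ := dist_coord _ _ _ (hBd b hb b0 hb0)
    have m : ∀ x y x' y' : ℝ, |x - x'| ≤ d / 2000 → |y - y'| ≤ d / 2000 →
        |(x - y) - (x' - y')| ≤ d / 1000 := by
      intro x y x' y' h1 h2
      have := abs_sub (x - x') (y - y')
      rw [show (x - y) - (x' - y') = (x - x') - (y - y') by ring]
      linarith
    exact frame_est d _ _ _ _ _ _ e1 e2 u0 hd he1 he2 hu0 hw0 (m _ _ _ _ k1 l1) (m _ _ _ _ k2 l2)
      (m _ _ _ _ k3 l3)
  have hu9 : ∀ a ∈ A, ∀ b ∈ B, 0.9 * d ≤ uw e1 e2 a b := by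
    intro a ha b hb
    have := (abs_le.1 (hest a ha b hb).1).1
    linarith
  have hwT : ∀ a b, wT E P δ d τ a b ≠ 0 → a ∈ P ∧ b ∈ P ∧ TT δ d τ a b := by
    intro a b hab
    unfold wT at hab
    by_contra hc
    rw [if_neg hc] at hab
    exact hab rfl
  have hwT' : ∀ a b, a ∈ P ∧ b ∈ P ∧ TT δ d τ a b → wT E P δ d τ a b = Uf E a b := by
    intro a b hab; unfold wT; rw [if_pos hab]
  have hwU : ∀ a b, 0 ≤ wT E P δ d τ a b := by
    intro a b; unfold wT Uf; split_ifs <;> positivity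
  have hn0 : (0:ℝ) ≤ A.card := by positivity
  have hn1 : (0:ℝ) ≤ B.card := by positivity
  have hsq : 0 ≤ Real.sqrt (τ / d) := Real.sqrt_nonneg _
  have hge : δ ≤ 70 * Real.sqrt (τ / d) := by
    have : δ ≤ Real.sqrt (τ / d) := by
      apply Real.le_sqrt_of_sq_le
      rw [le_div_iff₀ hd]
      have hδ1 := h.hδ1
      have : δ ^ 2 * d ≤ δ * 2 := by
        calc δ ^ 2 * d = δ * (δ * d) := by ring
          _ ≤ δ * (1 * 2) := by gcongr
          _ = _ := by ring
      linarith
    linarith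
  refine kst_bound A B (wT E P δ d τ) (xw e1 e2) (fun a b => uw e1 e2 a b / cm)
    (fun a b => - Qf a b / (uw e1 e2 a b * cm)) ρ
    (fun a => (a.2.2 + (a.1 * e1 + a.2.1 * e2)) / cm) (fun a => (a.1 * e2 - a.2.1 * e1) / cm)
    (fun a => (a.2.2 - (a.1 * e1 + a.2.1 * e2)) / cm)
    (fun a => (a.2.2 + (a.1 * e1 + a.2.1 * e2)) / cm) (fun a => (a.1 * e2 - a.2.1 * e1) / cm)
    (fun a => (a.2.2 - (a.1 * e1 + a.2.1 * e2)) / cm)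
    ?_ hwU hρ M hM hMρ _ _ _ ?_ (by positivity) (by positivity) ?_ ?_ (by linarith) (by linarith)
  · intro a ha b hb hab
    have hT := (hwT a b hab).2.2
    have := frame_supp d τ _ _ _ e1 e2 u0 ρ hd hτ0 he hu0d (hest a ha b hb).1 (hest a ha b hb).2
      hT.2.2.2.1 hρ2 cm hcm (uw e1 e2 a b) _ rfl rfl
    obtain ⟨-, f2, f3, f4, f5, f6⟩ := this
    refine ⟨f2, f3, f4, ?_, ?_, ?_⟩
    · simp only; rw [← sub_div]; unfold uw; congr 1; ring
    · simp only [xw]; unfold uw at f5 ⊢; rw [← f5, ← sub_div]; congr 1; ring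
    · simp only [xw, Qf]; unfold uw at f6 ⊢; rw [← f6, ← sub_div]; congr 1; ring
  · intro a b
    by_cases hab : a ∈ P ∧ b ∈ P ∧ TT δ d τ a b
    · rw [hwT' a b hab]
      exact h.U_tang hab.1 hab.2.1 d τ hδd hd2 hτ hτd hab.2.2 hτ2
    · unfold wT; rw [if_neg hab]; positivity
  · intro a ha b hb hab
    obtain ⟨haP, hbP, hT⟩ := hwT a b hab
    have hra := (h.hr a haP).1
    refine le_trans ?_ (h.W_bound haP (B.filter fun b' => TT δ d τ a b' ∧ |xw e1 e2 a b' - xw e1 e2 a b| ≤ 10 * ρ)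
      ((filter_subset _ _).trans hB) (gc a b) _ hge ?_)
    · rw [sum_filter]
      refine sum_le_sum fun b' hb' => ?_
      by_cases h1 : TT δ d τ a b' ∧ |xw e1 e2 a b' - xw e1 e2 a b| ≤ 10 * ρ
      · rw [if_pos h1, hwT' a b' ⟨haP, hB hb', h1.1⟩]
        have : 0 ≤ Uf E a b' := by unfold Uf; positivity
        split_ifs <;> simp [this]
      · rw [if_neg h1]
        by_cases h2 : TT δ d τ a b'
        · rw [if_neg, mul_zero]
          intro h3
          exact h1 ⟨h2, by linarith⟩
        · unfold wT; rw [if_neg, zero_mul]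
          exact fun hh => h2 hh.2.2
    · intro b' hb' z hz
      rw [mem_filter] at hb'
      obtain ⟨hb', hT', hx⟩ := hb'
      have d1 := h.near_gc haP (hB hb') d τ hd hd2 hτ hτd hT' z hz
      have d2 := gc_near_left hd hτ0 he hτd hρ2 hT' hT (hu9 a ha b' hb') (hu9 a ha b hb)
        ⟨by linarith [hra.1], hra.2⟩ hx
      have := dist_triangle z (gc a b') (gc a b)
      linarith
  · intro a ha b hb hab
    obtain ⟨haP, hbP, hT⟩ := hwT a b hab
    have hra := (h.hr b hbP).1
    refine le_trans ?_ (h.W_bound hbP (A.filter fun a' => TT δ d τ a' b ∧ |xw e1 e2 a' b - xw e1 e2 a b| ≤ 10 * ρ)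
      ((filter_subset _ _).trans hA) (gc a b) _ hge ?_)
    · rw [sum_filter]
      refine sum_le_sum fun b' hb' => ?_
      by_cases h1 : TT δ d τ b' b ∧ |xw e1 e2 b' b - xw e1 e2 a b| ≤ 10 * ρ
      · rw [if_pos h1, hwT' b' b ⟨hA hb', hbP, h1.1⟩, Uf_comm]
        have : 0 ≤ Uf E b b' := by unfold Uf; positivity
        split_ifs <;> simp [this]
      · rw [if_neg h1]
        by_cases h2 : TT δ d τ b' b
        · rw [if_neg, mul_zero]
          intro h3
          exact h1 ⟨h2, by linarith⟩
        · unfold wT; rw [if_neg, zero_mul]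
          exact fun hh => h2 hh.2.2
    · intro b' hb' z hz
      rw [mem_filter] at hb'
      obtain ⟨hb', hT', hx⟩ := hb'
      rw [inter_comm] at hz
      have d1 := h.near_gc (hA hb') hbP d τ hd hd2 hτ hτd hT' z hz
      have d2 := gc_near_right hd hτ0 he hτd hρ2 hT' hT (hu9 b' hb' b hb) (hu9 a ha b hb)
        ⟨by linarith [hra.1], hra.2⟩ hx
      have := dist_triangle z (gc b' b) (gc a b)
      linarith

/-- block estimate -/
lemma Cfg.block (h : Cfg δ C0 s t μ P E) (d τ : ℝ) 
    (hδd : δ ≤ d) (hd2 : d ≤ 2) (hτ : 800 * δ ≤ τ) (hτd : τ ≤ d / 100)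
    (hτ2 : τ = 800 * δ ∨ 1600 * δ ≤ τ) (A B : Finset Pt) (hA : A ⊆ P) (hB : B ⊆ P)
    (hAd : ∀ a ∈ A, ∀ a' ∈ A, dist a a' ≤ d / 2000) (hBd : ∀ a ∈ B, ∀ a' ∈ B, dist a a' ≤ d / 2000)
    (M : ℕ) (hM : 1 ≤ M) (hMρ : 3 ≤ 2 ^ (M - 1) * Real.sqrt (2 * (τ / d))) :
    ∑ a ∈ A, ∑ b ∈ B, wT E P δ d τ a b ≤
      Real.sqrt ((8 * M + 4) * (1400000 * μ * C0 ^ 3)) * (1 / δ) ^ s * ((A.card : ℝ) + B.card) := by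
  have hδ := h.hδ
  have hC0 := h.hC0
  have hμ := h.hμ
  have hd : 0 < d := by linarith
  have hτ0 : 0 < τ := by linarith
  have hs0 : 0 ≤ s := by linarith [h.ht, h.hts]
  have key := h.block_sq d τ hδd hd2 hτ hτd hτ2 A B hA hB hAd hBd M hM hMρ
  have hc : ∀ S : Finset Pt, S ⊆ P → (∀ a ∈ S, ∀ a' ∈ S, dist a a' ≤ d / 2000) →
      (S.card : ℝ) ≤ C0 * (d / δ) ^ s := by
    intro S hS hSd
    rcases S.eq_empty_or_nonempty with rfl | ⟨a0, ha0⟩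
    · simp; positivity
    calc (S.card : ℝ) ≤ ((P.filter (fun p => dist p a0 ≤ d)).card : ℝ) := by
          gcongr
          intro a ha
          rw [mem_filter]
          exact ⟨hS ha, (hSd a ha a0 ha0).trans (by linarith)⟩
      _ ≤ C0 * (d / δ) ^ t := h.hP a0 d hδd
      _ ≤ _ := by
          gcongr
          · rw [le_div_iff₀ hδ]; linarith
          · exact h.hts
  have hn : (A.card : ℝ) + B.card ≤ 2 * C0 * (d / δ) ^ s := by
    have := hc A hA hAd
    have := hc B hB hBd
    linarith
  set n := (A.card : ℝ) + B.card with hnd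
  have hn0 : 0 ≤ n := by positivity
  have e1 : (1 / Real.sqrt (τ * d)) ^ s * (70 * Real.sqrt (τ / d) / δ) ^ s ≤ 70 * (1 / (d * δ)) ^ s := by
    rw [← Real.mul_rpow (by positivity) (by positivity)]
    have : 1 / Real.sqrt (τ * d) * (70 * Real.sqrt (τ / d) / δ) = 70 * (1 / (d * δ)) := by
      have hs : Real.sqrt (τ / d) = Real.sqrt (τ * d) / d := by
        rw [eq_div_iff hd.ne']
        nth_rewrite 2 [← Real.sqrt_sq hd.le]
        rw [← Real.sqrt_mul (by positivity)]
        congr 1; field_simp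
      rw [hs]
      have : 0 < Real.sqrt (τ * d) := Real.sqrt_pos.2 (by positivity)
      field_simp
    rw [this]
    exact rpow_cmul _ _ _ (by norm_num) (by positivity) hs0 h.hs1
  have e2 : (1 / (d * δ)) ^ s * (d / δ) ^ s = ((1 / δ) ^ s) ^ 2 := by
    rw [sq, ← Real.mul_rpow (by positivity) (by positivity), ← Real.mul_rpow (by positivity) (by positivity)]
    congr 1; field_simp
  have hsq : (∑ a ∈ A, ∑ b ∈ B, wT E P δ d τ a b) ^ 2 ≤
      (Real.sqrt ((8 * M + 4) * (1400000 * μ * C0 ^ 3)) * (1 / δ) ^ s * n) ^ 2 := by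
    refine key.trans ?_
    rw [mul_pow, mul_pow, Real.sq_sqrt (by positivity), ← e2]
    have i1 : (5000 * C0 * (1 / Real.sqrt (τ * d)) ^ s) *
        (2 * μ * (C0 * (70 * Real.sqrt (τ / d) / δ) ^ s)) ≤ 700000 * μ * C0 ^ 2 * (1 / (d * δ)) ^ s := by
      calc _ = 10000 * μ * C0 ^ 2 * ((1 / Real.sqrt (τ * d)) ^ s * (70 * Real.sqrt (τ / d) / δ) ^ s) := by ring
        _ ≤ 10000 * μ * C0 ^ 2 * (70 * (1 / (d * δ)) ^ s) := by gcongr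
        _ = _ := by ring
    calc _ ≤ (8 * (M:ℝ) + 4) * (700000 * μ * C0 ^ 2 * (1 / (d * δ)) ^ s) * (n * n ^ 2) := by
          rw [← pow_succ' n 2]; gcongr
      _ ≤ (8 * (M:ℝ) + 4) * (700000 * μ * C0 ^ 2 * (1 / (d * δ)) ^ s) * (2 * C0 * (d / δ) ^ s * n ^ 2) := by
          gcongr
      _ = _ := by ring
  exact (le_abs_self _).trans (abs_le_of_sq_le_sq hsq (by positivity))
end
end

noncomputable section
open Finset Classical

lemma cell_sum {α G : Type*} [AddCommGroup G] [DecidableEq G] (P : Finset α) (κ : α → G) (w : α → α → ℝ)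
    (hw0 : ∀ a b, 0 ≤ w a b) (Z : ℝ) (hZ : 0 ≤ Z) (J : Finset G)
    (h1 : ∀ x y : G, ∑ a ∈ P with κ a = x, ∑ b ∈ P with κ b = y, w a b ≤
      Z * (((P.filter (κ · = x)).card : ℝ) + (P.filter (κ · = y)).card))
    (h2 : ∀ a b, w a b ≠ 0 → κ a - κ b ∈ J) :
    ∑ a ∈ P, ∑ b ∈ P, w a b ≤ 2 * Z * J.card * P.card := by
  have s1 : ∀ a ∈ P, ∑ b ∈ P, w a b ≤ ∑ g ∈ J, ∑ b ∈ P with κ b = κ a - g, w a b := by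
    intro a ha
    simp_rw [sum_filter]
    rw [sum_comm]
    refine sum_le_sum fun b hb => ?_
    by_cases hz : w a b = 0
    · simp [hz]
    · refine le_trans (le_of_eq ?_) (single_le_sum (f := fun g => if κ b = κ a - g then w a b else 0) (fun g _ => ?_) (h2 a b hz))
      · simp
      · split_ifs
        · exact hw0 a b
        · exact le_rfl
  have fib : ∀ (Q : Finset G) (f : G → G), Function.Injective f →
      ∑ x ∈ Q, ((P.filter (κ · = f x)).card : ℝ) ≤ P.card := by
    intro Q f hf
    rw [← Nat.cast_sum]
    norm_cast
    rw [← card_biUnion]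
    · apply card_le_card
      intro a ha
      rw [mem_biUnion] at ha
      obtain ⟨x, _, hx⟩ := ha
      exact (mem_filter.1 hx).1
    · intro x _ y _ hxy
      change Disjoint _ _
      rw [disjoint_left]
      intro a ha hb
      rw [mem_filter] at ha hb
      exact hxy (hf (ha.2.symm.trans hb.2))
  calc ∑ a ∈ P, ∑ b ∈ P, w a b ≤ ∑ a ∈ P, ∑ g ∈ J, ∑ b ∈ P with κ b = κ a - g, w a b := sum_le_sum s1
    _ = ∑ g ∈ J, ∑ a ∈ P, ∑ b ∈ P with κ b = κ a - g, w a b := sum_comm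
    _ = ∑ g ∈ J, ∑ x ∈ P.image κ, ∑ a ∈ P with κ a = x, ∑ b ∈ P with κ b = x - g, w a b := by
        refine sum_congr rfl fun g _ => ?_
        rw [← sum_fiberwise_of_maps_to (g := κ) (t := P.image κ) (fun a ha => mem_image_of_mem _ ha)]
        refine sum_congr rfl fun x _ => sum_congr rfl fun a ha => ?_
        rw [(mem_filter.1 ha).2]
    _ ≤ ∑ g ∈ J, ∑ x ∈ P.image κ, Z * (((P.filter (κ · = x)).card : ℝ) + (P.filter (κ · = x - g)).card) :=
        sum_le_sum fun g _ => sum_le_sum fun x _ => h1 x (x - g)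
    _ ≤ ∑ g ∈ J, Z * (P.card + P.card) := by
        refine sum_le_sum fun g _ => ?_
        rw [← mul_sum, sum_add_distrib]
        gcongr
        · exact fib _ (fun x => x) Function.injective_id
        · exact fib _ (fun x => x - g) sub_left_injective
    _ = _ := by rw [sum_const, nsmul_eq_mul]; ring

lemma floor_same (h x y : ℝ) (hh : 0 < h) (he : ⌊x / h⌋ = ⌊y / h⌋) : |x - y| ≤ h := by
  have := Int.abs_sub_lt_one_of_floor_eq_floor he
  rw [← sub_div, abs_div, abs_of_pos hh, div_lt_one hh] at this
  exact this.le

lemma floor_near (h x y : ℝ) (hh : 0 < h) (he : |x - y| ≤ 2000 * h) :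
    ⌊x / h⌋ - ⌊y / h⌋ ∈ Icc (-2001 : ℤ) 2001 := by
  have h1 := Int.floor_le (x / h)
  have h2 := Int.lt_floor_add_one (x / h)
  have h3 := Int.floor_le (y / h)
  have h4 := Int.lt_floor_add_one (y / h)
  rw [abs_le] at he
  have h5 : x / h - y / h ≤ 2000 := by rw [← sub_div, div_le_iff₀ hh]; exact he.2
  have h6 : -2000 ≤ x / h - y / h := by rw [← sub_div, le_div_iff₀ hh]; linarith [he.1]
  rw [mem_Icc]
  constructor
  · have : (-2001 : ℝ) ≤ ((⌊x / h⌋ - ⌊y / h⌋ : ℤ) : ℝ) := by push_cast; linarith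
    exact_mod_cast this
  · have : ((⌊x / h⌋ - ⌊y / h⌋ : ℤ) : ℝ) ≤ 2001 := by push_cast; linarith
    exact_mod_cast this

section
variable {δ C0 s t μ : ℝ} {P : Finset Pt} {E : Pt → Finset (ℝ × ℝ)}

lemma wT_nonneg (d τ : ℝ) (a b : Pt) : 0 ≤ wT E P δ d τ a b := by
  unfold wT Uf; split_ifs <;> positivity

lemma Cfg.class_sum (h : Cfg δ C0 s t μ P E) (d τ : ℝ) 
    (hδd : δ ≤ d) (hd2 : d ≤ 2) (hτ : 800 * δ ≤ τ) (hτd : τ ≤ d / 100)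
    (hτ2 : τ = 800 * δ ∨ 1600 * δ ≤ τ) 
    (M : ℕ) (hM : 1 ≤ M) (hMρ : 3 ≤ 2 ^ (M - 1) * Real.sqrt (2 * (τ / d))) :
    ∑ a ∈ P, ∑ b ∈ P, wT E P δ d τ a b ≤
      2 * (Real.sqrt ((8 * M + 4) * (1400000 * μ * C0 ^ 3)) * (1 / δ) ^ s) * 4003 ^ 3 * P.card := by
  have hδ := h.hδ
  have hd : 0 < d := by linarith
  set hh := d / 2000 with hhd
  have hh0 : 0 < hh := by positivity
  have hsame : ∀ x, ∀ a ∈ P.filter (fun a : Pt => ((⌊a.1 / hh⌋, ⌊a.2.1 / hh⌋, ⌊a.2.2 / hh⌋) : ℤ × ℤ × ℤ) = x), 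
      ∀ a' ∈ P.filter (fun a : Pt => ((⌊a.1 / hh⌋, ⌊a.2.1 / hh⌋, ⌊a.2.2 / hh⌋) : ℤ × ℤ × ℤ) = x), 
      dist a a' ≤ d / 2000 := by
    intro x a ha a' ha'
    rw [mem_filter] at ha ha'
    have := ha.2.trans ha'.2.symm
    simp only [Prod.mk.injEq] at this
    rw [dist_max]
    exact max_le (floor_same _ _ _ hh0 this.1) (max_le (floor_same _ _ _ hh0 this.2.1) (floor_same _ _ _ hh0 this.2.2))
  obtain ⟨S, hS, hSc⟩ : ∃ S : Finset ℤ, S = Icc (-2001) 2001 ∧ S.card = 4003 :=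
    ⟨_, rfl, by rw [Int.card_Icc]; rfl⟩
  have fl : ∀ x y : ℝ, |x - y| ≤ 2000 * hh → ⌊x / hh⌋ - ⌊y / hh⌋ ∈ S := by
    intro x y hxy
    rw [hS]; exact floor_near _ _ _ hh0 hxy
  clear hS
  have := cell_sum P (fun a : Pt => ((⌊a.1 / hh⌋, ⌊a.2.1 / hh⌋, ⌊a.2.2 / hh⌋) : ℤ × ℤ × ℤ))
    (wT E P δ d τ) (wT_nonneg d τ) (Real.sqrt ((8 * M + 4) * (1400000 * μ * C0 ^ 3)) * (1 / δ) ^ s)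
    (by positivity) (S ×ˢ S ×ˢ S)
    (fun x y => h.block d τ hδd hd2 hτ hτd hτ2 _ _ (filter_subset _ _) (filter_subset _ _)
      (hsame x) (hsame y) M hM hMρ) (by
      intro a b hab
      have hT : TT δ d τ a b := by
        unfold wT at hab
        by_contra hc
        rw [if_neg (fun q => hc q.2.2)] at hab
        exact hab rfl
      have e : d = 2000 * hh := by linarith
      have c := dist_coord a b _ hT.2.1
      have c1 := c.1.trans e.le
      have c2 := c.2.1.trans e.le
      have c3 := c.2.2.trans e.le
      exact mem_product.2 ⟨fl _ _ c1, mem_product.2 ⟨fl _ _ c2, fl _ _ c3⟩⟩)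
  refine this.trans (le_of_eq ?_)
  rw [card_product, card_product, hSc]
  push_cast
  ring

lemma Cfg.U_le_all (h : Cfg δ C0 s t μ P E) {a : Pt} (ha : a ∈ P) : 
    ((E a).card : ℝ) ≤ C0 * (4 * (1 / δ) ^ s) := by
  have hδ := h.hδ
  have hC0 := h.hC0
  have := h.card_le_of_dist ha (E a) (Subset.refl _) (a.1, a.2.1) 4 (by linarith [h.hδ1]) (by
    intro z hz
    apply dist2_le _ _ _ (by norm_num)
    have h1 := (abs_le.1 (h.hE a ha z hz)).2
    have h2 := (h.hr a ha).1
    have : a.2.2 ^ 2 ≤ 2 ^ 2 := by have := h2.1; gcongr; exact h2.2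
    have := h.hδ1
    simp only
    linarith)
  refine this.trans ?_
  gcongr
  rw [div_eq_mul_one_div]
  exact rpow_cmul _ _ _ (by norm_num) (by positivity) (by linarith [h.ht, h.hts]) h.hs1

lemma Cfg.row_sum (h : Cfg δ C0 s t μ P E) (g : Pt → Pt → Prop) [∀ a, DecidablePred (g a)] (ρ V : ℝ) (hρ : δ ≤ ρ) (hV : 0 ≤ V)
    (hg : ∀ a b, g a b → dist b a ≤ ρ) (hV : ∀ a ∈ P, ∀ b ∈ P, g a b → Uf E a b ≤ V) :
    ∑ a ∈ P, ∑ b ∈ P, (if g a b then Uf E a b else 0) ≤ P.card * (C0 * (ρ / δ) ^ t * V) := by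
  have : ∀ a ∈ P, ∑ b ∈ P, (if g a b then Uf E a b else 0) ≤ C0 * (ρ / δ) ^ t * V := by
    intro a ha
    rw [← sum_filter]
    calc _ ≤ ∑ b ∈ P with g a b, V := sum_le_sum fun b hb => hV a ha b (mem_filter.1 hb).1 (mem_filter.1 hb).2
      _ = ((P.filter (g a)).card : ℝ) * V := by rw [sum_const, nsmul_eq_mul]
      _ ≤ _ := by
        gcongr
        refine le_trans ?_ (h.hP a ρ hρ)
        gcongr
        exact hg a _
  calc _ ≤ ∑ a ∈ P, C0 * (ρ / δ) ^ t * V := sum_le_sum this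
    _ = _ := by rw [sum_const, nsmul_eq_mul]

lemma Cfg.close_sum (h : Cfg δ C0 s t μ P E) :
    ∑ a ∈ P, ∑ b ∈ P, (if dist b a ≤ 160000 * δ then Uf E a b else 0) ≤
      P.card * (640000 * C0 ^ 2 * (1 / δ) ^ s) := by
  have hδ := h.hδ
  have hC0 := h.hC0
  have hC00 : 0 < C0 := by linarith
  refine (h.row_sum (fun a b => dist b a ≤ 160000 * δ) (160000 * δ) (C0 * (4 * (1 / δ) ^ s)) (by linarith)
    (by positivity) (fun a b q => q) (fun a ha b hb _ => ?_)).trans ?_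
  · refine le_trans ?_ (h.U_le_all ha)
    unfold Uf
    gcongr
    exact inter_subset_left
  · refine mul_le_mul_of_nonneg_left ?_ (by positivity)
    have e : 160000 * δ / δ = 160000 * 1 := by field_simp
    have := rpow_cmul 160000 1 t (by norm_num) (by norm_num) h.ht.le (h.hts.trans h.hs1)
    rw [Real.one_rpow] at this
    rw [e]
    calc _ ≤ C0 * (160000 * 1) * (C0 * (4 * (1 / δ) ^ s)) := by gcongr
      _ = _ := by ring

lemma Cfg.trans_sum (h : Cfg δ C0 s t μ P E) (d : ℝ) (hd : 160000 * δ ≤ d) (hd2 : d ≤ 2) :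
    ∑ a ∈ P, ∑ b ∈ P, (if (d / 2 < dist a b ∧ dist a b ≤ d) ∧ d ^ 2 / 200 < |Qf a b| then Uf E a b else 0) ≤
      P.card * (18000 * C0 ^ 2 * (1 / δ) ^ s) := by
  have hδ := h.hδ
  have hC0 := h.hC0
  have hC00 : 0 < C0 := by linarith
  have hd0 : 0 < d := by linarith
  have hs0 : 0 ≤ s := by linarith [h.ht, h.hts]
  refine (h.row_sum (fun a b => (d / 2 < dist a b ∧ dist a b ≤ d) ∧ d ^ 2 / 200 < |Qf a b|) d
    (18000 * C0 * (1 / d) ^ s) (by linarith)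
    (by positivity) (fun a b q => by rw [dist_comm]; exact q.1.2) (fun a ha b hb q => ?_)).trans ?_
  · refine (h.U_G2 ha hb d (d ^ 2 / 200) (by linarith) hd2 q.1.2 q.1.1 (by nlinarith) q.2.le).trans ?_
    have e : 600 / Real.sqrt (d ^ 2 / 200) ≤ 9000 * (1 / d) := by
      have : d / 15 ≤ Real.sqrt (d ^ 2 / 200) := by
        apply Real.le_sqrt_of_sq_le; nlinarith
      calc _ ≤ 600 / (d / 15) := by gcongr
        _ = _ := by field_simp; norm_num
    have := rpow_cmul 9000 (1 / d) s (by norm_num) (by positivity) hs0 h.hs1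
    calc _ ≤ 2 * C0 * (9000 * (1 / d)) ^ s := by gcongr
      _ ≤ 2 * C0 * (9000 * (1 / d) ^ s) := by gcongr
      _ = _ := by ring
  · refine mul_le_mul_of_nonneg_left ?_ (by positivity)
    have e : (d / δ) ^ t ≤ (d / δ) ^ s := by
      apply Real.rpow_le_rpow_of_exponent_le _ h.hts
      rw [le_div_iff₀ hδ]; linarith
    have e2 : (d / δ) ^ s * (1 / d) ^ s = (1 / δ) ^ s := by
      rw [← Real.mul_rpow (by positivity) (by positivity)]
      congr 1; field_simp
    rw [← e2]
    calc _ ≤ C0 * (d / δ) ^ s * (18000 * C0 * (1 / d) ^ s) := by gcongr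
      _ = _ := by ring

lemma Qf_comm (a b : Pt) : Qf a b = Qf b a := by unfold Qf; ring

lemma Cfg.cover (h : Cfg δ C0 s t μ P E) (k : ℕ) (hk : δ = (1 / 2) ^ k) {a b : Pt} (ha : a ∈ P) (hb : b ∈ P) :
    dist b a ≤ 160000 * δ ∨ ∃ j < k + 1, 160000 * δ ≤ 2 * (1 / 2 : ℝ) ^ j ∧ (
     ((2 * (1 / 2 : ℝ) ^ j / 2 < dist a b ∧ dist a b ≤ 2 * (1 / 2) ^ j) ∧ (2 * (1 / 2) ^ j) ^ 2 / 200 < |Qf a b|) ∨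
     ∃ i < k + 1, 2 ^ i * (800 * δ) ≤ 2 * (1 / 2) ^ j / 100 ∧ 
      (TT δ (2 * (1 / 2) ^ j) (2 ^ i * (800 * δ)) a b ∨ TT δ (2 * (1 / 2) ^ j) (2 ^ i * (800 * δ)) b a)) := by
  have hδ := h.hδ
  by_cases hcl : dist b a ≤ 160000 * δ
  · exact Or.inl hcl
  right
  push Not at hcl
  rw [dist_comm] at hcl
  have hab1 : dist a b ≤ 1 := by
    rw [dist_max]
    obtain ⟨x1, x2⟩ := h.X_small ha hb
    have r1 := (h.hr a ha).1
    have r2 := (h.hr b hb).1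
    refine max_le (by linarith) (max_le (by linarith) ?_)
    rw [abs_le]; constructor <;> linarith [r1.1, r1.2, r2.1, r2.2]
  have hab0 : 0 < dist a b := by linarith
  obtain ⟨j, hj1, hj2⟩ := exists_nat_pow_near_of_lt_one (x := dist a b / 2) (y := (1/2:ℝ)) (by linarith) (by linarith)
    (by norm_num) (by norm_num)
  have hd1 : 2 * (1 / 2 : ℝ) ^ j / 2 < dist a b := by rw [pow_succ] at hj1; linarith
  have hd2 : dist a b ≤ 2 * (1 / 2 : ℝ) ^ j := by linarith
  set d := 2 * (1 / 2 : ℝ) ^ j with hd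
  have hd0 : 0 < d := by positivity
  have hdle : d ≤ 2 := by
    have : (1 / 2 : ℝ) ^ j ≤ 1 := pow_le_one₀ (by norm_num) (by norm_num)
    linarith
  have hjk : j < k + 1 := by
    by_contra hc
    push Not at hc
    have : (1 / 2 : ℝ) ^ j ≤ (1 / 2) ^ k := pow_le_pow_of_le_one (by norm_num) (by norm_num) (by omega)
    rw [← hk] at this
    linarith
  refine ⟨j, hjk, by linarith, ?_⟩
  by_cases htr : d ^ 2 / 200 < |Qf a b|
  · exact Or.inl ⟨⟨hd1, hd2⟩, htr⟩
  right
  push Not at htr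
  have hR : a.2.2 ≠ b.2.2 := by
    intro he
    rw [dist_max, he, sub_self, abs_zero] at hd1
    unfold Qf at htr
    rw [he, sub_self] at htr
    have h2 := (abs_le.1 htr).2
    rcases lt_max_iff.1 hd1 with q | q
    · have : (d / 2) ^ 2 ≤ (a.1 - b.1) ^ 2 := by rw [← sq_abs (a.1 - b.1)]; gcongr
      nlinarith [sq_nonneg (a.2.1 - b.2.1)]
    · rcases lt_max_iff.1 q with q | q
      · have : (d / 2) ^ 2 ≤ (a.2.1 - b.2.1) ^ 2 := by rw [← sq_abs (a.2.1 - b.2.1)]; gcongr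
        nlinarith [sq_nonneg (a.1 - b.1)]
      · linarith
  have fin : ∀ i, |Qf a b| ≤ 2 ^ i * (800 * δ) * d → (2 ^ i * (800 * δ) = 800 * δ ∨ 2 ^ i * (800 * δ) * d / 2 ≤ |Qf a b|) →
      TT δ d (2 ^ i * (800 * δ)) a b ∨ TT δ d (2 ^ i * (800 * δ)) b a := by
    intro i h1 h2
    rcases lt_or_gt_of_ne hR with hlt | hgt
    · right
      refine ⟨by rw [dist_comm]; exact hd1, by rw [dist_comm]; exact hd2, hlt, by rw [Qf_comm]; exact h1, by rw [Qf_comm]; exact h2⟩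
    · left
      exact ⟨hd1, hd2, hgt, h1, h2⟩
  by_cases hq : |Qf a b| ≤ 800 * δ * d
  · refine ⟨0, by omega, by rw [pow_zero]; linarith, fin 0 (by rw [pow_zero, one_mul]; exact hq) (Or.inl (by simp))⟩
  push Not at hq
  have hδd : 0 < 800 * δ * d := by positivity
  obtain ⟨n, hn1, hn2⟩ := exists_nat_pow_near (x := |Qf a b| / (800 * δ * d)) (y := (2:ℝ))
    (by rw [le_div_iff₀ hδd]; linarith) (by norm_num)
  rw [le_div_iff₀ hδd] at hn1
  rw [div_lt_iff₀ hδd] at hn2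
  have hτ : 2 ^ (n + 1) * (800 * δ) ≤ d / 100 := by
    rw [pow_succ]
    have : (2 ^ n * (800 * δ)) * d ≤ (d / 200) * d := by nlinarith
    have := le_of_mul_le_mul_right this hd0
    linarith
  refine ⟨n + 1, ?_, hτ, fin (n + 1) (by linarith) (Or.inr ?_)⟩
  · by_contra hc
    push Not at hc
    have h1 : (2:ℝ) ^ k ≤ 2 ^ (n + 1) := pow_le_pow_right₀ (by norm_num) (by omega)
    have h2 : (2:ℝ) ^ k * δ = 1 := by rw [hk, ← mul_pow]; norm_num
    nlinarith
  · rw [pow_succ]; linarith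

set_option maxHeartbeats 1000000 in
/-- main discrete estimate -/
lemma Cfg.main (h : Cfg δ C0 s t μ P E) (k : ℕ) (hk : δ = (1 / 2) ^ k) :
    ∑ a ∈ P, ∑ b ∈ P, Uf E a b ≤
      10 ^ 16 * C0 ^ 2 * ((k:ℝ) + 1) ^ 3 * Real.sqrt μ * (1 / δ) ^ s * P.card := by
  have hδ := h.hδ
  have hC0 := h.hC0
  have hμ := h.hμ
  have hC00 : 0 < C0 := by linarith
  set dj : ℕ → ℝ := fun j => 2 * (1 / 2 : ℝ) ^ j with hdj
  set τi : ℕ → ℝ := fun i => 2 ^ i * (800 * δ) with hτi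
  have hdj2 : ∀ j, dj j ≤ 2 := by
    intro j
    have : (1 / 2 : ℝ) ^ j ≤ 1 := pow_le_one₀ (by norm_num) (by norm_num)
    simp only [hdj]; linarith
  have hUf : ∀ a b, 0 ≤ Uf E a b := fun a b => by unfold Uf; positivity
  set f1 : Pt → Pt → ℝ := fun a b => if dist b a ≤ 160000 * δ then Uf E a b else 0 with hf1
  set f2 : ℕ → Pt → Pt → ℝ := fun j a b => if (dj j / 2 < dist a b ∧ dist a b ≤ dj j) ∧ dj j ^ 2 / 200 < |Qf a b|
    then Uf E a b else 0 with hf2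
  set f3 : ℕ → ℕ → Pt → Pt → ℝ := fun j i a b => wT E P δ (dj j) (τi i) a b with hf3
  have f1n : ∀ a b, 0 ≤ f1 a b := by
    intro a b; simp only [hf1]; split_ifs; exacts [hUf a b, le_rfl]
  have f2n : ∀ j a b, 0 ≤ f2 j a b := by
    intro j a b; simp only [hf2]; split_ifs; exacts [hUf a b, le_rfl]
  have f3n : ∀ j i a b, 0 ≤ f3 j i a b := fun j i a b => wT_nonneg _ _ _ _
  set J := (range (k + 1)).filter (fun j => 160000 * δ ≤ dj j) with hJ
  set I := fun j => (range (k + 1)).filter (fun i => τi i ≤ dj j / 100) with hI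
  have hJc : (J.card : ℝ) ≤ k + 1 := by
    have := card_filter_le (range (k + 1)) (fun j => 160000 * δ ≤ dj j)
    rw [card_range] at this
    exact_mod_cast this
  have hIc : ∀ j, ((I j).card : ℝ) ≤ k + 1 := by
    intro j
    have := card_filter_le (range (k + 1)) (fun i => τi i ≤ dj j / 100)
    rw [card_range] at this
    exact_mod_cast this
  have pt : ∀ a ∈ P, ∀ b ∈ P, Uf E a b ≤ f1 a b + ∑ j ∈ J, (f2 j a b + ∑ i ∈ I j, (f3 j i a b + f3 j i b a)) := by
    intro a ha b hb
    have n3 : ∀ j, 0 ≤ ∑ i ∈ I j, (f3 j i a b + f3 j i b a) :=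
      fun j => sum_nonneg fun i _ => add_nonneg (f3n _ _ _ _) (f3n _ _ _ _)
    have n2 : ∀ j, 0 ≤ f2 j a b + ∑ i ∈ I j, (f3 j i a b + f3 j i b a) :=
      fun j => add_nonneg (f2n _ _ _) (n3 j)
    rcases h.cover k hk ha hb with hc | ⟨j, hj, hjd, hc⟩
    · have : f1 a b = Uf E a b := by simp only [hf1]; rw [if_pos hc]
      have := sum_nonneg (s := J) fun j _ => n2 j
      linarith
    have hjJ : j ∈ J := mem_filter.2 ⟨mem_range.2 hj, hjd⟩
    have s1 := single_le_sum (f := fun j => f2 j a b + ∑ i ∈ I j, (f3 j i a b + f3 j i b a))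
      (fun j _ => n2 j) hjJ
    have := f1n a b
    rcases hc with hc | ⟨i, hi, hid, hc⟩
    · have : f2 j a b = Uf E a b := by simp only [hf2]; rw [if_pos hc]
      have := n3 j
      linarith
    have hiI : i ∈ I j := mem_filter.2 ⟨mem_range.2 hi, hid⟩
    have s2 := single_le_sum (f := fun i => f3 j i a b + f3 j i b a)
      (fun i _ => add_nonneg (f3n j i a b) (f3n j i b a)) hiI
    have := f2n j a b
    rcases hc with hc | hc
    · have : f3 j i a b = Uf E a b := by simp only [hf3, wT]; rw [if_pos ⟨ha, hb, hc⟩]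
      have := f3n j i b a
      linarith
    · have : f3 j i b a = Uf E a b := by rw [Uf_comm]; simp only [hf3, wT]; rw [if_pos ⟨hb, ha, hc⟩]
      have := f3n j i a b
      linarith
  set V := (1 / δ) ^ s with hV
  have hV0 : 0 ≤ V := by positivity
  set p : ℝ := (P.card : ℝ) with hp
  have hp0 : 0 ≤ p := by positivity
  set K : ℝ := (k : ℝ) + 1 with hK
  have hK1 : 1 ≤ K := by have : (0:ℝ) ≤ k := by positivity
                         linarith
  set m := Real.sqrt μ with hm
  have hm1 : 1 ≤ m := by rw [hm, Real.one_le_sqrt]; exact hμ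
  have b1 : ∑ a ∈ P, ∑ b ∈ P, f1 a b ≤ p * (640000 * C0 ^ 2 * V) := h.close_sum
  have b2 : ∀ j ∈ J, ∑ a ∈ P, ∑ b ∈ P, f2 j a b ≤ p * (18000 * C0 ^ 2 * V) := by
    intro j hj
    exact h.trans_sum (dj j) (mem_filter.1 hj).2 (hdj2 j)
  have b3 : ∀ j ∈ J, ∀ i ∈ I j, ∑ a ∈ P, ∑ b ∈ P, f3 j i a b ≤ 2 * (12 * K * 1200 * C0 ^ 2 * m * V) * 4003 ^ 3 * p := by
    intro j hj i hi
    have hj' := (mem_filter.1 hj).2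
    have hi' := (mem_filter.1 hi).2
    have h800 : 800 * δ ≤ τi i := by
      simp only [hτi]
      have : (1:ℝ) ≤ 2 ^ i := one_le_pow₀ (by norm_num)
      nlinarith
    have hd0 : 0 < dj j := by simp only [hdj]; positivity
    refine (h.class_sum (dj j) (τi i) (by linarith) (hdj2 j) h800 hi' ?_ (k + 1) (by omega) ?_).trans ?_
    · rcases Nat.eq_zero_or_pos i with rfl | hpos
      · left; simp [hτi]
      · right
        simp only [hτi]
        have : (2:ℝ) ^ 1 ≤ 2 ^ i := pow_le_pow_right₀ (by norm_num) hpos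
        nlinarith
    · have h1 : 3 * δ ≤ Real.sqrt (2 * (τi i / dj j)) := by
        apply Real.le_sqrt_of_sq_le
        have : 400 * δ ≤ τi i / dj j := by
          rw [le_div_iff₀ hd0]
          have := hdj2 j
          nlinarith
        have := h.hδ1
        nlinarith
      have h2 : (2:ℝ) ^ k * δ = 1 := by rw [hk, ← mul_pow]; norm_num
      have h3 : (0:ℝ) < 2 ^ k := by positivity
      simp only [Nat.add_sub_cancel]
      calc (3:ℝ) = 2 ^ k * (3 * δ) := by linarith
        _ ≤ _ := by gcongr
    · gcongr
      have hm2 : m ^ 2 = μ := Real.sq_sqrt (by linarith)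
      apply Real.sqrt_le_iff.2
      refine ⟨by positivity, ?_⟩
      push_cast
      rw [show (12 * K * 1200 * C0 ^ 2 * m) ^ 2 = (12 * K) * (1440000 * m ^ 2 * C0 ^ 3) * (12 * K * C0) by ring, hm2]
      have i1 : 8 * ((k:ℝ) + 1) + 4 ≤ 12 * K := by linarith
      have i2 : 1 ≤ 12 * K * C0 := by nlinarith
      have i3 : 0 ≤ μ * C0 ^ 3 := by positivity
      calc (8 * ((k:ℝ) + 1) + 4) * (1400000 * μ * C0 ^ 3) ≤ (12 * K) * (1440000 * μ * C0 ^ 3) * 1 := by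
            rw [mul_one]
            gcongr
            · norm_num
        _ ≤ _ := by gcongr
  have hsymm : ∀ j i, ∑ a ∈ P, ∑ b ∈ P, f3 j i b a = ∑ a ∈ P, ∑ b ∈ P, f3 j i a b := fun j i => sum_comm
  set B3 := 2 * (12 * K * 1200 * C0 ^ 2 * m * V) * 4003 ^ 3 * p with hB3
  have hB30 : 0 ≤ B3 := by positivity
  set B2 := p * (18000 * C0 ^ 2 * V) with hB2
  have hB20 : 0 ≤ B2 := by positivity
  have tot : ∑ a ∈ P, ∑ b ∈ P, Uf E a b ≤ p * (640000 * C0 ^ 2 * V) + K * (B2 + K * (2 * B3)) := by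
    calc _ ≤ ∑ a ∈ P, ∑ b ∈ P, (f1 a b + ∑ j ∈ J, (f2 j a b + ∑ i ∈ I j, (f3 j i a b + f3 j i b a))) :=
          sum_le_sum fun a ha => sum_le_sum fun b hb => pt a ha b hb
      _ = ∑ a ∈ P, ∑ b ∈ P, f1 a b + ∑ j ∈ J, (∑ a ∈ P, ∑ b ∈ P, f2 j a b + 
            ∑ i ∈ I j, (∑ a ∈ P, ∑ b ∈ P, f3 j i a b + ∑ a ∈ P, ∑ b ∈ P, f3 j i b a)) := by
          simp only [sum_add_distrib]
          have c1 : ∀ (f : ℕ → Pt → Pt → ℝ) (S : Finset ℕ), ∑ a ∈ P, ∑ b ∈ P, ∑ j ∈ S, f j a b = 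
              ∑ j ∈ S, ∑ a ∈ P, ∑ b ∈ P, f j a b := by
            intro f S
            calc _ = ∑ a ∈ P, ∑ j ∈ S, ∑ b ∈ P, f j a b := sum_congr rfl fun a _ => sum_comm
              _ = _ := sum_comm
          rw [c1 f2 J]
          rw [c1 (fun j a b => ∑ i ∈ I j, f3 j i a b) J, c1 (fun j a b => ∑ i ∈ I j, f3 j i b a) J]
          rw [sum_congr rfl fun j _ => c1 (fun i a b => f3 j i b a) (I j)]
          rw [sum_congr rfl fun j _ => c1 (fun i a b => f3 j i a b) (I j)]
      _ ≤ p * (640000 * C0 ^ 2 * V) + ∑ j ∈ J, (B2 + ∑ i ∈ I j, (B3 + B3)) := by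
          refine add_le_add b1 (sum_le_sum fun j hj => add_le_add (b2 j hj) (sum_le_sum fun i hi => ?_))
          rw [hsymm j i]
          exact add_le_add (b3 j hj i hi) (b3 j hj i hi)
      _ ≤ p * (640000 * C0 ^ 2 * V) + ∑ j ∈ J, (B2 + K * (2 * B3)) := by
          gcongr with j hj
          rw [sum_const, nsmul_eq_mul, ← two_mul]
          gcongr
          exact hIc j
      _ ≤ _ := by
          rw [sum_const, nsmul_eq_mul]
          gcongr
  refine tot.trans ?_
  set Y := C0 ^ 2 * V * p with hY
  have hY0 : 0 ≤ Y := by positivity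
  have y1 : p * (640000 * C0 ^ 2 * V) = 640000 * Y := by rw [hY]; ring
  have y2 : B2 = 18000 * Y := by rw [hB2, hY]; ring
  have y3 : B3 = (2 * 12 * 1200 * 4003 ^ 3) * (K * m * Y) := by rw [hB3, hY]; ring
  have y4 : 10 ^ 16 * C0 ^ 2 * K ^ 3 * m * V * p = 10 ^ 16 * (K ^ 3 * m * Y) := by rw [hY]; ring
  rw [y1, y2, y3, y4]
  have z0 : Y ≤ m * Y := by nlinarith
  have hmY : 0 ≤ m * Y := by positivity
  have z1 : K * (m * Y) ≤ K ^ 3 * (m * Y) := by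
    gcongr
    exact le_self_pow₀ hK1 (by norm_num)
  have z2 : 1 * (m * Y) ≤ K * (m * Y) := by gcongr
  have z3 : K * Y ≤ K * (m * Y) := by gcongr
  have : K ^ 3 * (m * Y) = K * K * (K * m * Y) := by ring
  have : 10 ^ 16 * (K ^ 3 * m * Y) = 10 ^ 16 * (K ^ 3 * (m * Y)) := by ring
  have : K * (18000 * Y + K * (2 * ((2 * 12 * 1200 * 4003 ^ 3) * (K * m * Y)))) =
    18000 * (K * Y) + (4 * 12 * 1200 * 4003 ^ 3) * (K ^ 3 * (m * Y)) := by ring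
  rw [this]
  norm_num at *
  linarith
end
end

noncomputable section
open Finset Classical

lemma Cfg.count {δ C0 s t μ0 : ℝ} {P : Finset Pt} {E : Pt → Finset (ℝ × ℝ)} (h : Cfg δ C0 s t μ0 P E)
    (k : ℕ) (hk : δ = (1 / 2) ^ k) (m0 : ℝ) (hm0 : 0 < m0) (hE : ∀ p ∈ P, m0 ≤ (E p).card)
    (I : ℕ) (hI : P.card < 2 ^ I) (Fs : Finset (ℝ × ℝ)) (hF : ∀ p ∈ P, E p ⊆ Fs) :
    P.card * m0 ^ 3 ≤ 2 * (I:ℝ) ^ 3 * (10 ^ 16 * C0 ^ 2 * ((k:ℝ) + 1) ^ 3 * (1 / δ) ^ s) ^ 2 * Fs.card := by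
  rcases P.eq_empty_or_nonempty with rfl | hne
  · simp; positivity
  have hC0 := h.hC0
  have hδ := h.hδ
  set X := 10 ^ 16 * C0 ^ 2 * ((k:ℝ) + 1) ^ 3 * (1 / δ) ^ s with hX
  have hX0 : 0 ≤ X := by positivity
  have hp : 0 < (P.card : ℝ) := by exact_mod_cast hne.card_pos
  set m : ℝ × ℝ → ℕ := fun z => (P.filter (fun p => z ∈ E p)).card with hm
  set Ei : ℕ → Pt → Finset (ℝ × ℝ) := fun i p => (E p).filter (fun z => Nat.log 2 (m z) = i) with hEi
  have hlog : ∀ z, m z ≠ 0 → Nat.log 2 (m z) < I := by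
    intro z hz
    apply Nat.log_lt_of_lt_pow hz
    exact lt_of_le_of_lt (card_filter_le _ _) hI
  have hmE : ∀ p ∈ P, ∀ z ∈ E p, m z ≠ 0 := by
    intro p hp z hz
    exact (card_pos.2 ⟨p, mem_filter.2 ⟨hp, hz⟩⟩).ne'
  have hI0 : 0 < I := by
    rcases Nat.eq_zero_or_pos I with rfl | h'
    · simp at hI; exact absurd hI hne.ne_empty
    · exact h'
  have hIR : (0:ℝ) < I := by exact_mod_cast hI0

  have htot : P.card * m0 ≤ ∑ i ∈ range I, ∑ p ∈ P, ((Ei i p).card : ℝ) := by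
    rw [sum_comm]
    calc (P.card : ℝ) * m0 = ∑ p ∈ P, m0 := by rw [sum_const, nsmul_eq_mul]
      _ ≤ _ := by
        refine sum_le_sum fun p hp => (hE p hp).trans (le_of_eq ?_)
        have := card_eq_sum_card_fiberwise (s := E p) (t := range I) (f := fun z => Nat.log 2 (m z))
          (fun z hz => by
            have := hlog z (hmE p hp z hz)
            simpa using this)
        rw [this]; push_cast; rfl
  obtain ⟨i, hi, hSi⟩ : ∃ i ∈ range I, P.card * m0 / I ≤ ∑ p ∈ P, ((Ei i p).card : ℝ) := by
    by_contra hc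
    push Not at hc
    have := sum_lt_sum_of_nonempty (s := range I) ⟨0, mem_range.2 hI0⟩ hc
    rw [sum_const, card_range, nsmul_eq_mul] at this
    have e : (I:ℝ) * (P.card * m0 / I) = P.card * m0 := by field_simp
    linarith
  set Si := ∑ p ∈ P, ((Ei i p).card : ℝ) with hSid
  have hSi0 : 0 < Si := lt_of_lt_of_le (by positivity) hSi
  set μ : ℝ := 2 ^ i with hμ
  have hμ1 : 1 ≤ μ := one_le_pow₀ (by norm_num)
  have hsub : ∀ p, Ei i p ⊆ E p := fun p => filter_subset _ _
  set mi : ℝ × ℝ → ℝ := fun z => ((P.filter (fun p => z ∈ Ei i p)).card : ℝ) with hmi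
  have hmi2 : ∀ z, mi z ≤ 2 * μ := by
    intro z
    by_cases hz : Nat.log 2 (m z) = i
    · have h1 : mi z ≤ m z := by
        simp only [hmi, hm]
        gcongr
        exact hsub _
      have h2 : m z < 2 ^ (i + 1) := by rw [← hz]; exact Nat.lt_pow_succ_log_self (by norm_num) _
      have h3 : (m z : ℝ) < 2 ^ (i + 1) := by exact_mod_cast h2
      rw [pow_succ] at h3
      linarith
    · have : mi z = 0 := by
        simp only [hmi]
        rw [filter_false_of_mem]
        · simp
        · intro p _ hzp
          exact hz (mem_filter.1 hzp).2
      rw [this]; positivity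
  have hmi1 : ∀ z, mi z ≠ 0 → μ ≤ mi z := by
    intro z hz
    have hne : (P.filter (fun p => z ∈ Ei i p)).Nonempty := by
      rw [nonempty_iff_ne_empty]
      intro he
      apply hz; simp only [hmi]; rw [he]; simp
    obtain ⟨p, hp⟩ := hne
    rw [mem_filter] at hp
    have hz := (mem_filter.1 hp.2).2
    have : mi z = m z := by
      simp only [hmi, hm]
      congr 2
      ext q
      simp only [hEi, mem_filter]
      constructor
      · rintro ⟨a, b, _⟩; exact ⟨a, b⟩
      · rintro ⟨a, b⟩; exact ⟨a, b, hz⟩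
    rw [this]
    have h2 := Nat.pow_log_le_self 2 (hmE p hp.1 z (hsub p hp.2))
    rw [hz] at h2
    rw [hμ]; exact_mod_cast h2
  have hcfg : Cfg δ C0 s t μ P (Ei i) := by
    refine ⟨h.hδ, h.hδ1, h.hC0, h.ht, h.hts, h.hs1, hμ1, h.hr, fun p hp z hz => h.hE p hp z (hsub p hz),
      h.hP, fun p hp y ρ hρ => ?_, hmi2⟩
    refine le_trans ?_ (h.hEc p hp y ρ hρ)
    gcongr
    exact hsub p
  have hmain := hcfg.main k hk
  -- expressing sums
  have hS : Si = ∑ z ∈ Fs, mi z := by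
    rw [hSid]
    have : ∀ p ∈ P, ((Ei i p).card : ℝ) = ∑ z ∈ Fs, if z ∈ Ei i p then (1:ℝ) else 0 := by
      intro p hp
      rw [sum_boole]
      congr 2
      ext z
      simp only [mem_filter]
      exact ⟨fun hz => ⟨hF p hp (hsub p hz), hz⟩, fun hz => hz.2⟩
    rw [sum_congr rfl this, sum_comm]
    refine sum_congr rfl fun z _ => ?_
    rw [sum_boole]
  have hS2 : ∑ a ∈ P, ∑ b ∈ P, Uf (Ei i) a b = ∑ z ∈ Fs, mi z ^ 2 := by
    have e1 : ∀ a ∈ P, ∀ b ∈ P, Uf (Ei i) a b = ∑ z ∈ Fs, (if z ∈ Ei i a then (1:ℝ) else 0) * (if z ∈ Ei i b then 1 else 0) := by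
      intro a ha b hb
      unfold Uf
      have e0 : ∀ z, (if z ∈ Ei i a then (1:ℝ) else 0) * (if z ∈ Ei i b then 1 else 0) =
          if z ∈ Ei i a ∧ z ∈ Ei i b then 1 else 0 := by
        intro z
        by_cases h1 : z ∈ Ei i a <;> by_cases h2 : z ∈ Ei i b <;> simp [h1, h2]
      rw [sum_congr rfl fun z _ => e0 z, sum_boole]
      congr 2
      ext z
      simp only [mem_filter, mem_inter]
      exact ⟨fun hz => ⟨hF a ha (hsub a hz.1), hz⟩, fun hz => hz.2⟩
    calc _ = ∑ a ∈ P, ∑ b ∈ P, ∑ z ∈ Fs, (if z ∈ Ei i a then (1:ℝ) else 0) * (if z ∈ Ei i b then 1 else 0) :=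
          sum_congr rfl fun a ha => sum_congr rfl fun b hb => e1 a ha b hb
      _ = ∑ a ∈ P, ∑ z ∈ Fs, ∑ b ∈ P, (if z ∈ Ei i a then (1:ℝ) else 0) * (if z ∈ Ei i b then 1 else 0) :=
          sum_congr rfl fun a ha => sum_comm
      _ = ∑ z ∈ Fs, ∑ a ∈ P, ∑ b ∈ P, (if z ∈ Ei i a then (1:ℝ) else 0) * (if z ∈ Ei i b then 1 else 0) := sum_comm
      _ = _ := by
        refine sum_congr rfl fun z _ => ?_
        rw [← sum_mul_sum, sq, sum_boole]
  have hlow : μ * Si ≤ X * Real.sqrt μ * P.card := by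
    have : μ * Si ≤ ∑ a ∈ P, ∑ b ∈ P, Uf (Ei i) a b := by
      rw [hS2, hS, mul_sum]
      refine sum_le_sum fun z _ => ?_
      by_cases hz : mi z = 0
      · simp [hz]
      · rw [sq]
        have := hmi1 z hz
        gcongr
    refine this.trans (hmain.trans (le_of_eq ?_))
    rw [hX]; ring
  have hFs : Si ≤ 2 * μ * Fs.card := by
    rw [hS]
    calc _ ≤ ∑ z ∈ Fs, 2 * μ := sum_le_sum fun z _ => hmi2 z
      _ = _ := by rw [sum_const, nsmul_eq_mul]; ring
  set q := Real.sqrt μ with hq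
  have hq2 : q ^ 2 = μ := Real.sq_sqrt (by linarith)
  have hq0 : 0 < q := Real.sqrt_pos.2 (by linarith)
  set p : ℝ := (P.card : ℝ) with hpd
  have hSi' : p * m0 ≤ I * Si := by
    rw [div_le_iff₀ hIR] at hSi; linarith
  have h1 : q * Si ≤ X * p := by
    rw [← hq2] at hlow
    have : q * (q * Si) ≤ q * (X * p) := by linarith
    exact le_of_mul_le_mul_left this hq0
  have h2 : q * m0 ≤ X * I := by
    have : p * (q * m0) ≤ p * (X * I) := by
      calc p * (q * m0) = q * (p * m0) := by ring
        _ ≤ q * (I * Si) := by gcongr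
        _ = I * (q * Si) := by ring
        _ ≤ I * (X * p) := by gcongr
        _ = _ := by ring
    exact le_of_mul_le_mul_left this hp
  calc p * m0 ^ 3 = (p * m0) * m0 ^ 2 := by ring
    _ ≤ (I * Si) * m0 ^ 2 := by gcongr
    _ ≤ (I * (2 * μ * Fs.card)) * m0 ^ 2 := by gcongr
    _ = 2 * I * Fs.card * (q * m0) ^ 2 := by rw [← hq2]; ring
    _ ≤ 2 * I * Fs.card * (X * I) ^ 2 := by gcongr
    _ = _ := by ring
end

noncomputable section
open Finset Classical

lemma frost {X ι : Type*} (κ : ℕ → X → ι)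
    (hnest : ∀ i j, i ≤ j → ∀ x y, κ j x = κ j y → κ i x = κ i y) (A : Set X) (k : ℕ)
    (hfin : (κ k '' A).Finite) (N : ℕ → ℕ) (hNk : N k = 1) :
    ∃ P : Finset X, (∀ p ∈ P, p ∈ A) ∧ (∀ x, ∀ j ≤ k, (P.filter (fun p => κ j p = κ j x)).card ≤ N j) ∧
      ∃ Q : Finset (ℕ × ι), (∀ q ∈ Q, q.1 ≤ k) ∧ (∀ x ∈ A, ∃ q ∈ Q, κ q.1 x = q.2) ∧
        ∑ q ∈ Q, N q.1 ≤ P.card := by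
  obtain ⟨Ω, hΩ, hΩ2⟩ : ∃ Ω : Finset X, (∀ p ∈ Ω, p ∈ A) ∧ ∀ a ∈ A, ∃ w ∈ Ω, κ k w = κ k a := by
    rcases A.eq_empty_or_nonempty with rfl | ⟨a0, -⟩
    · exact ⟨∅, by simp, by simp⟩
    have : Nonempty X := ⟨a0⟩
    choose! g hg using fun (y : ι) (hy : y ∈ κ k '' A) => hy
    refine ⟨hfin.toFinset.image g, ?_, ?_⟩
    · intro p hp
      obtain ⟨y, hy, rfl⟩ := mem_image.1 hp
      exact (hg y (by simpa using hy)).1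
    · intro a ha
      refine ⟨g (κ k a), mem_image_of_mem _ (by simpa using ⟨a, ha, rfl⟩), (hg (κ k a) ⟨a, ha, rfl⟩).2⟩
  set G := Ω.powerset.filter (fun P => ∀ x, ∀ j ≤ k, (P.filter (fun p => κ j p = κ j x)).card ≤ N j) with hG
  have hGne : G.Nonempty := ⟨∅, by simp [hG]⟩
  obtain ⟨P, hPG, hPmax⟩ := exists_max_image G Finset.card hGne
  obtain ⟨hPΩ, hPN⟩ := mem_filter.1 hPG
  rw [mem_powerset] at hPΩ
  have hsat : ∀ w ∈ Ω, ∃ j, j ≤ k ∧ N j ≤ (P.filter (fun p => κ j p = κ j w)).card := by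
    intro w hw
    by_cases hwP : w ∈ P
    · exact ⟨k, le_rfl, by rw [hNk]; exact card_pos.2 ⟨w, by simp [hwP]⟩⟩
    · by_contra hcon
      push Not at hcon
      have : insert w P ∈ G := by
        refine mem_filter.2 ⟨mem_powerset.2 (insert_subset hw hPΩ), ?_⟩
        intro x j hj
        by_cases hx : κ j w = κ j x
        · rw [filter_insert, if_pos hx]
          refine (card_insert_le _ _).trans ?_
          have := hcon j hj
          rw [hx] at this
          exact this
        · rw [filter_insert, if_neg hx]
          exact hPN x j hj
      have := hPmax _ this
      rw [card_insert_of_notMem hwP] at this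
      omega
  let jj : X → ℕ := fun w => if h : ∃ j, j ≤ k ∧ N j ≤ (P.filter (fun p => κ j p = κ j w)).card then Nat.find h else 0
  have hjj : ∀ w ∈ Ω, (jj w ≤ k ∧ N (jj w) ≤ (P.filter (fun p => κ (jj w) p = κ (jj w) w)).card) ∧
      ∀ j, j ≤ k → N j ≤ (P.filter (fun p => κ j p = κ j w)).card → jj w ≤ j := by
    intro w hw
    have h := hsat w hw
    simp only [jj, dif_pos h]
    exact ⟨Nat.find_spec h, fun j h1 h2 => Nat.find_min' h ⟨h1, h2⟩⟩
  refine ⟨P, fun p hp => hΩ p (hPΩ hp), hPN, Ω.image (fun w => (jj w, κ (jj w) w)), ?_, ?_, ?_⟩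
  · intro q hq
    obtain ⟨w, hw, rfl⟩ := mem_image.1 hq
    exact (hjj w hw).1.1
  · intro x hx
    obtain ⟨w, hw, hwx⟩ := hΩ2 x hx
    exact ⟨_, mem_image_of_mem _ hw, (hnest _ _ (hjj w hw).1.1 _ _ hwx).symm⟩
  · have h1 : ∑ q ∈ Ω.image (fun w => (jj w, κ (jj w) w)), N q.1 ≤
        ∑ q ∈ Ω.image (fun w => (jj w, κ (jj w) w)), (P.filter (fun p => κ q.1 p = q.2)).card := by
      apply sum_le_sum
      intro q hq
      obtain ⟨w, hw, rfl⟩ := mem_image.1 hq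
      exact (hjj w hw).1.2
    refine h1.trans ?_
    rw [← card_biUnion]
    · exact card_le_card (biUnion_subset.2 fun q _ => filter_subset _ _)
    · intro q hq q' hq' hne
      obtain ⟨w, hw, rfl⟩ := mem_image.1 hq
      obtain ⟨w', hw', rfl⟩ := mem_image.1 hq'
      rw [Function.onFun, Finset.disjoint_left]
      intro p hp hp'
      have e1 := (mem_filter.1 hp).2
      have e2 := (mem_filter.1 hp').2
      simp only at e1 e2
      apply hne
      have key : ∀ w ∈ Ω, ∀ w' ∈ Ω, κ (jj w) p = κ (jj w) w → κ (jj w') p = κ (jj w') w' → jj w ≤ jj w' → jj w' ≤ jj w := by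
        intro w hw w' hw' e1 e2 hle
        have e3 : κ (jj w) w' = κ (jj w) w := by
          rw [← e1]; exact (hnest _ _ hle _ _ e2).symm
        apply (hjj w' hw').2 _ (hjj w hw).1.1
        rw [e3]; exact (hjj w hw).1.2
      have ejj : jj w = jj w' := by
        rcases le_total (jj w) (jj w') with hle | hle
        · exact le_antisymm hle (key w hw w' hw' e1 e2 hle)
        · exact le_antisymm (key w' hw' w hw e2 e1 hle) hle
      rw [← ejj] at e2
      simp only [Prod.mk.injEq]
      exact ⟨ejj, by rw [← ejj, ← e1, ← e2]⟩

def cellAt (j : ℕ) (x : Pt) : ℤ × ℤ × ℤ := (⌊2 ^ j * x.1⌋, ⌊2 ^ j * x.2.1⌋, ⌊2 ^ j * x.2.2⌋)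

lemma floor_nest (d : ℕ) (a b : ℝ) (c : ℝ) (hc : 0 ≤ c) (h : ⌊2 ^ d * (c * a)⌋ = ⌊2 ^ d * (c * b)⌋) : ⌊c * a⌋ = ⌊c * b⌋ := by
  have key : ∀ y : ℝ, ⌊y⌋ = ⌊2 ^ d * y⌋ / (2:ℤ) ^ d := by
    intro y
    have := Int.floor_div_natCast (2 ^ d * y) (2 ^ d)
    push_cast at this
    rw [mul_div_cancel_left₀ _ (by positivity)] at this
    exact this
  rw [key (c * a), key (c * b), h]

lemma cellAt_nest (i j : ℕ) (hij : i ≤ j) (x y : Pt) (h : cellAt j x = cellAt j y) : cellAt i x = cellAt i y := by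
  obtain ⟨d, rfl⟩ := Nat.exists_eq_add_of_le hij
  simp only [cellAt, Prod.mk.injEq] at h ⊢
  have e : (2:ℝ) ^ (i + d) = 2 ^ d * 2 ^ i := by rw [pow_add]; ring
  rw [e] at h
  simp only [mul_assoc] at h
  exact ⟨floor_nest d _ _ _ (by positivity) h.1, floor_nest d _ _ _ (by positivity) h.2.1, floor_nest d _ _ _ (by positivity) h.2.2⟩

lemma floor_eq_dist (j : ℕ) (a b : ℝ) (h : ⌊2 ^ j * a⌋ = ⌊2 ^ j * b⌋) : dist a b ≤ (1/2) ^ j := by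
  have := Int.abs_sub_lt_one_of_floor_eq_floor h
  rw [← mul_sub, abs_mul, abs_of_pos (by positivity)] at this
  rw [Real.dist_eq, one_div, inv_pow, ← one_div, le_div_iff₀ (by positivity)]
  nlinarith

lemma cellAt_dist (j : ℕ) (x y : Pt) (h : cellAt j x = cellAt j y) : dist x y ≤ (1/2) ^ j := by
  simp only [cellAt, Prod.mk.injEq] at h
  rw [Prod.dist_eq, Prod.dist_eq]
  exact max_le (floor_eq_dist _ _ _ h.1) (max_le (floor_eq_dist _ _ _ h.2.1) (floor_eq_dist _ _ _ h.2.2))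

lemma floor_mem_near (j m : ℕ) (a b : ℝ) (h : dist a b ≤ m * (1/2) ^ j) :
    ⌊2 ^ j * a⌋ ∈ Finset.Icc (⌊2 ^ j * b⌋ - m) (⌊2 ^ j * b⌋ + m) := by
  have h2 : |2 ^ j * a - 2 ^ j * b| ≤ m := by
    rw [← mul_sub, abs_mul, abs_of_pos (by positivity)]
    rw [Real.dist_eq] at h
    have h3 : (2:ℝ) ^ j * (1/2) ^ j = 1 := by rw [← mul_pow]; norm_num
    calc (2:ℝ) ^ j * |a - b| ≤ 2 ^ j * (m * (1/2) ^ j) := by gcongr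
      _ = m * (2 ^ j * (1/2) ^ j) := by ring
      _ = m := by rw [h3, mul_one]
  obtain ⟨h3, h4⟩ := abs_le.1 h2
  rw [Finset.mem_Icc]
  constructor
  · rw [Int.le_floor]; push_cast
    linarith [Int.floor_le ((2:ℝ) ^ j * b)]
  · rw [← Int.lt_add_one_iff, Int.floor_lt]; push_cast
    linarith [Int.lt_floor_add_one ((2:ℝ) ^ j * b)]

lemma cellAt_near (j m : ℕ) (y : Pt) : ∃ T : Finset (ℤ × ℤ × ℤ), T.card = (2 * m + 1) ^ 3 ∧
    ∀ x : Pt, dist x y ≤ m * (1/2) ^ j → cellAt j x ∈ T := by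
  have hc : ∀ a : ℤ, (Finset.Icc (a - m) (a + m)).card = 2 * m + 1 := by
    intro a; rw [Int.card_Icc]; omega
  refine ⟨Finset.Icc (⌊2 ^ j * y.1⌋ - m) (⌊2 ^ j * y.1⌋ + m) ×ˢ Finset.Icc (⌊2 ^ j * y.2.1⌋ - m) (⌊2 ^ j * y.2.1⌋ + m) ×ˢ
    Finset.Icc (⌊2 ^ j * y.2.2⌋ - m) (⌊2 ^ j * y.2.2⌋ + m), ?_, ?_⟩
  · rw [card_product, card_product, hc, hc, hc]; ring
  · intro x hx
    rw [Prod.dist_eq, Prod.dist_eq] at hx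
    have h1 := le_trans (le_max_left _ _) hx
    have h2 := le_trans (le_max_right _ _) hx
    have h3 := le_trans (le_max_left _ _) h2
    have h4 := le_trans (le_max_right _ _) h2
    simp only [cellAt, Finset.mem_product]
    exact ⟨floor_mem_near _ _ _ _ h1, floor_mem_near _ _ _ _ h3, floor_mem_near _ _ _ _ h4⟩

lemma count_near {X : Type*} (e : X → Pt) (P : Finset X) (j m N : ℕ) (y : Pt)
    (hN : ∀ x, (P.filter (fun p => cellAt j (e p) = cellAt j (e x))).card ≤ N) (S : Finset X) (hS : S ⊆ P)
    (hd : ∀ p ∈ S, dist (e p) y ≤ m * (1/2) ^ j) : S.card ≤ (2 * m + 1) ^ 3 * N := by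
  obtain ⟨T, hT, hT2⟩ := cellAt_near j m y
  have h1 : S.card ≤ N * (S.image (fun p => cellAt j (e p))).card := by
    apply card_le_mul_card_image
    intro b hb
    obtain ⟨x, hx, rfl⟩ := mem_image.1 hb
    exact (card_le_card (filter_subset_filter _ hS)).trans (hN x)
  have h2 : (S.image (fun p => cellAt j (e p))).card ≤ T.card := by
    apply card_le_card
    intro b hb
    obtain ⟨x, hx, rfl⟩ := mem_image.1 hb
    exact hT2 _ (hd x hx)
  rw [hT] at h2
  calc S.card ≤ _ := h1
    _ ≤ N * (2 * m + 1) ^ 3 := by gcongr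
    _ = _ := by ring

def ctn {X : Type*} [PseudoEMetricSpace X] (t : ℝ) : MeasureTheory.OuterMeasure X :=
  MeasureTheory.OuterMeasure.ofFunction (fun A => ⨆ _ : A.Nonempty, Metric.ediam A ^ t) (by simp)

lemma ctn_le {X : Type*} [PseudoEMetricSpace X] (t : ℝ) (ht : 0 ≤ t) (A : Set X) (r : ENNReal) (h : Metric.ediam A ≤ r) :
    ctn t A ≤ r ^ t := by
  refine (MeasureTheory.OuterMeasure.ofFunction_le A).trans ?_
  exact iSup_le fun _ => ENNReal.rpow_le_rpow h ht

lemma frost_metric {X : Type*} [PseudoMetricSpace X] (e : X → Pt) (he : ∀ x y, dist (e x) (e y) = dist x y) (A : Set X)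
    (hA : ∀ a ∈ A, dist (e a) 0 ≤ 4) (t : ℝ) (ht : 0 < t) (ht1 : t ≤ 1) (k : ℕ) :
    ∃ P : Finset X, (∀ p ∈ P, p ∈ A) ∧ (∀ p ∈ P, ∀ q ∈ P, cellAt k (e p) = cellAt k (e q) → p = q) ∧
      (∀ q ρ, (1/2:ℝ) ^ k ≤ ρ → ((P.filter (fun p => dist p q ≤ ρ)).card : ℝ) ≤ 2000 * (ρ / (1/2) ^ k) ^ t) ∧
      ctn t A ≤ ENNReal.ofReal (((1/2:ℝ) ^ k) ^ t * P.card) := by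
  set N : ℕ → ℕ := fun j => ⌈((2:ℝ) ^ (k - j)) ^ t⌉₊ with hN
  have hNk : N k = 1 := by simp [hN]
  have hfin : ((fun x => cellAt k (e x)) '' A).Finite := by
    obtain ⟨T, -, hT⟩ := cellAt_near k (4 * 2 ^ k) 0
    refine T.finite_toSet.subset ?_
    rintro _ ⟨x, hx, rfl⟩
    apply hT
    push_cast
    rw [mul_assoc, ← mul_pow]; norm_num; simpa using hA x hx
  obtain ⟨P, hPA, hPN, Q, hQk, hQA, hQP⟩ := frost (fun j x => cellAt j (e x))
    (fun i j hij x y h => cellAt_nest i j hij _ _ h) A k hfin N hNk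
  have hN2 : ∀ j, (N j : ℝ) ≤ 2 * ((2:ℝ) ^ (k - j)) ^ t := by
    intro j
    have h1 : (1:ℝ) ≤ ((2:ℝ) ^ (k - j)) ^ t := Real.one_le_rpow (one_le_pow₀ (by norm_num)) ht.le
    have := Nat.ceil_lt_add_one (zero_le_one.trans h1)
    simp only [hN]; linarith
  have hδ : (0:ℝ) < (1/2) ^ k := by positivity
  have h2k : ∀ j ≤ k, (2:ℝ) ^ (k - j) = (1/2) ^ j / (1/2) ^ k := by
    intro j hj
    obtain ⟨d, rfl⟩ := Nat.exists_eq_add_of_le hj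
    rw [Nat.add_sub_cancel_left, pow_add, one_div, inv_pow, inv_pow]
    field_simp
  refine ⟨P, hPA, ?_, ?_, ?_⟩
  · intro p hp q hq h
    have := hPN q k le_rfl
    rw [hNk, card_le_one] at this
    exact this p (by simp [hp, h]) q (by simp [hq])
  · intro q ρ hρ
    have hρ0 : 0 < ρ := hδ.trans_le hρ
    rcases le_or_gt ρ 1 with hρ1 | hρ1
    · obtain ⟨n, hn1, hn2⟩ := exists_nat_pow_near_of_lt_one hρ0 hρ1 (by norm_num : (0:ℝ) < 1/2) (by norm_num)
      have hnk : n ≤ k := by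
        have := hρ.trans hn2
        by_contra hlt
        push Not at hlt
        exact absurd (pow_lt_pow_right_of_lt_one₀ (by norm_num : (0:ℝ) < 1/2) (by norm_num) hlt) (not_lt.2 this)
      have h1 := count_near e P n 1 (N n) (e q) (fun x => by convert hPN x n hnk) (P.filter (fun p => dist p q ≤ ρ)) (filter_subset _ _)
        (by intro p hp; rw [he]; push_cast; rw [one_mul]; exact (mem_filter.1 hp).2.trans hn2)
      have h1' : ((P.filter (fun p => dist p q ≤ ρ)).card : ℝ) ≤ 27 * N n := by
        have : ((P.filter (fun p => dist p q ≤ ρ)).card : ℝ) ≤ (((2 * 1 + 1) ^ 3 * N n : ℕ) : ℝ) := by exact_mod_cast h1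
        push_cast at this; linarith
      have h3 : ((2:ℝ) ^ (k - n)) ^ t ≤ 2 * (ρ / (1/2) ^ k) ^ t := by
        rw [h2k n hnk]
        refine le_trans ?_ (rpow_cmul 2 (ρ / (1/2) ^ k) t (by norm_num) (by positivity) ht.le ht1)
        apply Real.rpow_le_rpow (by positivity) _ ht.le
        rw [← mul_div_assoc]
        gcongr
        rw [pow_succ] at hn1
        linarith
      have h4 : 0 ≤ (ρ / (1/2) ^ k) ^ t := by positivity
      linarith [hN2 n]
    · have h1 := count_near e P 0 4 (N 0) 0 (fun x => by convert hPN x 0 (Nat.zero_le _)) (P.filter (fun p => dist p q ≤ ρ)) (filter_subset _ _)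
        (by intro p hp; push_cast; rw [pow_zero, mul_one]; exact hA p (hPA p (mem_filter.1 hp).1))
      have h1' : ((P.filter (fun p => dist p q ≤ ρ)).card : ℝ) ≤ 729 * N 0 := by
        have : ((P.filter (fun p => dist p q ≤ ρ)).card : ℝ) ≤ (((2 * 4 + 1) ^ 3 * N 0 : ℕ) : ℝ) := by exact_mod_cast h1
        push_cast at this; linarith
      have h3 : ((2:ℝ) ^ (k - 0)) ^ t ≤ (ρ / (1/2) ^ k) ^ t := by
        rw [h2k 0 (Nat.zero_le _)]
        apply Real.rpow_le_rpow (by positivity) _ ht.le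
        gcongr
        simpa using hρ1.le
      have h4 : 0 ≤ (ρ / (1/2) ^ k) ^ t := by positivity
      linarith [hN2 0]
  · have hsub : A ⊆ ⋃ q ∈ Q, {x | cellAt q.1 (e x) = q.2} := by
      intro x hx
      obtain ⟨q, hq, h⟩ := hQA x hx
      exact Set.mem_biUnion hq h
    have hb : ∀ q ∈ Q, ctn t {x : X | cellAt q.1 (e x) = q.2} ≤ ENNReal.ofReal (((1/2:ℝ) ^ k) ^ t * N q.1) := by
      intro q hq
      refine (ctn_le t ht.le _ (ENNReal.ofReal ((1/2) ^ q.1)) ?_).trans ?_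
      · apply Metric.ediam_le
        intro x hx y hy
        rw [edist_dist]
        apply ENNReal.ofReal_le_ofReal
        rw [← he]
        exact cellAt_dist _ _ _ (hx.trans hy.symm)
      · rw [ENNReal.ofReal_rpow_of_nonneg (by positivity) ht.le]
        apply ENNReal.ofReal_le_ofReal
        have h1 : ((2:ℝ) ^ (k - q.1)) ^ t ≤ N q.1 := Nat.le_ceil _
        rw [h2k _ (hQk q hq), Real.div_rpow (by positivity) (by positivity), div_le_iff₀ (by positivity)] at h1
        linarith
    calc ctn t A ≤ ctn t (⋃ q ∈ Q, {x : X | cellAt q.1 (e x) = q.2}) := MeasureTheory.measure_mono hsub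
      _ ≤ ∑ q ∈ Q, ctn t {x : X | cellAt q.1 (e x) = q.2} := MeasureTheory.measure_biUnion_finset_le _ _
      _ ≤ ∑ q ∈ Q, ENNReal.ofReal (((1/2:ℝ) ^ k) ^ t * N q.1) := sum_le_sum hb
      _ = ENNReal.ofReal (∑ q ∈ Q, ((1/2:ℝ) ^ k) ^ t * N q.1) := by
        rw [ENNReal.ofReal_sum_of_nonneg]; intros; positivity
      _ ≤ _ := by
        apply ENNReal.ofReal_le_ofReal
        rw [← mul_sum]
        gcongr
        exact_mod_cast hQP
end

noncomputable section
open Finset Classical MeasureTheory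

lemma ctn_apply {X : Type*} [PseudoEMetricSpace X] (t : ℝ) (A : Set X) :
    ctn t A = ⨅ (U : ℕ → Set X) (_ : A ⊆ ⋃ n, U n), ∑' n, ⨆ _ : (U n).Nonempty, Metric.ediam (U n) ^ t :=
  MeasureTheory.OuterMeasure.ofFunction_apply _ _ _

lemma ediam_rpow_le {X : Type*} [PseudoEMetricSpace X] (t : ℝ) (ht : 0 < t) (A : Set X) :
    Metric.ediam A ^ t ≤ ⨆ _ : A.Nonempty, Metric.ediam A ^ t := by
  rcases A.eq_empty_or_nonempty with rfl | h
  · simp [ht]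
  · exact le_iSup (fun _ : A.Nonempty => Metric.ediam A ^ t) h

lemma ctn_pos {X : Type*} [EMetricSpace X] [MeasurableSpace X] [BorelSpace X] (t : ℝ) (ht : 0 < t) (A : Set X)
    (h : ENNReal.ofReal t < dimH A) : 0 < ctn t A := by
  by_contra hcon
  have h0 : ctn t A = 0 := by simpa using hcon
  have hd : Measure.hausdorffMeasure (t.toNNReal : ℝ) A = ⊤ := hausdorffMeasure_of_lt_dimH h
  rw [Real.coe_toNNReal _ ht.le] at hd
  have : Measure.hausdorffMeasure t A = 0 := by
    rw [Measure.hausdorffMeasure_apply]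
    simp only [ENNReal.iSup_eq_zero]
    intro r hr
    refine le_antisymm (le_of_forall_gt fun η hη => ?_) zero_le
    have hε : ctn t A < min η (r ^ t) := by
      rw [h0]; exact lt_min hη (ENNReal.rpow_pos_of_nonneg hr ht.le)
    rw [ctn_apply] at hε
    obtain ⟨U, hU⟩ := iInf_lt_iff.1 hε
    obtain ⟨hAU, hU⟩ := iInf_lt_iff.1 hU
    refine lt_of_le_of_lt ?_ (hU.trans_le (min_le_left _ _))
    refine iInf_le_of_le U (iInf_le_of_le hAU (iInf_le_of_le ?_ le_rfl))
    intro n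
    have h1 := (ediam_rpow_le t ht (U n)).trans ((ENNReal.le_tsum n).trans (hU.le.trans (min_le_right _ _)))
    exact (ENNReal.rpow_le_rpow_iff ht).1 h1
  rw [this] at hd
  exact absurd hd (by simp)

lemma cover_lemma {X : Type*} [EMetricSpace X] [MeasurableSpace X] [BorelSpace X] (β : ℝ) (hβ : 0 < β) (A : Set X)
    (h : dimH A < ENNReal.ofReal β) (k0 : ℕ) :
    ∃ (U : ℕ → Set X) (κ : ℕ → ℕ), A ⊆ ⋃ n, U n ∧ (∀ n, k0 ≤ κ n) ∧
      (∀ n, Metric.ediam (U n) ≤ ENNReal.ofReal ((1/2) ^ κ n)) ∧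
      ∀ k, ∀ T : Finset ℕ, (∀ n ∈ T, κ n = k) → (T.card : ℝ) ≤ ((2:ℝ) ^ (k+1)) ^ β := by
  have hd : Measure.hausdorffMeasure (β.toNNReal : ℝ) A = 0 := hausdorffMeasure_of_dimH_lt h
  rw [Real.coe_toNNReal _ hβ.le, Measure.hausdorffMeasure_apply] at hd
  simp only [ENNReal.iSup_eq_zero] at hd
  have hd1 := hd 1 one_pos
  set c : ℝ := ((1/2) ^ (k0+1)) ^ β with hc
  have hc0 : 0 < c := by positivity
  have hc1 : c ≤ 1 := Real.rpow_le_one (by positivity) (pow_le_one₀ (by norm_num) (by norm_num)) hβ.le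
  have hc2 : (0:ENNReal) < ENNReal.ofReal (c/2) := by simpa using hc0
  rw [← hd1] at hc2
  obtain ⟨U, hU⟩ := iInf_lt_iff.1 hc2
  obtain ⟨hAU, hU⟩ := iInf_lt_iff.1 hU
  obtain ⟨hU1, hU⟩ := iInf_lt_iff.1 hU
  have hc3 : ENNReal.ofReal (c/2) ≠ 0 := by simpa using hc0
  obtain ⟨ε, hε0, hε⟩ := ENNReal.exists_pos_sum_of_countable' hc3 ℕ
  set x : ℕ → ENNReal := fun n => (⨆ _ : (U n).Nonempty, Metric.ediam (U n) ^ β) + ε n with hx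
  have hxs : ∑' n, x n ≤ ENNReal.ofReal c := by
    rw [ENNReal.tsum_add]
    refine (add_le_add hU.le hε.le).trans ?_
    rw [← ENNReal.ofReal_add (by positivity) (by positivity)]
    simp
  have hxn : ∀ n, x n ≤ ENNReal.ofReal c := fun n => (ENNReal.le_tsum n).trans hxs
  have hxt : ∀ n, x n ≠ ⊤ := fun n => ne_top_of_le_ne_top ENNReal.ofReal_ne_top (hxn n)
  have hx0 : ∀ n, 0 < (x n).toReal := fun n => ENNReal.toReal_pos (by simp only [hx]; exact (lt_of_lt_of_le (hε0 n) le_add_self).ne') (hxt n)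
  have hxc : ∀ n, (x n).toReal ≤ c := fun n => ENNReal.toReal_le_of_le_ofReal hc0.le (hxn n)
  set ρ : ℕ → ℝ := fun n => (x n).toReal ^ (1/β) with hρ
  have hρ0 : ∀ n, 0 < ρ n := fun n => Real.rpow_pos_of_pos (hx0 n) _
  have hρβ : ∀ n, ρ n ^ β = (x n).toReal := by
    intro n
    simp only [hρ]
    rw [← Real.rpow_mul (hx0 n).le, one_div_mul_cancel hβ.ne', Real.rpow_one]
  have hρc : ∀ n, ρ n ≤ (1/2) ^ (k0+1) := by
    intro n
    rw [← Real.rpow_le_rpow_iff (hρ0 n).le (by positivity) hβ, hρβ]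
    exact hxc n
  have hρ1 : ∀ n, ρ n ≤ 1 := fun n => (hρc n).trans (pow_le_one₀ (by norm_num) (by norm_num))
  choose κ hκ1 hκ2 using fun n => exists_nat_pow_near_of_lt_one (hρ0 n) (hρ1 n) (by norm_num : (0:ℝ) < 1/2) (by norm_num)
  refine ⟨U, κ, hAU, ?_, ?_, ?_⟩
  · intro n
    have h1 := (hκ1 n).trans_le (hρc n)
    have := (pow_lt_pow_iff_right_of_lt_one₀ (by norm_num : (0:ℝ) < 1/2) (by norm_num)).1 h1
    omega
  · intro n
    rw [← ENNReal.rpow_le_rpow_iff hβ]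
    refine (ediam_rpow_le β hβ (U n)).trans ?_
    have h1 : (⨆ _ : (U n).Nonempty, Metric.ediam (U n) ^ β) ≤ x n := le_self_add
    refine h1.trans ?_
    rw [ENNReal.ofReal_rpow_of_nonneg (by positivity) hβ.le, ← ENNReal.ofReal_toReal (hxt n), ← hρβ]
    apply ENNReal.ofReal_le_ofReal
    exact Real.rpow_le_rpow (hρ0 n).le (hκ2 n) hβ.le
  · intro k T hT
    have h1 : ∑ n ∈ T, (x n).toReal ≤ 1 := by
      rw [← ENNReal.toReal_sum (fun n _ => hxt n)]
      refine (ENNReal.toReal_le_of_le_ofReal hc0.le ((ENNReal.sum_le_tsum T).trans hxs)).trans hc1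
    have h2 : ∑ n ∈ T, ((1/2:ℝ) ^ (k+1)) ^ β ≤ ∑ n ∈ T, (x n).toReal := by
      apply sum_le_sum
      intro n hn
      rw [← hρβ, ← hT n hn]
      exact Real.rpow_le_rpow (by positivity) (hκ1 n).le hβ.le
    rw [sum_const, nsmul_eq_mul] at h2
    have h3 : ((2:ℝ) ^ (k+1)) ^ β * ((1/2:ℝ) ^ (k+1)) ^ β = 1 := by
      rw [← Real.mul_rpow (by positivity) (by positivity), ← mul_pow]; norm_num
    have h4 : 0 < ((2:ℝ) ^ (k+1)) ^ β := by positivity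
    calc (T.card : ℝ) = T.card * ((1/2:ℝ) ^ (k+1)) ^ β * ((2:ℝ) ^ (k+1)) ^ β := by rw [mul_assoc, mul_comm (((1/2:ℝ) ^ (k+1)) ^ β), h3, mul_one]
      _ ≤ 1 * ((2:ℝ) ^ (k+1)) ^ β := by gcongr; linarith
      _ = _ := one_mul _
end

noncomputable section
open Finset Classical MeasureTheory

def circ (p : Pt) : Set (ℝ × ℝ) := {z | (z.1 - p.1) ^ 2 + (z.2 - p.2.1) ^ 2 = p.2.2 ^ 2}

def emb (z : ℝ × ℝ) : Pt := (z.1, z.2, 0)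

lemma emb_dist (x y : ℝ × ℝ) : dist (emb x) (emb y) = dist x y := by
  simp [emb, Prod.dist_eq]

def corner (k : ℕ) (c : ℤ × ℤ × ℤ) : ℝ × ℝ := (c.1 / 2 ^ k, c.2.1 / 2 ^ k)

lemma corner_dist1 (k : ℕ) (a : ℝ) : |(⌊2 ^ k * a⌋ : ℝ) / 2 ^ k - a| ≤ (1/2) ^ k := by
  have h : (0:ℝ) < 2 ^ k := by positivity
  have e : (⌊2 ^ k * a⌋ : ℝ) / 2 ^ k - a = (⌊2 ^ k * a⌋ - 2 ^ k * a) / 2 ^ k := by field_simp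
  rw [e, abs_div, abs_of_pos h, one_div, inv_pow, ← one_div]
  gcongr
  rw [abs_le]
  constructor <;> linarith [Int.floor_le ((2:ℝ) ^ k * a), Int.lt_floor_add_one ((2:ℝ) ^ k * a)]

lemma corner_dist (k : ℕ) (z : ℝ × ℝ) : dist (corner k (cellAt k (emb z))) z ≤ (1/2) ^ k := by
  rw [Prod.dist_eq]
  exact max_le (corner_dist1 k z.1) (corner_dist1 k z.2)

lemma corner_inj (k : ℕ) (x y : ℝ × ℝ) (h : corner k (cellAt k (emb x)) = corner k (cellAt k (emb y))) :
    cellAt k (emb x) = cellAt k (emb y) := by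
  simp only [corner, cellAt, emb, Prod.mk.injEq] at h ⊢
  have h2 : (2:ℝ) ^ k ≠ 0 := by positivity
  rw [div_left_inj' h2, div_left_inj' h2] at h
  exact ⟨by exact_mod_cast h.1, by exact_mod_cast h.2, trivial⟩

lemma circ_abs {p : Pt} {z : ℝ × ℝ} (hz : z ∈ circ p) (hr : p.2.2 ≤ 2) (hr0 : 0 ≤ p.2.2) :
    |z.1 - p.1| ≤ 2 ∧ |z.2 - p.2.1| ≤ 2 ∧ |z.1 - p.1| + |z.2 - p.2.1| ≤ 3 := by
  have hz' : (z.1 - p.1) ^ 2 + (z.2 - p.2.1) ^ 2 = p.2.2 ^ 2 := hz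
  rw [← sq_abs (z.1 - p.1), ← sq_abs (z.2 - p.2.1)] at hz'
  have h1 := abs_nonneg (z.1 - p.1)
  have h2 := abs_nonneg (z.2 - p.2.1)
  set a := |z.1 - p.1|
  set b := |z.2 - p.2.1|
  have h3 : a ^ 2 + b ^ 2 ≤ 4 := by nlinarith
  refine ⟨by nlinarith, by nlinarith, by nlinarith [sq_nonneg (a - b)]⟩

lemma circ_near {p : Pt} {z w : ℝ × ℝ} (hz : z ∈ circ p) (hr : p.2.2 ≤ 2) (hr0 : 0 ≤ p.2.2) {δ : ℝ} (hδ1 : δ ≤ 1)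
    (hw : dist w z ≤ δ) : |(w.1 - p.1) ^ 2 + (w.2 - p.2.1) ^ 2 - p.2.2 ^ 2| ≤ 9 * δ := by
  obtain ⟨-, -, h⟩ := circ_abs hz hr hr0
  have hz' : (z.1 - p.1) ^ 2 + (z.2 - p.2.1) ^ 2 = p.2.2 ^ 2 := hz
  rw [Prod.dist_eq] at hw
  have ha : |w.1 - z.1| ≤ δ := (le_max_left _ _).trans hw
  have hb : |w.2 - z.2| ≤ δ := (le_max_right _ _).trans hw
  have e : (w.1 - p.1) ^ 2 + (w.2 - p.2.1) ^ 2 - p.2.2 ^ 2 =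
      2 * ((z.1 - p.1) * (w.1 - z.1)) + 2 * ((z.2 - p.2.1) * (w.2 - z.2)) + ((w.1 - z.1) * (w.1 - z.1) + (w.2 - z.2) * (w.2 - z.2)) := by
    rw [← hz']; ring
  rw [e]
  have hδ0 : 0 ≤ δ := (abs_nonneg _).trans ha
  have b1 : |(z.1 - p.1) * (w.1 - z.1)| ≤ |z.1 - p.1| * δ := by rw [abs_mul]; gcongr
  have b2 : |(z.2 - p.2.1) * (w.2 - z.2)| ≤ |z.2 - p.2.1| * δ := by rw [abs_mul]; gcongr
  have b3 : |(w.1 - z.1) * (w.1 - z.1)| ≤ δ * 1 := by rw [abs_mul]; gcongr; linarith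
  have b4 : |(w.2 - z.2) * (w.2 - z.2)| ≤ δ * 1 := by rw [abs_mul]; gcongr; linarith
  have b5 : (|z.1 - p.1| + |z.2 - p.2.1|) * δ ≤ 3 * δ := by gcongr
  have c1 := abs_le.1 b1
  have c2 := abs_le.1 b2
  have c3 := abs_le.1 b3
  have c4 := abs_le.1 b4
  rw [abs_le]
  constructor <;> linarith [c1.1, c1.2, c2.1, c2.2, c3.1, c3.2, c4.1, c4.2]

lemma scale_lemma (k : ℕ) (s t c : ℝ) (ht : 0 < t) (hts : t ≤ s) (hs1 : s ≤ 1) (hc : 0 < c)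
    (K : Set Pt) (hK : ∀ p ∈ K, (1 ≤ p.2.2 ∧ p.2.2 ≤ 2) ∧ |p.1| ≤ 1/100 ∧ |p.2.1| ≤ 1/100)
    (hKc : ENNReal.ofReal c ≤ ctn t K) (U : ℕ → Set (ℝ × ℝ)) (T : Finset ℕ)
    (hU : ∀ n ∈ T, Metric.ediam (U n) ≤ ENNReal.ofReal ((1/2) ^ k))
    (hF : ∀ p ∈ K, ENNReal.ofReal c ≤ ctn s ((⋃ n ∈ T, U n) ∩ circ p)) :
    c ^ 4 * ((2:ℝ) ^ k) ^ (t + s) ≤ 10 ^ 50 * ((k:ℝ) + 13) ^ 9 * T.card := by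
  set δ : ℝ := (1/2) ^ k with hδ
  have hδ0 : 0 < δ := by positivity
  have hδ1 : δ ≤ 1 := pow_le_one₀ (by norm_num) (by norm_num)
  have hδ2 : 1 / δ = 2 ^ k := by rw [hδ]; simp
  have hs : 0 < s := ht.trans_le hts
  have hKd : ∀ p ∈ K, dist p 0 ≤ 4 := by
    intro p hp
    obtain ⟨⟨h1, h2⟩, h3, h4⟩ := hK p hp
    simp only [Prod.dist_eq, Prod.fst_zero, Prod.snd_zero, Real.dist_eq, sub_zero]
    refine max_le (by linarith) (max_le (by linarith) ?_)
    rw [abs_of_nonneg (by linarith)]; linarith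
  obtain ⟨P, hPK, -, hPb, hPc⟩ := frost_metric (fun x : Pt => x) (fun _ _ => rfl) K hKd t ht (hts.trans hs1) k
  have hEp : ∀ p ∈ K, ∃ E : Finset (ℝ × ℝ), (∀ z ∈ E, z ∈ (⋃ n ∈ T, U n) ∩ circ p) ∧
      (∀ z ∈ E, ∀ w ∈ E, cellAt k (emb z) = cellAt k (emb w) → z = w) ∧
      (∀ q ρ, (1/2:ℝ) ^ k ≤ ρ → ((E.filter (fun z => dist z q ≤ ρ)).card : ℝ) ≤ 2000 * (ρ / (1/2) ^ k) ^ s) ∧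
      ctn s ((⋃ n ∈ T, U n) ∩ circ p) ≤ ENNReal.ofReal (((1/2:ℝ) ^ k) ^ s * E.card) := by
    intro p hp
    apply frost_metric emb emb_dist _ _ s hs hs1 k
    intro z hz
    obtain ⟨⟨h1, h2⟩, h3, h4⟩ := hK p hp
    obtain ⟨a1, a2, -⟩ := circ_abs hz.2 h2 (by linarith)
    simp only [emb, Prod.dist_eq, Prod.fst_zero, Prod.snd_zero, Real.dist_eq, sub_zero]
    have e1 := abs_add_le (z.1 - p.1) p.1
    have e2 := abs_add_le (z.2 - p.2.1) p.2.1
    rw [sub_add_cancel] at e1 e2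
    refine max_le (by linarith) (max_le (by linarith) (by simp))
  choose! E0 hE0 hE0i hE0b hE0c using hEp
  set g : ℝ × ℝ → ℝ × ℝ := fun z => corner k (cellAt k (emb z)) with hg
  have hgd : ∀ z, dist (g z) z ≤ δ := corner_dist k
  set E : Pt → Finset (ℝ × ℝ) := fun p => (E0 p).image g with hE
  have hEcard : ∀ p ∈ K, (E p).card = (E0 p).card := by
    intro p hp
    apply card_image_of_injOn
    intro z hz w hw h
    exact hE0i p hp z hz w hw (corner_inj k z w h)
  have hcnt : ∀ (a : ℝ) (n : ℕ), ENNReal.ofReal c ≤ ENNReal.ofReal (δ ^ a * n) → c * ((2:ℝ) ^ k) ^ a ≤ n := by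
    intro a n h
    have h1 := (ENNReal.ofReal_le_ofReal_iff (by positivity)).1 h
    have h2 : δ ^ a * ((2:ℝ) ^ k) ^ a = 1 := by
      rw [← Real.mul_rpow (by positivity) (by positivity), ← hδ2, mul_one_div_cancel hδ0.ne', Real.one_rpow]
    calc c * ((2:ℝ) ^ k) ^ a ≤ (δ ^ a * n) * ((2:ℝ) ^ k) ^ a := by gcongr
      _ = (δ ^ a * ((2:ℝ) ^ k) ^ a) * n := by ring
      _ = n := by rw [h2, one_mul]
  have hPn : c * ((2:ℝ) ^ k) ^ t ≤ P.card := hcnt t _ (hKc.trans hPc)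
  have hEn : ∀ p ∈ P, c * ((2:ℝ) ^ k) ^ s ≤ (E p).card := by
    intro p hp
    rw [hEcard p (hPK p hp)]
    exact hcnt s _ ((hF p (hPK p hp)).trans (hE0c p (hPK p hp)))
  have hcfg : Cfg δ 4000 s t (max 1 P.card) P E := by
    refine ⟨hδ0, hδ1, by norm_num, ht, hts, hs1, le_max_left _ _, fun p hp => hK p (hPK p hp), ?_, ?_, ?_, ?_⟩
    · intro p hp z hz
      obtain ⟨w, hw, rfl⟩ := mem_image.1 hz
      have := hK p (hPK p hp)
      exact circ_near (hE0 p (hPK p hp) w hw).2 this.1.2 (by linarith [this.1.1]) hδ1 (hgd w)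
    · intro q ρ hρ
      refine le_trans ?_ ((hPb q ρ hρ).trans ?_)
      · apply le_of_eq; congr!
      · have : 0 < ρ := hδ0.trans_le hρ
        gcongr; norm_num
    · intro p hp y ρ hρ
      have hρ0 : 0 < ρ := hδ0.trans_le hρ
      have h1 : (E p).filter (fun z => dist z y ≤ ρ) ⊆ ((E0 p).filter (fun z => dist z y ≤ 2 * ρ)).image g := by
        intro z hz
        obtain ⟨hz1, hz2⟩ := mem_filter.1 hz
        obtain ⟨w, hw, rfl⟩ := mem_image.1 hz1
        refine mem_image_of_mem _ (mem_filter.2 ⟨hw, ?_⟩)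
        have := dist_triangle w (g w) y
        rw [dist_comm w (g w)] at this
        linarith [hgd w]
      have h2 := (card_le_card h1).trans card_image_le
      have h3 := hE0b p (hPK p hp) y (2 * ρ) (by linarith)
      have h4 : (2 * ρ / (1/2) ^ k) ^ s ≤ 2 * (ρ / δ) ^ s := by
        rw [mul_div_assoc]; exact rpow_cmul 2 (ρ / δ) s (by norm_num) (by positivity) hs.le hs1
      have h5 : (((E p).filter (fun z => dist z y ≤ ρ)).card : ℝ) ≤ ((E0 p).filter (fun z => dist z y ≤ 2 * ρ)).card := by
        exact_mod_cast h2
      have h6 : (((E0 p).filter (fun z => dist z y ≤ 2 * ρ)).card : ℝ) ≤ 2000 * (2 * ρ / (1/2) ^ k) ^ s := h3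
      linarith
    · intro z
      have h1 : ((P.filter (fun p => z ∈ E p)).card : ℝ) ≤ P.card := by exact_mod_cast card_filter_le _ _
      have h2 := le_max_right (1:ℝ) P.card
      have h3 : (0:ℝ) ≤ P.card := by positivity
      linarith
  have hPI : P.card < 2 ^ (k + 13) := by
    have h1 := hPb 0 4 (by linarith [hδ1])
    have h2 : P.filter (fun p => dist p 0 ≤ 4) = P := by
      rw [filter_eq_self]; intro p hp; exact hKd p (hPK p hp)
    have h3 : (4 / (1/2:ℝ) ^ k) ^ t ≤ 4 * 2 ^ k := by
      have h4 : (1:ℝ) ≤ 4 / (1/2:ℝ) ^ k := by rw [le_div_iff₀ hδ0]; linarith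
      refine (Real.rpow_le_rpow_of_exponent_le h4 (hts.trans hs1)).trans ?_
      rw [Real.rpow_one, ← hδ2, mul_one_div]
    have h5 : (P.card : ℝ) ≤ 8000 * 2 ^ k := by
      have : (P.card : ℝ) ≤ 2000 * (4 / (1/2:ℝ) ^ k) ^ t := by
        refine le_trans (le_of_eq ?_) h1
        congr 2
        convert h2.symm
      linarith
    have h6 : (P.card : ℝ) < 2 ^ (k + 13) := by
      rw [pow_add]
      have : (0:ℝ) < 2 ^ k := by positivity
      norm_num; linarith
    exact_mod_cast h6
  obtain ⟨Fs, hFs, hFsE⟩ : ∃ Fs : Finset (ℝ × ℝ), Fs.card ≤ T.card * 27 ∧ ∀ p ∈ P, E p ⊆ Fs := by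
    have hn : ∀ n ∈ T, ∃ S : Finset (ℤ × ℤ × ℤ), S.card ≤ 27 ∧ ∀ z ∈ U n, cellAt k (emb z) ∈ S := by
      intro n hn
      rcases (U n).eq_empty_or_nonempty with h | ⟨y, hy⟩
      · exact ⟨∅, by simp, by simp [h]⟩
      · obtain ⟨S, hS, hS2⟩ := cellAt_near k 1 (emb y)
        refine ⟨S, by rw [hS]; norm_num, fun z hz => hS2 _ ?_⟩
        rw [emb_dist, Nat.cast_one, one_mul]
        have := (Metric.edist_le_ediam_of_mem hz hy).trans (hU n hn)
        rw [edist_dist] at this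
        exact (ENNReal.ofReal_le_ofReal_iff hδ0.le).1 this
    choose! S hS1 hS2 using hn
    refine ⟨T.biUnion (fun n => (S n).image (corner k)), ?_, ?_⟩
    · exact card_biUnion_le_card_mul _ _ _ (fun n hn => card_image_le.trans (hS1 n hn))
    · intro p hp z hz
      obtain ⟨w, hw, rfl⟩ := mem_image.1 hz
      have h1 := (hE0 p (hPK p hp) w hw).1
      simp only [Set.mem_iUnion] at h1
      obtain ⟨n, hn, hwn⟩ := h1
      exact mem_biUnion.2 ⟨n, hn, mem_image_of_mem _ (hS2 n hn w hwn)⟩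
  have hfin := hcfg.count k hδ (c * ((2:ℝ) ^ k) ^ s) (by positivity) hEn (k + 13) hPI Fs hFsE
  have hFsR : (Fs.card : ℝ) ≤ T.card * 27 := by exact_mod_cast hFs
  rw [hδ2] at hfin
  set A : ℝ := ((2:ℝ) ^ k) ^ s with hA
  have hA0 : 0 < A := by positivity
  set B : ℝ := ((2:ℝ) ^ k) ^ t with hB
  have hB0 : 0 < B := by positivity
  rw [Real.rpow_add (by positivity), ← hA, ← hB]
  have hk0 : (0:ℝ) ≤ k := by positivity
  have hl : c * B * (c * A) ^ 3 ≤ P.card * (c * A) ^ 3 := by gcongr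
  have hr : 2 * ((k + 13 : ℕ):ℝ) ^ 3 * (10 ^ 16 * 4000 ^ 2 * ((k:ℝ) + 1) ^ 3 * A) ^ 2 * Fs.card ≤
      2 * ((k:ℝ) + 13) ^ 3 * (10 ^ 16 * 4000 ^ 2 * ((k:ℝ) + 13) ^ 3 * A) ^ 2 * (T.card * 27) := by
    push_cast
    gcongr
    norm_num
  have hX := hl.trans (hfin.trans hr)
  have hX2 : (c ^ 4 * (B * A)) * A ^ 2 ≤ (10 ^ 50 * ((k:ℝ) + 13) ^ 9 * T.card) * A ^ 2 := by
    have hz : 0 ≤ ((k:ℝ) + 13) ^ 9 * T.card * A ^ 2 := by positivity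
    calc _ = c * B * (c * A) ^ 3 := by ring
      _ ≤ _ := hX
      _ = (54 * 4000 ^ 4 * 10 ^ 32) * (((k:ℝ) + 13) ^ 9 * T.card * A ^ 2) := by ring
      _ ≤ 10 ^ 50 * (((k:ℝ) + 13) ^ 9 * T.card * A ^ 2) := by gcongr; norm_num
      _ = _ := by ring
  exact le_of_mul_le_mul_right hX2 (by positivity)
end

noncomputable section
open Finset Classical MeasureTheory

lemma growth (C q : ℝ) (hC : 0 < C) (hq0 : 0 < q) (hq1 : q < 1) :
    ∃ k1 : ℕ, ∀ k ≥ k1, C * ((k:ℝ) + 13) ^ 9 * q ^ k < 1 := by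
  have h := tendsto_pow_const_mul_const_pow_of_abs_lt_one 9 (by rwa [abs_of_pos hq0] : |q| < 1)
  have h2 := (Filter.tendsto_add_atTop_iff_nat 13).2 h
  have h3 : (0:ℝ) < q ^ 13 / C := by positivity
  obtain ⟨k1, hk1⟩ := Filter.eventually_atTop.1 (h2.eventually (gt_mem_nhds h3))
  refine ⟨k1, fun k hk => ?_⟩
  have h4 := hk1 k hk
  push_cast at h4
  rw [lt_div_iff₀ hC, pow_add] at h4
  have h5 : (0:ℝ) < q ^ 13 := by positivity
  by_contra hcon
  push Not at hcon
  have := mul_le_mul_of_nonneg_right hcon h5.le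
  linarith

lemma exists_ge_of_tsum {f : ℕ → ENNReal} {g : ℕ → ENNReal} {a : ENNReal} (h1 : a ≤ ∑' i, f i) (h2 : ∑' i, g i < a) :
    ∃ i, g i ≤ f i := by
  by_contra hcon
  push Not at hcon
  exact absurd (h1.trans (ENNReal.tsum_le_tsum fun i => (hcon i).le)) (not_le.2 h2)

lemma main_std (s t ε β : ℝ) (ht : 0 < t) (hts : t ≤ s) (hs1 : s ≤ 1) (hε : 0 < ε) (hβ : 0 < β) (hβ2 : β ≤ s + t - 5 * ε)
    (K : Set Pt) (hK : ∀ p ∈ K, (1 ≤ p.2.2 ∧ p.2.2 ≤ 2) ∧ |p.1| ≤ 1/100 ∧ |p.2.1| ≤ 1/100) (F : Set (ℝ × ℝ))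
    (hKc : 0 < ctn t K) (hFc : ∀ p ∈ K, 0 < ctn s (F ∩ circ p)) : ENNReal.ofReal β ≤ dimH F := by
  by_contra hdim
  push Not at hdim
  obtain ⟨N, hN⟩ : ∃ N : ℕ, 0 < ctn t {p ∈ K | ((N:ENNReal) + 1)⁻¹ ≤ ctn s (F ∩ circ p)} := by
    by_contra hcon
    push Not at hcon
    have h1 : ctn t (⋃ N : ℕ, {p ∈ K | ((N:ENNReal) + 1)⁻¹ ≤ ctn s (F ∩ circ p)}) = 0 :=
      measure_iUnion_null fun N => le_antisymm (hcon N) zero_le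
    have h2 : K ⊆ ⋃ N : ℕ, {p ∈ K | ((N:ENNReal) + 1)⁻¹ ≤ ctn s (F ∩ circ p)} := by
      intro p hp
      obtain ⟨n, hn⟩ := ENNReal.exists_inv_nat_lt (hFc p hp).ne'
      refine Set.mem_iUnion.2 ⟨n, hp, le_trans (ENNReal.inv_le_inv.2 le_self_add) hn.le⟩
    exact absurd (measure_mono_null h2 h1) hKc.ne'
  set K1 := {p ∈ K | ((N:ENNReal) + 1)⁻¹ ≤ ctn s (F ∩ circ p)} with hK1
  set a : ENNReal := min (ctn t K1) ((N:ENNReal) + 1)⁻¹ with ha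
  have ha0 : 0 < a := lt_min hN (by simp)
  set q : ℝ := (1/2) ^ ε with hq
  have hq0 : 0 < q := by positivity
  have hq1 : q < 1 := Real.rpow_lt_one (by norm_num) (by norm_num) hε
  have hsum : ∑' k : ℕ, ENNReal.ofReal (q ^ k) ≠ ⊤ := by
    rw [← ENNReal.ofReal_tsum_of_nonneg (fun n => by positivity) (summable_geometric_of_lt_one hq0.le hq1)]
    exact ENNReal.ofReal_ne_top
  have htail := ENNReal.tendsto_sum_nat_add (fun k : ℕ => ENNReal.ofReal (q ^ k)) hsum
  obtain ⟨k2, hk2⟩ := Filter.eventually_atTop.1 (htail.eventually (gt_mem_nhds ha0))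
  obtain ⟨k1, hk1⟩ := growth (10 ^ 50 * 2 ^ β) q (by positivity) hq0 hq1
  set k0 := max k1 k2 with hk0
  have htl : ∑' i : ℕ, ENNReal.ofReal (q ^ (i + k0)) < a := hk2 k0 (le_max_right _ _)
  obtain ⟨U, κ, hFU, hκ0, hUd, hUc⟩ := cover_lemma β hβ F hdim k0
  have hT : ∀ k, ∃ T : Finset ℕ, (∀ n, n ∈ T ↔ κ n = k) ∧ (T.card : ℝ) ≤ ((2:ℝ) ^ (k+1)) ^ β := by
    intro k
    have hf : {n | κ n = k}.Finite := by
      by_contra hinf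
      obtain ⟨T, hT, hTc⟩ := Set.Infinite.exists_subset_card_eq hinf (⌈((2:ℝ) ^ (k+1)) ^ β⌉₊ + 1)
      have h1 := hUc k T (fun n hn => hT hn)
      rw [hTc] at h1
      push_cast at h1
      linarith [Nat.le_ceil (((2:ℝ) ^ (k+1)) ^ β)]
    refine ⟨hf.toFinset, by simp, hUc k _ (by simp)⟩
  choose T hTm hTc using hT
  have hstep1 : ∀ p ∈ K1, ∃ i : ℕ, ENNReal.ofReal (q ^ (i + k0)) ≤ ctn s ((⋃ n ∈ T (i + k0), U n) ∩ circ p) := by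
    intro p hp
    apply exists_ge_of_tsum (a := a) _ htl
    refine (min_le_right _ _).trans (hp.2.trans ?_)
    refine le_trans (measure_mono ?_) (measure_iUnion_le _)
    rintro z ⟨hzF, hzc⟩
    obtain ⟨n, hn⟩ := Set.mem_iUnion.1 (hFU hzF)
    obtain ⟨i, hi⟩ := Nat.exists_eq_add_of_le (hκ0 n)
    refine Set.mem_iUnion.2 ⟨i, ?_, hzc⟩
    exact Set.mem_biUnion ((hTm _ n).2 (by omega)) hn
  obtain ⟨i, hi⟩ : ∃ i : ℕ, ENNReal.ofReal (q ^ (i + k0)) ≤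
      ctn t {p ∈ K1 | ENNReal.ofReal (q ^ (i + k0)) ≤ ctn s ((⋃ n ∈ T (i + k0), U n) ∩ circ p)} := by
    apply exists_ge_of_tsum (a := a) _ htl
    refine (min_le_left _ _).trans ?_
    refine le_trans (measure_mono ?_) (measure_iUnion_le _)
    intro p hp
    obtain ⟨i, hi⟩ := hstep1 p hp
    exact Set.mem_iUnion.2 ⟨i, hp, hi⟩
  set k := i + k0 with hk
  have hfin := scale_lemma k s t (q ^ k) ht hts hs1 (by positivity) _ (fun p hp => hK p hp.1.1) hi U (T k)
    (fun n hn => by rw [← (hTm k n).1 hn]; exact hUd n) (fun p hp => hp.2)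
  have hg := hk1 k (by omega)
  have h2k : (0:ℝ) < 2 ^ k := by positivity
  have h2k1 : (1:ℝ) ≤ 2 ^ k := one_le_pow₀ (by norm_num)
  have e1 : ((2:ℝ) ^ (k+1)) ^ β = 2 ^ β * ((2:ℝ) ^ k) ^ β := by
    rw [pow_succ, mul_comm, Real.mul_rpow (by norm_num) h2k.le]
  have e2 : ((2:ℝ) ^ k) ^ β ≤ ((2:ℝ) ^ k) ^ (t + s) * (q ^ k) ^ 5 := by
    have e3 : (q ^ k) * ((2:ℝ) ^ k) ^ ε = 1 := by
      rw [hq, ← Real.rpow_natCast, ← Real.rpow_mul (by norm_num), mul_comm ε, Real.rpow_mul (by norm_num), Real.rpow_natCast,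
        ← Real.mul_rpow (by positivity) (by positivity), ← mul_pow]
      norm_num
    calc ((2:ℝ) ^ k) ^ β ≤ ((2:ℝ) ^ k) ^ (s + t - 5 * ε) := Real.rpow_le_rpow_of_exponent_le h2k1 hβ2
      _ = ((2:ℝ) ^ k) ^ (s + t - 5 * ε) * ((q ^ k) * ((2:ℝ) ^ k) ^ ε) ^ 5 := by rw [e3]; ring
      _ = ((2:ℝ) ^ k) ^ (s + t - 5 * ε) * (((2:ℝ) ^ k) ^ ε) ^ 5 * (q ^ k) ^ 5 := by ring
      _ = _ := by
        congr 1
        rw [← Real.rpow_natCast (((2:ℝ) ^ k) ^ ε), ← Real.rpow_mul h2k.le, ← Real.rpow_add h2k]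
        congr 1; push_cast; ring
  set A := ((2:ℝ) ^ k) ^ (t + s) with hA
  have hA0 : 0 < A := by positivity
  have hqk : 0 < q ^ k := by positivity
  have h3 : (q ^ k) ^ 4 * A ≤ (10 ^ 50 * 2 ^ β * ((k:ℝ) + 13) ^ 9 * q ^ k) * ((q ^ k) ^ 4 * A) := by
    calc (q ^ k) ^ 4 * A ≤ 10 ^ 50 * ((k:ℝ) + 13) ^ 9 * (T k).card := hfin
      _ ≤ 10 ^ 50 * ((k:ℝ) + 13) ^ 9 * (2 ^ β * (A * (q ^ k) ^ 5)) := by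
        have := (hTc k).trans_eq e1
        gcongr
        refine this.trans ?_
        gcongr
      _ = _ := by ring
  have h4 : 0 < (q ^ k) ^ 4 * A := by positivity
  nlinarith
end

noncomputable section
open Finset Classical MeasureTheory

abbrev E2 := EuclideanSpace ℝ (Fin 2)

lemma dimH_image_le' {E G : Type*} [NormedAddCommGroup E] [NormedSpace ℝ E] [FiniteDimensional ℝ E]
    [NormedAddCommGroup G] [NormedSpace ℝ G] {f : E → G} (hf : ContDiff ℝ 1 f) (A : Set E) : dimH (f '' A) ≤ dimH A :=
  ContDiffOn.dimH_image_le (s := Set.univ) hf.contDiffOn convex_univ (Set.subset_univ _)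

def phi (R c1 c2 : ℝ) (x : E2) : ℝ × ℝ := ((x 0 - c1) / R, (x 1 - c2) / R)
def psi (R c1 c2 : ℝ) (z : ℝ × ℝ) : E2 := !₂[R * z.1 + c1, R * z.2 + c2]
def Phi (R c1 c2 : ℝ) (p : E2 × ℝ) : Pt := ((p.1 0 - c1) / R, (p.1 1 - c2) / R, p.2 / R)
def Psi (R c1 c2 : ℝ) (z : Pt) : E2 × ℝ := (!₂[R * z.1 + c1, R * z.2.1 + c2], R * z.2.2)

lemma phi_contDiff (R c1 c2 : ℝ) : ContDiff ℝ 1 (phi R c1 c2) := by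
  unfold phi; fun_prop

lemma psi_contDiff (R c1 c2 : ℝ) : ContDiff ℝ 1 (psi R c1 c2) := by
  rw [contDiff_euclidean]
  intro i
  fin_cases i <;> simp [psi] <;> fun_prop

lemma Psi_contDiff (R c1 c2 : ℝ) : ContDiff ℝ 1 (Psi R c1 c2) := by
  unfold Psi
  refine ContDiff.prodMk ?_ (by fun_prop)
  rw [contDiff_euclidean]
  intro i
  fin_cases i <;> simp <;> fun_prop

lemma psi_phi (R c1 c2 : ℝ) (hR : R ≠ 0) (x : E2) : psi R c1 c2 (phi R c1 c2 x) = x := by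
  ext i
  fin_cases i <;> simp [psi, phi] <;> field_simp <;> ring

lemma Psi_Phi (R c1 c2 : ℝ) (hR : R ≠ 0) (p : E2 × ℝ) : Psi R c1 c2 (Phi R c1 c2 p) = p := by
  refine Prod.ext ?_ ?_
  · exact psi_phi R c1 c2 hR p.1
  · simp only [Psi, Phi]; field_simp

lemma phi_circ (R c1 c2 : ℝ) (hR : R ≠ 0) (p : E2 × ℝ) (x : E2) (hx : x ∈ Metric.sphere p.1 p.2) :
    phi R c1 c2 x ∈ circ (Phi R c1 c2 p) := by
  have h1 : dist x p.1 = p.2 := hx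
  have h2 : (x 0 - p.1 0) ^ 2 + (x 1 - p.1 1) ^ 2 = p.2 ^ 2 := by
    rw [← h1, EuclideanSpace.dist_eq, Real.sq_sqrt (by positivity), Fin.sum_univ_two, Real.dist_eq, Real.dist_eq, sq_abs, sq_abs]
  show ((x 0 - c1) / R - (p.1 0 - c1) / R) ^ 2 + ((x 1 - c2) / R - (p.1 1 - c2) / R) ^ 2 = (p.2 / R) ^ 2
  rw [div_pow, ← h2]
  field_simp
  ring

lemma furst_lower (s t ε β : ℝ) (ht : 0 < t) (hts : t ≤ s) (hs1 : s ≤ 1) (hε : 0 < ε) (hβ : 0 < β) (hβ2 : β ≤ s + t - 5 * ε)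
    (F : Set E2) (K : Set (E2 × ℝ)) (hKpos : ∀ p ∈ K, 0 < p.2) (hKdim : ENNReal.ofReal t < dimH K)
    (hF : ∀ p ∈ K, ENNReal.ofReal s < dimH (F ∩ Metric.sphere p.1 p.2)) : ENNReal.ofReal β ≤ dimH F := by
  let R : ℤ → ℝ := fun n => 2 ^ n
  have hR : ∀ n, 0 < R n := fun n => by positivity
  let A : ℤ × ℤ × ℤ → Set (E2 × ℝ) := fun m => {p | p ∈ K ∧ (R m.1 ≤ p.2 ∧ p.2 ≤ 2 * R m.1) ∧
    |p.1 0 / R m.1 - m.2.1 / 100| ≤ 1/100 ∧ |p.1 1 / R m.1 - m.2.2 / 100| ≤ 1/100}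
  have hcov : K ⊆ ⋃ m, A m := by
    intro p hp
    obtain ⟨n, hn1, hn2⟩ := exists_mem_Ico_zpow (hKpos p hp) (by norm_num : (1:ℝ) < 2)
    have hfl : ∀ y : ℝ, |y - ⌊100 * y⌋ / 100| ≤ 1/100 := by
      intro y
      rw [abs_le]
      constructor <;> linarith [Int.floor_le (100 * y), Int.lt_floor_add_one (100 * y)]
    refine Set.mem_iUnion.2 ⟨(n, ⌊100 * (p.1 0 / R n)⌋, ⌊100 * (p.1 1 / R n)⌋), hp, ⟨hn1, ?_⟩, hfl _, hfl _⟩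
    have : (2:ℝ) ^ (n+1) = 2 * R n := by rw [zpow_add_one₀ (by norm_num)]; exact mul_comm _ _
    linarith
  have h1 := hKdim.trans_le (dimH_mono hcov)
  rw [dimH_iUnion, lt_iSup_iff] at h1
  obtain ⟨m, hm⟩ := h1
  set r := R m.1 with hr
  have hr0 : 0 < r := hR _
  set c1 : ℝ := r * (m.2.1 / 100) with hc1
  set c2 : ℝ := r * (m.2.2 / 100) with hc2
  have hKim : ENNReal.ofReal t < dimH (Phi r c1 c2 '' A m) := by
    refine hm.trans_le ((dimH_mono ?_).trans (dimH_image_le' (Psi_contDiff r c1 c2) (Phi r c1 c2 '' A m)))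
    intro p hp
    exact ⟨_, ⟨p, hp, rfl⟩, Psi_Phi r c1 c2 hr0.ne' p⟩
  refine le_trans ?_ (dimH_image_le' (phi_contDiff r c1 c2) F)
  refine main_std s t ε β ht hts hs1 hε hβ hβ2 (Phi r c1 c2 '' A m) ?_ _ (ctn_pos t ht _ hKim) ?_
  · rintro _ ⟨p, ⟨hpK, ⟨h1, h2⟩, h3, h4⟩, rfl⟩
    simp only [Phi]
    refine ⟨⟨?_, ?_⟩, ?_, ?_⟩
    · rw [le_div_iff₀ hr0]; linarith
    · rw [div_le_iff₀ hr0]; linarith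
    · rw [sub_div, hc1, mul_div_cancel_left₀ _ hr0.ne']; exact h3
    · rw [sub_div, hc2, mul_div_cancel_left₀ _ hr0.ne']; exact h4
  · rintro _ ⟨p, ⟨hpK, -⟩, rfl⟩
    apply ctn_pos s (ht.trans_le hts)
    refine (hF p hpK).trans_le ((dimH_mono ?_).trans (dimH_image_le' (psi_contDiff r c1 c2) _))
    rintro x ⟨hxF, hxS⟩
    exact ⟨phi r c1 c2 x, ⟨⟨x, hxF, rfl⟩, phi_circ r c1 c2 hr0.ne' p x hxS⟩, psi_phi r c1 c2 hr0.ne' x⟩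

lemma furst_final (s t : ℝ) (hs0 : 1 / 2 < s) (hs1 : s ≤ 1) (ht0 : 0 < t) (ht1 : t ≤ 1)
    (F : Set E2) (K : Set (E2 × ℝ)) (hKpos : ∀ p ∈ K, 0 < p.2) (hKdim : ENNReal.ofReal t ≤ dimH K)
    (hF : ∀ p ∈ K, ENNReal.ofReal s ≤ dimH (F ∩ Metric.sphere p.1 p.2)) :
    ENNReal.ofReal ((2 * s - 1) * t + s) ≤ dimH F := by
  set t0 := min s t with ht0'
  have h0 : 0 < t0 := lt_min (by linarith) ht0
  have hle : (2 * s - 1) * t + s ≤ s + t0 := by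
    have : (2 * s - 1) * t ≤ t0 := le_min (by nlinarith) (by nlinarith)
    linarith
  refine (ENNReal.ofReal_le_ofReal hle).trans ?_
  by_contra hcon
  push Not at hcon
  have htop : dimH F ≠ ⊤ := ne_top_of_lt hcon
  obtain ⟨d, hd⟩ : ∃ d, d = (dimH F).toReal := ⟨_, rfl⟩
  have hd0 : 0 ≤ d := hd ▸ ENNReal.toReal_nonneg
  have hdF : dimH F = ENNReal.ofReal d := by rw [hd, ENNReal.ofReal_toReal htop]
  rw [hdF] at hcon
  have hlt : d < s + t0 := (ENNReal.ofReal_lt_ofReal_iff_of_nonneg hd0).1 hcon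
  set η := min ((s + t0 - d) / 8) (t0 / 8) with hη
  have hη0 : 0 < η := lt_min (by linarith) (by linarith)
  have hη1 : η ≤ (s + t0 - d) / 8 := min_le_left _ _
  have hη2 : η ≤ t0 / 8 := min_le_right _ _
  have hts : t0 ≤ s := min_le_left _ _
  have htt : t0 ≤ t := min_le_right _ _
  have := furst_lower (s - η) (t0 - η) η (s + t0 - 7 * η) (by linarith) (by linarith) (by linarith) hη0 (by linarith) (by linarith)
    F K hKpos (lt_of_lt_of_le ((ENNReal.ofReal_lt_ofReal_iff ht0).2 (by linarith)) hKdim)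
    (fun p hp => lt_of_lt_of_le ((ENNReal.ofReal_lt_ofReal_iff (by linarith)).2 (by linarith)) (hF p hp))
  rw [hdF] at this
  have := (ENNReal.ofReal_le_ofReal_iff hd0).1 this
  linarith
end

open scoped ENNReal
open MeasureTheory Metric Set

/-- **Dimension estimate for circular `(s,t)`-Furstenberg sets, `s > 1/2`.**
If `1/2 < s ≤ 1`, `0 < t ≤ 1` and `F ⊆ ℝ²` is a circular `(s,t)`-Furstenberg set,
then `dim_H F ≥ (2s−1)t + s`. -/
theorem circular_furstenberg_dim_lower_bound_large_s
    (s t : ℝ) (hs0 : 1 / 2 < s) (hs1 : s ≤ 1) (ht0 : 0 < t) (ht1 : t ≤ 1)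
    (F : Set (EuclideanSpace ℝ (Fin 2)))
    (K : Set (EuclideanSpace ℝ (Fin 2) × ℝ))
    (hKpos : ∀ p ∈ K, 0 < p.2)
    (hKdim : ENNReal.ofReal t ≤ dimH K)
    (hF : ∀ p ∈ K, ENNReal.ofReal s ≤ dimH (F ∩ Metric.sphere p.1 p.2)) :
    ENNReal.ofReal ((2 * s - 1) * t + s) ≤ dimH F := by
  exact furst_final s t hs0 hs1 ht0 ht1 F K hKpos hKdim hF
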